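/- arXiv:2211.11135 — 2 statements merged into one kernel-verified Lean document; each statement's English description precedes it below -/
import Mathlib

section
/- Write $\mathbb T^n=\mathbb R^n/\mathbb Z^n$, $\mathbb R^+=[0,+\infty)$, and let $B_{3/4}\subset\mathbb R^n$ be the open ball of radius $3/4$ centred at the origin. For $f$ on $\mathbb T^n\times\mathbb R^+\times B_{3/4}$ write $f^t_{p_0}(\theta)=f(\theta,t;p_0)$. For $\sigma\ge 1$ let $\mathcal B^+_\sigma$ be the space of real functions $f$ on $\mathbb T^n\times\mathbb R^+\times B_{3/4}$ such that $f$ is continuous, the partial derivative $\partial_{p_0}f$ exists everywhere and is continuous, and $f^t_{p_0}\in C^\sigma(\mathbb T^n)$ for all $(t,p_0)$ (for integer $\sigma$ this is the usual class $C^\sigma$, for non-integer $\sigma$ the Hölder class). For $m>1$ put $$|f|^+_{\sigma,m}=\sup_{(t,p_0)\in\mathbb R^+\times B_{3/4}}|f^t_{p_0}|_{C^\sigma}(1+t^m)+\sup_{(t,p_0)\in\mathbb R^+\times B_{3/4}}|(\partial_{p_0}f)^t_{p_0}|_{C^0}(1+t^{m-1}).$$ Let $\sigma\ge 1$ and $l>1$.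 Let $\omega\in C^1(B_{3/4},\mathbb R^n)$ and let $g\in\mathcal B^+_\sigma$ with $|g|^+_{\sigma,l+1}<\infty$; in the case $\sigma=1$ assume in addition that $\partial_\theta g$ is continuous on $\mathbb T^n\times\mathbb R^+\times B_{3/4}$. Then the integral in $$\kappa(\theta,t;p_0)=-\int_t^{+\infty}g(\theta+\omega(p_0)(\tau-t),\tau;p_0)\,d\tau$$ converges absolutely, $\kappa$ belongs to $\mathcal B^+_\sigma$, is a solution of the homological equation $$\omega(p_0)\cdot\partial_\theta\kappa(\theta,t;p_0)+\partial_t\kappa(\theta,t;p_0)=g(\theta,t;p_0)$$ on $\mathbb T^n\times\mathbb R^+\times B_{3/4}$ (the partial derivatives exist and the equation holds at every point, $\partial_t$ being one-sided at $t=0$), satisfies $\lim_{t\to+\infty}|\kappa^t_{p_0}|_{C^0}=0$ for each fixed $p_0\in B_{3/4}$, and is the unique solution in $\mathcal B^+_\sigma$ with this asymptotic property. Moreover, if $|\omega|_{C^1}<\infty$, then $$|\kappa|^+_{\sigma,l}\le C\,|g|^+_{\sigma,l+1}$$ with a constant $C$ depending only on $n$, $l$ and (an upper bound for) $|\omega|_{C^1}$.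 -/
open scoped ENNReal NNReal Topology
open Filter Metric Set MeasureTheory

noncomputable section

namespace HomEq

/-- `ℝⁿ` with the Euclidean norm. Functions on the torus `𝕋ⁿ = ℝⁿ/ℤⁿ` are `ℤⁿ`-periodic functions
on `ℝⁿ`. -/
abbrev E (n : ℕ) := EuclideanSpace ℝ (Fin n)

/-- The point of `ℤⁿ ⊂ ℝⁿ` with integer coordinates `k`. -/
def latt {n : ℕ} (k : Fin n → ℤ) : E n := WithLp.toLp 2 fun i => (k i : ℝ)

/-- The ball `B_{3/4}` of parameters. -/
abbrev B34 (n : ℕ) : Set (E n) := ball 0 (3 / 4)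

/-- The domain `𝕋ⁿ × ℝ⁺ × B_{3/4}`, with points `(θ, t, p₀)`. -/
def dom (n : ℕ) : Set (E n × ℝ × E n) := univ ×ˢ (Ici (0 : ℝ) ×ˢ B34 n)

/-- The sup norm `|f|_{C⁰}`. -/
def c0Norm {n : ℕ} {F : Type*} [NormedAddCommGroup F] (f : E n → F) : ℝ≥0∞ := ⨆ x, ‖f x‖ₑ

/-- The Hölder norm `|f|_{C^σ}`, `σ = k + μ` with `k = ⌊σ⌋` and `0 ≤ μ < 1`: the largest of the sup
norms of the derivatives of order at most `k`, plus, if `μ > 0`, the `μ`-Hölder seminorm of the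
derivative of order `k`. For `f` periodic, taking the quotients over `ℝⁿ` or with the distance of
`𝕋ⁿ` gives the same supremum. -/
def holderNorm {n : ℕ} (σ : ℝ) (f : E n → ℝ) : ℝ≥0∞ :=
  (⨆ i : Fin (⌊σ⌋₊ + 1), c0Norm (iteratedFDeriv ℝ (i : ℕ) f)) +
    if (⌊σ⌋₊ : ℝ) = σ then 0 else
      ⨆ (x : E n) (y : E n) (_ : x ≠ y),
        ENNReal.ofReal (‖iteratedFDeriv ℝ ⌊σ⌋₊ f x - iteratedFDeriv ℝ ⌊σ⌋₊ f y‖ /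
          ‖x - y‖ ^ (σ - (⌊σ⌋₊ : ℝ)))

/-- `f ∈ C^σ(𝕋ⁿ)`. -/
def MemHolder {n : ℕ} (σ : ℝ) (f : E n → ℝ) : Prop :=
  (∀ (x : E n) (k : Fin n → ℤ), f (x + latt k) = f x) ∧
    ContDiff ℝ ⌊σ⌋₊ f ∧ holderNorm σ f < ⊤

/-- The partial derivative `∂_θ f (θ, t; p₀)`. -/
def dTheta {n : ℕ} (f : E n → ℝ → E n → ℝ) (θ : E n) (t : ℝ) (p : E n) : E n →L[ℝ] ℝ :=
  fderiv ℝ (fun θ' => f θ' t p) θ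

/-- The partial derivative `∂_{p₀} f (θ, t; p₀)`. -/
def dParam {n : ℕ} (f : E n → ℝ → E n → ℝ) (θ : E n) (t : ℝ) (p : E n) : E n →L[ℝ] ℝ :=
  fderiv ℝ (fun p' => f θ t p') p

/-- The partial derivative `∂_t f (θ, t; p₀)` on `ℝ⁺ = [0, ∞)`, one-sided at `t = 0`. -/
def dTime {n : ℕ} (f : E n → ℝ → E n → ℝ) (θ : E n) (t : ℝ) (p : E n) : ℝ :=
  derivWithin (fun s => f θ s p) (Ici 0) t

/-- The space `B⁺_σ`: on `𝕋ⁿ × ℝ⁺ × B_{3/4}` the function `f` is continuous, `∂_{p₀} f` exists and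
is continuous, and `f^t_{p₀} ∈ C^σ(𝕋ⁿ)` for all `(t, p₀)`. Values of `f` off this domain do not
matter. -/
structure MemB {n : ℕ} (σ : ℝ) (f : E n → ℝ → E n → ℝ) : Prop where
  continuousOn : ContinuousOn (fun x : E n × ℝ × E n => f x.1 x.2.1 x.2.2) (dom n)
  differentiableAt_param : ∀ θ : E n, ∀ t ∈ Ici (0 : ℝ), ∀ p ∈ B34 n,
    DifferentiableAt ℝ (fun p' => f θ t p') p
  continuousOn_dParam : ContinuousOn (fun x : E n × ℝ × E n => dParam f x.1 x.2.1 x.2.2) (dom n)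
  memHolder : ∀ t ∈ Ici (0 : ℝ), ∀ p ∈ B34 n, MemHolder σ (fun θ => f θ t p)

/-- The weighted norm `|f|⁺_{σ,l}`. -/
def wNorm {n : ℕ} (σ l : ℝ) (f : E n → ℝ → E n → ℝ) : ℝ≥0∞ :=
  (⨆ t ∈ Ici (0 : ℝ), ⨆ p ∈ B34 n,
      holderNorm σ (fun θ => f θ t p) * ENNReal.ofReal (1 + t ^ l)) +
    ⨆ t ∈ Ici (0 : ℝ), ⨆ p ∈ B34 n,
      c0Norm (fun θ => dParam f θ t p) * ENNReal.ofReal (1 + t ^ (l - 1))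

/-- The norm `|ω|_{C¹}` on the open ball `B_{3/4}`. -/
def c1Norm {n : ℕ} (ω : E n → E n) : ℝ≥0∞ :=
  (⨆ p ∈ B34 n, ‖ω p‖ₑ) ⊔ ⨆ p ∈ B34 n, ‖fderiv ℝ ω p‖ₑ

/-- `κ` solves `ω(p₀)·∂_θ κ + ∂_t κ = g` on `𝕋ⁿ × ℝ⁺ × B_{3/4}`: the partial derivatives exist and
the equation holds at every point. -/
def IsSolution {n : ℕ} (ω : E n → E n) (g κ : E n → ℝ → E n → ℝ) : Prop :=
  ∀ θ : E n, ∀ t ∈ Ici (0 : ℝ), ∀ p ∈ B34 n,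
    DifferentiableAt ℝ (fun θ' => κ θ' t p) θ ∧
    DifferentiableWithinAt ℝ (fun s => κ θ s p) (Ici 0) t ∧
    dTheta κ θ t p (ω p) + dTime κ θ t p = g θ t p

/-- `|κ^t_{p₀}|_{C⁰} → 0` as `t → +∞`, for each fixed `p₀ ∈ B_{3/4}`. -/
def Vanishes {n : ℕ} (κ : E n → ℝ → E n → ℝ) : Prop :=
  ∀ p ∈ B34 n, Tendsto (fun t : ℝ => c0Norm fun θ => κ θ t p) atTop (𝓝 0)

/-- `κ(θ, t; p₀) = -∫_t^∞ g(θ + ω(p₀)(τ - t), τ; p₀) dτ`. -/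
def kappa {n : ℕ} (ω : E n → E n) (g : E n → ℝ → E n → ℝ) (θ : E n) (t : ℝ) (p : E n) : ℝ :=
  -∫ τ in Ioi t, g (θ + (τ - t) • ω p) τ p

end HomEq

end

open HomEq

namespace HomEq

section ParametricIntegral

/-- Measurability in a parameter of the derivative in a finite-dimensional variable. -/
theorem aestronglyMeasurable_fderiv_param {V F α : Type*} [NormedAddCommGroup V] [NormedSpace ℝ V]
    [FiniteDimensional ℝ V] [NormedAddCommGroup F] [NormedSpace ℝ F] [MeasurableSpace α]
    {μ : Measure α} {f : V → α → F} (hm : ∀ x, AEStronglyMeasurable (f x) μ)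
    (hd : ∀ᵐ a ∂μ, Differentiable ℝ (fun x => f x a)) (x : V) :
    AEStronglyMeasurable (fun a => fderiv ℝ (fun x => f x a) x) μ := by
  have hv : ∀ v : V, AEStronglyMeasurable (fun a => fderiv ℝ (fun x => f x a) x v) μ := by
    intro v
    refine aestronglyMeasurable_of_tendsto_ae (atTop : Filter ℕ)
      (f := fun k a => (k : ℝ) • (f (x + (k : ℝ)⁻¹ • v) a - f x a)) (fun k => ?_) ?_
    · exact ((hm _).sub (hm _)).const_smul _
    · filter_upwards [hd] with a ha
      have h := (ha x).hasFDerivAt.lim_real v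
      exact h.comp tendsto_natCast_atTop_atTop
  let b := Module.finBasis ℝ V
  have hrep : ∀ L : V →L[ℝ] F, L = ∑ i, ContinuousLinearMap.smulRightL ℝ V F
      (LinearMap.toContinuousLinearMap (b.coord i)) (L (b i)) := by
    intro L
    ext w
    have hw := congrArg L (b.sum_repr w)
    simp only [map_sum, map_smul] at hw
    simpa using hw.symm
  have h2 : (fun a => fderiv ℝ (fun x => f x a) x) = fun a =>
      ∑ i, ContinuousLinearMap.smulRightL ℝ V F
      (LinearMap.toContinuousLinearMap (b.coord i)) (fderiv ℝ (fun x => f x a) x (b i)) :=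
    funext fun a => hrep _
  rw [h2]
  refine Finset.aestronglyMeasurable_fun_sum _ fun i _ => ?_
  exact (ContinuousLinearMap.continuous _).comp_aestronglyMeasurable (hv (b i))

/-- Derivatives of order at most `k` of a parametric integral, with bounds on each order. -/
theorem contDiff_integral_and_norm_iteratedFDeriv_le {V α : Type} [NormedAddCommGroup V]
    [NormedSpace ℝ V] [FiniteDimensional ℝ V] [MeasurableSpace α] {μ : Measure α} (k : ℕ) :
    ∀ {F : Type} [NormedAddCommGroup F] [NormedSpace ℝ F] [CompleteSpace F]
      {f : V → α → F} {b : ℕ → α → ℝ} (_ : ∀ x, AEStronglyMeasurable (f x) μ)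
      (_ : ∀ᵐ a ∂μ, ContDiff ℝ k (fun x => f x a))
      (_ : ∀ i ≤ k, Integrable (b i) μ)
      (_ : ∀ i ≤ k, ∀ᵐ a ∂μ, ∀ x, ‖iteratedFDeriv ℝ i (fun x => f x a) x‖ ≤ b i a),
      ContDiff ℝ k (fun x => ∫ a, f x a ∂μ) ∧
        ∀ i ≤ k, ∀ x, ‖iteratedFDeriv ℝ i (fun x => ∫ a, f x a ∂μ) x‖ ≤ ∫ a, b i a ∂μ := by
  induction k with
  | zero =>
    intro F _ _ _ f b hm hd hi hb
    have hb0 : ∀ᵐ a ∂μ, ∀ x, ‖f x a‖ ≤ b 0 a := by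
      simpa only [norm_iteratedFDeriv_zero] using hb 0 le_rfl
    refine ⟨?_, ?_⟩
    · refine contDiff_zero.2 (continuous_of_dominated hm
        (fun x => hb0.mono fun a ha => ha x) (hi 0 le_rfl) ?_)
      filter_upwards [hd] with a ha using ha.continuous
    · intro i hi0 x
      obtain rfl : i = 0 := by omega
      rw [norm_iteratedFDeriv_zero]
      exact norm_integral_le_of_norm_le (hi 0 le_rfl) (hb0.mono fun a ha => ha x)
  | succ k ih =>
    intro F _ _ _ f b hm hd hi hb
    have hb0 : ∀ᵐ a ∂μ, ∀ x, ‖f x a‖ ≤ b 0 a := by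
      simpa only [norm_iteratedFDeriv_zero] using hb 0 (Nat.zero_le _)
    have hdiff : ∀ᵐ a ∂μ, Differentiable ℝ (fun x => f x a) := by
      filter_upwards [hd] with a ha using ha.differentiable (by simp)
    have hb1 : ∀ᵐ a ∂μ, ∀ x, ‖fderiv ℝ (fun x => f x a) x‖ ≤ b 1 a := by
      simpa only [norm_iteratedFDeriv_one] using hb 1 (by omega)
    have hm' := aestronglyMeasurable_fderiv_param hm hdiff
    have hder : ∀ x, HasFDerivAt (fun x => ∫ a, f x a ∂μ)
        (∫ a, fderiv ℝ (fun x => f x a) x ∂μ) x := by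
      intro x
      refine hasFDerivAt_integral_of_dominated_of_fderiv_le (s := univ) univ_mem
        (F' := fun x a => fderiv ℝ (fun x => f x a) x)
        (Eventually.of_forall hm) ?_ (hm' x) ?_ (hi 1 (by omega)) ?_
      · exact (hi 0 (by omega)).mono' (hm x) (hb0.mono fun a ha => ha x)
      · filter_upwards [hb1] with a ha y _ using ha y
      · filter_upwards [hdiff] with a ha y _ using (ha y).hasFDerivAt
    have hfd : fderiv ℝ (fun x => ∫ a, f x a ∂μ) =
        fun x => ∫ a, fderiv ℝ (fun x => f x a) x ∂μ := funext fun x => (hder x).fderiv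
    have key := ih (f := fun x a => fderiv ℝ (fun x => f x a) x) (b := fun i => b (i + 1)) hm'
      (by
        filter_upwards [hd] with a ha
        exact ha.fderiv_right (m := k) (by norm_cast))
      (fun i hik => hi _ (by omega))
      (fun i hik => by
        filter_upwards [hb (i + 1) (by omega)] with a ha x
        exact (norm_iteratedFDeriv_fderiv (𝕜 := ℝ)).trans_le (ha x))
    refine ⟨?_, ?_⟩
    · have : ((k + 1 : ℕ) : WithTop ℕ∞) = (k : WithTop ℕ∞) + 1 := by norm_cast
      rw [this, contDiff_succ_iff_fderiv]
      refine ⟨fun x => (hder x).differentiableAt, by simp, ?_⟩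
      rw [hfd]
      exact key.1
    · rintro (_ | i) hik x
      · rw [norm_iteratedFDeriv_zero]
        exact norm_integral_le_of_norm_le (hi 0 hik) (hb0.mono fun a ha => ha x)
      · rw [← norm_iteratedFDeriv_fderiv, hfd]
        exact key.2 i (by omega) x

end ParametricIntegral

section Decay

theorem one_add_rpow_le {r t : ℝ} (hr : 0 ≤ r) (ht : 0 ≤ t) :
    (1 + t) ^ r ≤ 2 ^ r * (1 + t ^ r) := by
  have h1 : (1 + t) ^ r ≤ (2 * max 1 t) ^ r :=
    Real.rpow_le_rpow (by linarith) (by linarith [le_max_left 1 t, le_max_right 1 t]) hr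
  rw [Real.mul_rpow (by norm_num) (by positivity)] at h1
  refine h1.trans (mul_le_mul_of_nonneg_left ?_ (by positivity))
  rcases le_total 1 t with h | h
  · rw [max_eq_right h]; linarith
  · rw [max_eq_left h, Real.one_rpow]; linarith [Real.rpow_nonneg ht r]

theorem one_add_rpow_le_two_mul {r t : ℝ} (hr : 0 ≤ r) (ht : 0 ≤ t) :
    1 + t ^ r ≤ 2 * (1 + t) ^ r := by
  have h1 : (1 : ℝ) ≤ (1 + t) ^ r := Real.one_le_rpow (by linarith) hr
  have h2 : t ^ r ≤ (1 + t) ^ r := Real.rpow_le_rpow ht (by linarith) hr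
  linarith

theorem integrableOn_one_add_rpow {r t : ℝ} (hr : 1 < r) (ht : 0 ≤ t) :
    IntegrableOn (fun s : ℝ => (1 + (t + s)) ^ (-r)) (Ioi 0) := by
  have := integrableOn_add_rpow_Ioi_of_lt (a := -r) (c := 0) (m := 1 + t) (by linarith)
    (by linarith)
  refine this.congr_fun (fun s _ => ?_) measurableSet_Ioi
  simp only
  congr 1; ring

theorem integral_Ioi_shift {F : Type*} [NormedAddCommGroup F] [NormedSpace ℝ F] (f : ℝ → F)
    (t : ℝ) : ∫ τ in Ioi t, f τ = ∫ s in Ioi 0, f (t + s) := by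
  have := (measurePreserving_add_left volume t).setIntegral_preimage_emb
    (measurableEmbedding_addLeft t) f (Ioi t)
  rw [← this]
  simp

theorem integrableOn_Ioi_shift {F : Type*} [NormedAddCommGroup F] (f : ℝ → F)
    (t : ℝ) : IntegrableOn f (Ioi t) ↔ IntegrableOn (fun s => f (t + s)) (Ioi 0) := by
  have := (measurePreserving_add_left volume t).integrableOn_comp_preimage
    (measurableEmbedding_addLeft t) (f := f) (s := Ioi t)
  rw [← this]
  simp [Function.comp_def]

theorem integral_one_add_rpow {r t : ℝ} (hr : 1 < r) (ht : 0 ≤ t) :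
    ∫ s in Ioi (0 : ℝ), (1 + (t + s)) ^ (-r) = (1 + t) ^ (-(r - 1)) / (r - 1) := by
  have h := integral_Ioi_rpow_of_lt (a := -r) (by linarith) (c := 1 + t) (by linarith)
  rw [integral_Ioi_shift] at h
  simp only [add_assoc] at h
  rw [h, show -r + 1 = -(r - 1) by ring, neg_div_neg_eq]

end Decay

section Norms

variable {n : ℕ}

theorem norm_le_of_c0Norm_le {F : Type*} [NormedAddCommGroup F] {f : E n → F} {c : ℝ}
    (hc : 0 ≤ c) (h : c0Norm f ≤ ENNReal.ofReal c) (x : E n) : ‖f x‖ ≤ c := by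
  have h1 : ‖f x‖ₑ ≤ ENNReal.ofReal c := (le_iSup (fun x => ‖f x‖ₑ) x).trans h
  rwa [← ofReal_norm, ENNReal.ofReal_le_ofReal_iff hc] at h1

theorem c0Norm_le {F : Type*} [NormedAddCommGroup F] {f : E n → F} {c : ℝ}
    (h : ∀ x, ‖f x‖ ≤ c) : c0Norm f ≤ ENNReal.ofReal c := by
  refine iSup_le fun x => ?_
  rw [← ofReal_norm]
  exact ENNReal.ofReal_le_ofReal (h x)

theorem norm_iteratedFDeriv_le_of_holderNorm_le {σ c : ℝ} {f : E n → ℝ} (hc : 0 ≤ c)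
    (h : holderNorm σ f ≤ ENNReal.ofReal c) {i : ℕ} (hi : i ≤ ⌊σ⌋₊) (x : E n) :
    ‖iteratedFDeriv ℝ i f x‖ ≤ c := by
  refine norm_le_of_c0Norm_le hc ?_ x
  refine le_trans ?_ (le_self_add.trans h)
  exact le_iSup (fun i : Fin (⌊σ⌋₊ + 1) => c0Norm (iteratedFDeriv ℝ (i : ℕ) f))
    ⟨i, Nat.lt_succ_of_le hi⟩

theorem norm_iteratedFDeriv_sub_le_of_holderNorm_le {σ c : ℝ} {f : E n → ℝ} (hc : 0 ≤ c)
    (h : holderNorm σ f ≤ ENNReal.ofReal c) (hσ : (⌊σ⌋₊ : ℝ) ≠ σ) (x y : E n) :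
    ‖iteratedFDeriv ℝ ⌊σ⌋₊ f x - iteratedFDeriv ℝ ⌊σ⌋₊ f y‖ ≤
      c * ‖x - y‖ ^ (σ - (⌊σ⌋₊ : ℝ)) := by
  rcases eq_or_ne x y with rfl | hxy
  · simp only [sub_self, norm_zero]; positivity
  have h1 := le_add_self.trans h
  rw [if_neg hσ] at h1
  have h2 : ENNReal.ofReal (‖iteratedFDeriv ℝ ⌊σ⌋₊ f x - iteratedFDeriv ℝ ⌊σ⌋₊ f y‖ /
          ‖x - y‖ ^ (σ - (⌊σ⌋₊ : ℝ))) ≤ ENNReal.ofReal c :=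
    (le_iSup_of_le x (le_iSup_of_le y (by rw [iSup_pos hxy]))).trans h1
  rw [ENNReal.ofReal_le_ofReal_iff hc] at h2
  rwa [div_le_iff₀ (Real.rpow_pos_of_pos (norm_sub_pos_iff.2 hxy) _)] at h2

theorem holderNorm_le {σ c : ℝ} {f : E n → ℝ} (hc : 0 ≤ c)
    (h : ∀ i ≤ ⌊σ⌋₊, ∀ x, ‖iteratedFDeriv ℝ i f x‖ ≤ c)
    (h' : (⌊σ⌋₊ : ℝ) ≠ σ → ∀ x y, ‖iteratedFDeriv ℝ ⌊σ⌋₊ f x - iteratedFDeriv ℝ ⌊σ⌋₊ f y‖ ≤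
      c * ‖x - y‖ ^ (σ - (⌊σ⌋₊ : ℝ))) :
    holderNorm σ f ≤ ENNReal.ofReal (2 * c) := by
  rw [two_mul, ENNReal.ofReal_add hc hc]
  refine add_le_add (iSup_le fun i => c0Norm_le (h i (Nat.lt_succ_iff.1 i.2))) ?_
  split_ifs with hσ
  · exact zero_le
  · refine iSup_le fun x => iSup_le fun y => iSup_le fun hxy => ENNReal.ofReal_le_ofReal ?_
    rw [div_le_iff₀ (Real.rpow_pos_of_pos (norm_sub_pos_iff.2 hxy) _)]
    exact h' hσ x y

/-- Pointwise decay of a function and of its derivatives, the form in which a bound on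
`wNorm σ (l + 1) g` is used. -/
structure HasDecay (σ l K : ℝ) (g : E n → ℝ → E n → ℝ) : Prop where
  nonneg : 0 ≤ K
  holder : ∀ t, 0 ≤ t → ∀ p ∈ B34 n,
    holderNorm σ (fun θ => g θ t p) ≤ ENNReal.ofReal (K * (1 + t) ^ (-(l + 1)))
  param : ∀ θ t, 0 ≤ t → ∀ p ∈ B34 n, ‖dParam g θ t p‖ ≤ K * (1 + t) ^ (-l)

theorem le_ofReal_of_mul_weight_le {a N : ℝ≥0∞} (hN : N ≠ ⊤) {r s t : ℝ} (hr : 0 ≤ r)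
    (hrs : r ≤ s) (ht : 0 ≤ t) (h : a * ENNReal.ofReal (1 + t ^ r) ≤ N) :
    a ≤ ENNReal.ofReal (N.toReal * 2 ^ s * (1 + t) ^ (-r)) := by
  have hpos : 0 < 1 + t ^ r := by positivity
  have h1 : a ≤ N / ENNReal.ofReal (1 + t ^ r) := by
    rw [ENNReal.le_div_iff_mul_le (Or.inl (by simpa using hpos)) (Or.inl ENNReal.ofReal_ne_top)]
    exact h
  refine h1.trans ?_
  rw [← ENNReal.ofReal_toReal hN, ← ENNReal.ofReal_div_of_pos hpos,
    ENNReal.toReal_ofReal ENNReal.toReal_nonneg]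
  refine ENNReal.ofReal_le_ofReal ?_
  rw [div_le_iff₀ hpos, mul_assoc, mul_assoc]
  refine le_mul_of_one_le_right ENNReal.toReal_nonneg ?_
  have h2 := one_add_rpow_le hr ht
  have h3 : (2 : ℝ) ^ r ≤ 2 ^ s := Real.rpow_le_rpow_of_exponent_le (by norm_num) hrs
  have h4 : 0 < (1 + t) ^ r := by positivity
  rw [Real.rpow_neg (by linarith), mul_left_comm, ← div_eq_inv_mul, le_div_iff₀ h4, one_mul]
  exact h2.trans (mul_le_mul_of_nonneg_right h3 hpos.le)

theorem hasDecay_of_wNorm_lt_top {σ l : ℝ} (hl : 1 < l) {g : E n → ℝ → E n → ℝ}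
    (hg : wNorm σ (l + 1) g < ⊤) :
    HasDecay σ l ((wNorm σ (l + 1) g).toReal * 2 ^ (l + 1)) g where
  nonneg := by positivity
  holder t ht p hp := by
    refine le_ofReal_of_mul_weight_le hg.ne (by linarith) le_rfl ht ?_
    refine le_trans ?_ le_self_add
    exact le_iSup₂_of_le t ht (le_iSup₂_of_le p hp le_rfl)
  param θ t ht p hp := by
    refine norm_le_of_c0Norm_le (f := fun θ => dParam g θ t p) (by positivity) ?_ θ
    refine le_ofReal_of_mul_weight_le hg.ne (by linarith) (by linarith) ht ?_
    refine le_trans ?_ le_add_self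
    refine le_iSup₂_of_le t ht (le_iSup₂_of_le p hp ?_)
    rw [add_sub_cancel_right]

theorem mul_weight_le {a : ℝ≥0∞} {c r t : ℝ} (hc : 0 ≤ c) (hr : 0 ≤ r) (ht : 0 ≤ t)
    (h : a ≤ ENNReal.ofReal (c * (1 + t) ^ (-r))) :
    a * ENNReal.ofReal (1 + t ^ r) ≤ ENNReal.ofReal (2 * c) := by
  refine (mul_le_mul_left h _).trans ?_
  rw [← ENNReal.ofReal_mul (by positivity)]
  refine ENNReal.ofReal_le_ofReal ?_
  have h1 := one_add_rpow_le_two_mul hr ht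
  have h4 : 0 < (1 + t) ^ r := by positivity
  rw [Real.rpow_neg (by linarith), mul_assoc, ← div_eq_inv_mul, mul_comm 2 c]
  refine mul_le_mul_of_nonneg_left ?_ hc
  rwa [div_le_iff₀ h4]

theorem wNorm_le {σ l c d : ℝ} (hl : 1 < l) (hc : 0 ≤ c) (hd : 0 ≤ d) {f : E n → ℝ → E n → ℝ}
    (h : ∀ t, 0 ≤ t → ∀ p ∈ B34 n,
      holderNorm σ (fun θ => f θ t p) ≤ ENNReal.ofReal (c * (1 + t) ^ (-l)))
    (h' : ∀ θ t, 0 ≤ t → ∀ p ∈ B34 n, ‖dParam f θ t p‖ ≤ d * (1 + t) ^ (-(l - 1))) :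
    wNorm σ l f ≤ ENNReal.ofReal (2 * c + 2 * d) := by
  rw [ENNReal.ofReal_add (by positivity) (by positivity)]
  refine add_le_add (iSup₂_le fun t ht => iSup₂_le fun p hp => ?_)
    (iSup₂_le fun t ht => iSup₂_le fun p hp => ?_)
  · exact mul_weight_le hc (by linarith) ht (h t ht p hp)
  · exact mul_weight_le hd (by linarith) ht (c0Norm_le fun θ => h' θ t ht p hp)

end Norms

section Regularity

variable {n : ℕ} {σ l K : ℝ} {g : E n → ℝ → E n → ℝ}

theorem HasDecay.norm_iteratedFDeriv_le (hg : HasDecay σ l K g) {t : ℝ} (ht : 0 ≤ t) {p : E n}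
    (hp : p ∈ B34 n) {i : ℕ} (hi : i ≤ ⌊σ⌋₊) (x : E n) :
    ‖iteratedFDeriv ℝ i (fun θ => g θ t p) x‖ ≤ K * (1 + t) ^ (-(l + 1)) :=
  norm_iteratedFDeriv_le_of_holderNorm_le (mul_nonneg hg.nonneg (by positivity))
    (hg.holder t ht p hp) hi x

theorem HasDecay.norm_le (hg : HasDecay σ l K g) {t : ℝ} (ht : 0 ≤ t) {p : E n}
    (hp : p ∈ B34 n) (x : E n) : ‖g x t p‖ ≤ K * (1 + t) ^ (-(l + 1)) := by
  simpa only [norm_iteratedFDeriv_zero] using hg.norm_iteratedFDeriv_le ht hp (Nat.zero_le _) x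

theorem HasDecay.norm_dTheta_le (hg : HasDecay σ l K g) (hσ : 1 ≤ σ) {t : ℝ} (ht : 0 ≤ t)
    {p : E n} (hp : p ∈ B34 n) (x : E n) : ‖dTheta g x t p‖ ≤ K * (1 + t) ^ (-(l + 1)) := by
  have h1 : 1 ≤ ⌊σ⌋₊ := Nat.le_floor (by simpa using hσ)
  simpa only [norm_iteratedFDeriv_one, dTheta] using hg.norm_iteratedFDeriv_le ht hp h1 x

theorem norm_fderiv_sub_le_norm_iteratedFDeriv_one_sub {V F : Type*} [NormedAddCommGroup V]
    [NormedSpace ℝ V] [NormedAddCommGroup F] [NormedSpace ℝ F] (f : V → F) (x y : V) :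
    ‖fderiv ℝ f x - fderiv ℝ f y‖ ≤ ‖iteratedFDeriv ℝ 1 f x - iteratedFDeriv ℝ 1 f y‖ := by
  refine ContinuousLinearMap.opNorm_le_bound _ (norm_nonneg _) fun v => ?_
  simpa using (iteratedFDeriv ℝ 1 f x - iteratedFDeriv ℝ 1 f y).le_opNorm fun _ => v

/-- For `σ > 1` the derivative in `θ` is Hölder continuous, uniformly in the parameters. -/
theorem HasDecay.exists_holder_dTheta (hg : HasDecay σ l K g) (hB : MemB σ g) (hl : 0 ≤ l)
    (hσ : 1 < σ) : ∃ α : ℝ, 0 < α ∧ ∀ t, 0 ≤ t → ∀ p ∈ B34 n, ∀ x y,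
      ‖dTheta g x t p - dTheta g y t p‖ ≤ K * ‖x - y‖ ^ α := by
  have hw : ∀ t : ℝ, 0 ≤ t → K * (1 + t) ^ (-(l + 1)) ≤ K := fun t ht =>
    mul_le_of_le_one_right hg.nonneg
      (Real.rpow_le_one_of_one_le_of_nonpos (by linarith) (by linarith))
  rcases lt_or_ge σ 2 with h2 | h2
  · have hf : ⌊σ⌋₊ = 1 := by
      rw [Nat.floor_eq_iff (by linarith)]; norm_num; exact ⟨hσ.le, by linarith⟩
    refine ⟨σ - 1, by linarith, fun t ht p hp x y => ?_⟩
    have h := norm_iteratedFDeriv_sub_le_of_holderNorm_le (σ := σ) hg.nonneg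
      ((hg.holder t ht p hp).trans (ENNReal.ofReal_le_ofReal (hw t ht)))
      (by rw [hf]; push_cast; exact hσ.ne) x y
    rw [hf] at h
    unfold dTheta
    refine (norm_fderiv_sub_le_norm_iteratedFDeriv_one_sub _ x y).trans ?_
    simpa using h
  · have hf : 2 ≤ ⌊σ⌋₊ := Nat.le_floor (by simpa using h2)
    refine ⟨1, one_pos, fun t ht p hp x y => ?_⟩
    have hC : ContDiff ℝ 2 (fun θ => g θ t p) :=
      (hB.memHolder t ht p hp).2.1.of_le (by exact_mod_cast hf)
    have hd : Differentiable ℝ (fderiv ℝ (fun θ => g θ t p)) :=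
      (hC.fderiv_right (m := 1) (by norm_num)).differentiable (by simp)
    have hb : ∀ z, ‖fderiv ℝ (fderiv ℝ (fun θ => g θ t p)) z‖ ≤ K := by
      intro z
      rw [← norm_iteratedFDeriv_one, norm_iteratedFDeriv_fderiv]
      exact (hg.norm_iteratedFDeriv_le ht hp hf z).trans (hw t ht)
    rw [Real.rpow_one]
    exact convex_univ.norm_image_sub_le_of_norm_fderiv_le (fun z _ => hd z)
      (fun z _ => hb z) (mem_univ y) (mem_univ x)

/-- The derivative in `θ` of a continuous family whose derivatives in `θ` are uniformly Hölder is
jointly continuous. -/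
theorem continuousOn_fderiv_of_uniform_holder {V X : Type*} [NormedAddCommGroup V]
    [NormedSpace ℝ V] [FiniteDimensional ℝ V] [TopologicalSpace X] {S : Set X} {f : V → X → ℝ}
    (hf : ContinuousOn (fun z : V × X => f z.1 z.2) (univ ×ˢ S))
    (hd : ∀ y ∈ S, Differentiable ℝ fun x => f x y) {K α : ℝ} (hK : 0 ≤ K) (hα : 0 < α)
    (hh : ∀ y ∈ S, ∀ x x', ‖fderiv ℝ (fun x => f x y) x - fderiv ℝ (fun x => f x y) x'‖ ≤
      K * ‖x - x'‖ ^ α) :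
    ContinuousOn (fun z : V × X => fderiv ℝ (fun x => f x z.2) z.1) (univ ×ˢ S) := by
  rw [continuousOn_clm_apply]
  intro v
  let δ : ℕ → ℝ := fun k => ((k : ℝ) + 1)⁻¹
  have hδ : ∀ k, 0 < δ k := fun k => by positivity
  have hδ0 : Tendsto δ atTop (𝓝 0) := tendsto_inv_atTop_zero.comp
    (tendsto_atTop_add_const_right _ _ tendsto_natCast_atTop_atTop)
  have hlim : TendstoUniformlyOn
      (fun (k : ℕ) (z : V × X) => (δ k)⁻¹ * (f (z.1 + δ k • v) z.2 - f z.1 z.2))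
      (fun z => fderiv ℝ (fun x => f x z.2) z.1 v) atTop (univ ×ˢ S) := by
    rw [Metric.tendstoUniformlyOn_iff]
    intro ε hε
    have hsmall : Tendsto (fun k => K * (δ k * ‖v‖) ^ α * ‖v‖) atTop (𝓝 0) := by
      have h1 : Tendsto (fun k => δ k * ‖v‖) atTop (𝓝 0) := by simpa using hδ0.mul_const ‖v‖
      have h2 := h1.rpow_const (p := α) (Or.inr hα.le)
      rw [Real.zero_rpow hα.ne'] at h2
      simpa using (h2.const_mul K).mul_const ‖v‖
    filter_upwards [hsmall.eventually_lt_const hε] with k hk z hz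
    refine lt_of_le_of_lt ?_ hk
    set L := fderiv ℝ (fun x => f x z.2) z.1
    have hmv := (convex_closedBall z.1 (δ k * ‖v‖)).norm_image_sub_le_of_norm_fderiv_le' (𝕜 := ℝ)
      (f := fun x => f x z.2) (φ := L) (C := K * (δ k * ‖v‖) ^ α) (x := z.1) (y := z.1 + δ k • v)
      (fun x _ => hd _ hz.2 x)
      (fun x hx => (hh _ hz.2 x z.1).trans (mul_le_mul_of_nonneg_left
        (Real.rpow_le_rpow (norm_nonneg _) (mem_closedBall_iff_norm.1 hx) hα.le) hK))
      (mem_closedBall_self (mul_nonneg (hδ k).le (norm_nonneg _)))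
      (by rw [mem_closedBall_iff_norm]; simp [norm_smul, abs_of_pos (hδ k)])
    rw [add_sub_cancel_left, map_smul, norm_smul, Real.norm_of_nonneg (hδ k).le] at hmv
    rw [dist_eq_norm, norm_sub_rev]
    have heq : (δ k)⁻¹ * (f (z.1 + δ k • v) z.2 - f z.1 z.2) - L v =
        (δ k)⁻¹ * (f (z.1 + δ k • v) z.2 - f z.1 z.2 - δ k • L v) := by
      rw [smul_eq_mul]; field_simp [(hδ k).ne']
    rw [heq, norm_mul, norm_inv, Real.norm_of_nonneg (hδ k).le, inv_mul_le_iff₀ (hδ k)]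
    linarith
  refine hlim.continuousOn (Frequently.of_forall fun k => ?_)
  refine continuousOn_const.mul (ContinuousOn.sub ?_ hf)
  exact hf.comp (f := fun z : V × X => (z.1 + δ k • v, z.2)) (by fun_prop)
    fun z hz => ⟨mem_univ _, hz.2⟩

theorem continuousOn_dTheta (hg : HasDecay σ l K g) (hB : MemB σ g) (hl : 0 ≤ l) (hσ : 1 ≤ σ)
    (h1 : σ = 1 → ContinuousOn (fun x : E n × ℝ × E n => dTheta g x.1 x.2.1 x.2.2) (dom n)) :
    ContinuousOn (fun x : E n × ℝ × E n => dTheta g x.1 x.2.1 x.2.2) (dom n) := by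
  rcases hσ.eq_or_lt with h | h
  · exact h1 h.symm
  obtain ⟨α, hα, hh⟩ := hg.exists_holder_dTheta hB hl h
  have hf : 1 ≤ ⌊σ⌋₊ := Nat.le_floor (by simpa using hσ)
  exact continuousOn_fderiv_of_uniform_holder (V := E n) (X := ℝ × E n)
    (S := Ici (0 : ℝ) ×ˢ B34 n) (f := fun x y => g x y.1 y.2) hB.continuousOn
    (fun y hy => (hB.memHolder y.1 hy.1 y.2 hy.2).2.1.differentiable (by exact_mod_cast (by omega)))
    hg.nonneg hα (fun y hy => hh y.1 hy.1 y.2 hy.2)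

end Regularity

section Kappa

variable {n : ℕ} {σ l K : ℝ} {ω : E n → E n} {g : E n → ℝ → E n → ℝ}

theorem kappa_eq (θ : E n) (t : ℝ) (p : E n) :
    kappa ω g θ t p = -∫ s in Ioi (0 : ℝ), g (θ + s • ω p) (t + s) p := by
  unfold kappa
  rw [integral_Ioi_shift]
  simp

/-- A continuous function on the domain is measurable along the characteristics. -/
theorem aestronglyMeasurable_characteristic {F : Type*} [NormedAddCommGroup F]
    {h : E n × ℝ × E n → F} (hh : ContinuousOn h (dom n)) (θ w : E n)
    {t : ℝ} (ht : 0 ≤ t) {p : E n} (hp : p ∈ B34 n) :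
    AEStronglyMeasurable (fun s : ℝ => h (θ + s • w, t + s, p)) (volume.restrict (Ioi 0)) := by
  refine ContinuousOn.aestronglyMeasurable ?_ measurableSet_Ioi
  refine hh.comp (f := fun s : ℝ => (θ + s • w, t + s, p)) (by fun_prop) fun s hs => ?_
  exact ⟨mem_univ _, add_nonneg ht (le_of_lt hs), hp⟩

theorem integrableOn_decay (hl : 0 < l) (K : ℝ) {t : ℝ} (ht : 0 ≤ t) :
    IntegrableOn (fun s : ℝ => K * (1 + (t + s)) ^ (-(l + 1))) (Ioi 0) :=
  (integrableOn_one_add_rpow (by linarith) ht).const_mul K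

theorem integral_decay (hl : 0 < l) (K : ℝ) {t : ℝ} (ht : 0 ≤ t) :
    ∫ s in Ioi (0 : ℝ), K * (1 + (t + s)) ^ (-(l + 1)) = K * ((1 + t) ^ (-l) / l) := by
  rw [integral_const_mul, integral_one_add_rpow (by linarith) ht, add_sub_cancel_right]

theorem integrableOn_shifted_characteristic (hg : HasDecay σ l K g) (hB : MemB σ g) (hl : 0 < l)
    (θ w : E n) {t : ℝ} (ht : 0 ≤ t) {p : E n} (hp : p ∈ B34 n) :
    IntegrableOn (fun s => g (θ + s • w) (t + s) p) (Ioi 0) := by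
  refine (integrableOn_decay hl K ht).mono'
    (aestronglyMeasurable_characteristic hB.continuousOn θ w ht hp) ?_
  filter_upwards [ae_restrict_mem measurableSet_Ioi] with s hs
  exact hg.norm_le (add_nonneg ht (le_of_lt hs)) hp _

theorem integrableOn_characteristic (hg : HasDecay σ l K g) (hB : MemB σ g) (hl : 0 < l)
    (θ w : E n) {t : ℝ} (ht : 0 ≤ t) {p : E n} (hp : p ∈ B34 n) :
    IntegrableOn (fun τ => g (θ + (τ - t) • w) τ p) (Ioi t) := by
  rw [integrableOn_Ioi_shift]
  simpa using integrableOn_shifted_characteristic hg hB hl θ w ht hp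

theorem contDiff_kappa_and_norm_iteratedFDeriv_le (hg : HasDecay σ l K g) (hB : MemB σ g)
    (hl : 0 < l) {t : ℝ} (ht : 0 ≤ t) {p : E n} (hp : p ∈ B34 n) :
    ContDiff ℝ ⌊σ⌋₊ (fun θ => kappa ω g θ t p) ∧
      ∀ i ≤ ⌊σ⌋₊, ∀ x, ‖iteratedFDeriv ℝ i (fun θ => kappa ω g θ t p) x‖ ≤
        K * ((1 + t) ^ (-l) / l) := by
  have key := contDiff_integral_and_norm_iteratedFDeriv_le (μ := volume.restrict (Ioi (0 : ℝ)))
    ⌊σ⌋₊ (f := fun (θ : E n) s => -g (θ + s • ω p) (t + s) p)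
    (b := fun _ s => K * (1 + (t + s)) ^ (-(l + 1)))
    (fun θ => (aestronglyMeasurable_characteristic hB.continuousOn θ (ω p) ht hp).neg)
    (by
      filter_upwards [ae_restrict_mem measurableSet_Ioi] with s hs
      have h := (hB.memHolder (t + s) (add_nonneg ht (le_of_lt hs)) p hp).2.1
      exact (h.comp (contDiff_id.add contDiff_const)).neg)
    (fun i _ => integrableOn_decay hl K ht)
    (fun i hi => by
      filter_upwards [ae_restrict_mem measurableSet_Ioi] with s hs x
      change ‖iteratedFDeriv ℝ i (-fun θ => g (θ + s • ω p) (t + s) p) x‖ ≤ _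
      rw [iteratedFDeriv_neg_apply, norm_neg,
        iteratedFDeriv_comp_add_right (f := fun θ => g θ (t + s) p)]
      exact hg.norm_iteratedFDeriv_le (add_nonneg ht (le_of_lt hs)) hp hi _)
  simp only [integral_neg, ← kappa_eq, integral_decay hl K ht] at key
  exact key

theorem norm_iteratedFDeriv_kappa_sub_le (hg : HasDecay σ l K g) (hB : MemB σ g)
    (hl : 0 < l) {t : ℝ} (ht : 0 ≤ t) {p : E n} (hp : p ∈ B34 n) (hσ : (⌊σ⌋₊ : ℝ) ≠ σ)
    (x y : E n) :
    ‖iteratedFDeriv ℝ ⌊σ⌋₊ (fun θ => kappa ω g θ t p) x -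
      iteratedFDeriv ℝ ⌊σ⌋₊ (fun θ => kappa ω g θ t p) y‖ ≤
        K * ((1 + t) ^ (-l) / l) * ‖x - y‖ ^ (σ - (⌊σ⌋₊ : ℝ)) := by
  set A : ℕ → ℝ := fun i => if i = ⌊σ⌋₊ then ‖x - y‖ ^ (σ - (⌊σ⌋₊ : ℝ)) else 2 with hA
  have hsmooth : ∀ s ∈ Ioi (0 : ℝ), ∀ v, ContDiff ℝ ⌊σ⌋₊ (fun θ => g (θ + v) (t + s) p) := by
    intro s hs v
    have h := (hB.memHolder (t + s) (add_nonneg ht (le_of_lt hs)) p hp).2.1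
    exact h.comp (contDiff_id.add contDiff_const)
  have key := (contDiff_integral_and_norm_iteratedFDeriv_le (μ := volume.restrict (Ioi (0 : ℝ)))
    ⌊σ⌋₊ (f := fun (θ : E n) s => g (θ + s • ω p) (t + s) p -
      g (θ + ((x - y) + s • ω p)) (t + s) p)
    (b := fun i s => A i * (K * (1 + (t + s)) ^ (-(l + 1))))
    (fun θ => (aestronglyMeasurable_characteristic hB.continuousOn θ (ω p) ht hp).sub (by
      simp_rw [← add_assoc]
      exact aestronglyMeasurable_characteristic hB.continuousOn _ (ω p) ht hp))
    (by
      filter_upwards [ae_restrict_mem measurableSet_Ioi] with s hs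
      exact (hsmooth s hs _).sub (hsmooth s hs _))
    (fun i _ => (integrableOn_decay hl K ht).const_mul _)
    (fun i hi => by
      filter_upwards [ae_restrict_mem measurableSet_Ioi] with s hs z
      have hts : 0 ≤ t + s := add_nonneg ht (le_of_lt hs)
      have hi' : (i : WithTop ℕ∞) ≤ ⌊σ⌋₊ := by exact_mod_cast hi
      rw [fun_iteratedFDeriv_sub_apply ((hsmooth s hs _).of_le hi').contDiffAt
        ((hsmooth s hs _).of_le hi').contDiffAt,
        iteratedFDeriv_comp_add_right (f := fun θ => g θ (t + s) p),
        iteratedFDeriv_comp_add_right (f := fun θ => g θ (t + s) p)]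
      have hc : 0 ≤ K * (1 + (t + s)) ^ (-(l + 1)) := mul_nonneg hg.nonneg (by positivity)
      by_cases hik : i = ⌊σ⌋₊
      · simp only [hA, if_pos hik]
        rw [hik, norm_sub_rev, mul_comm]
        refine (norm_iteratedFDeriv_sub_le_of_holderNorm_le hc
          (hg.holder (t + s) hts p hp) hσ _ _).trans_eq ?_
        congr 3
        abel
      · simp only [hA, if_neg hik, two_mul]
        exact (norm_sub_le _ _).trans (add_le_add (hg.norm_iteratedFDeriv_le hts hp hi _)
          (hg.norm_iteratedFDeriv_le hts hp hi _)))).2 ⌊σ⌋₊ le_rfl y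
  have heq : (fun θ : E n => ∫ s in Ioi (0 : ℝ), (g (θ + s • ω p) (t + s) p -
      g (θ + ((x - y) + s • ω p)) (t + s) p)) =
      fun θ => kappa ω g (θ + (x - y)) t p - kappa ω g θ t p := by
    funext θ
    rw [integral_sub (integrableOn_shifted_characteristic hg hB hl θ (ω p) ht hp), kappa_eq,
      kappa_eq]
    · simp_rw [← add_assoc]; ring
    · simp_rw [← add_assoc]
      exact integrableOn_shifted_characteristic hg hB hl _ (ω p) ht hp
  have hk := (contDiff_kappa_and_norm_iteratedFDeriv_le (ω := ω) hg hB hl ht hp).1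
  have hk' : ContDiff ℝ ⌊σ⌋₊ (fun θ => kappa ω g (θ + (x - y)) t p) :=
    hk.comp (contDiff_id.add contDiff_const)
  rw [heq, fun_iteratedFDeriv_sub_apply hk'.contDiffAt hk.contDiffAt,
    iteratedFDeriv_comp_add_right (f := fun θ => kappa ω g θ t p),
    add_sub_cancel, integral_const_mul, integral_decay hl K ht, mul_comm] at key
  simp only [hA, if_true] at key
  exact key

theorem holderNorm_kappa_le (hg : HasDecay σ l K g) (hB : MemB σ g) (hl : 0 < l)
    {t : ℝ} (ht : 0 ≤ t) {p : E n} (hp : p ∈ B34 n) :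
    holderNorm σ (fun θ => kappa ω g θ t p) ≤
      ENNReal.ofReal (2 * (K / l) * (1 + t) ^ (-l)) := by
  have h := holderNorm_le (σ := σ) (f := fun θ => kappa ω g θ t p)
    (c := K * ((1 + t) ^ (-l) / l)) (mul_nonneg hg.nonneg (by positivity))
    (contDiff_kappa_and_norm_iteratedFDeriv_le hg hB hl ht hp).2
    (norm_iteratedFDeriv_kappa_sub_le hg hB hl ht hp)
  refine h.trans_eq ?_
  congr 1
  ring

theorem kappa_add_latt (hB : MemB σ g) {t : ℝ} (ht : 0 ≤ t) {p : E n} (hp : p ∈ B34 n)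
    (x : E n) (k : Fin n → ℤ) : kappa ω g (x + latt k) t p = kappa ω g x t p := by
  rw [kappa_eq, kappa_eq]
  congr 1
  refine setIntegral_congr_fun measurableSet_Ioi fun s hs => ?_
  rw [add_right_comm]
  exact (hB.memHolder (t + s) (add_nonneg ht (le_of_lt hs)) p hp).1 _ k

theorem memHolder_kappa (hg : HasDecay σ l K g) (hB : MemB σ g) (hl : 0 < l)
    {t : ℝ} (ht : 0 ≤ t) {p : E n} (hp : p ∈ B34 n) :
    MemHolder σ (fun θ => kappa ω g θ t p) :=
  ⟨kappa_add_latt hB ht hp, (contDiff_kappa_and_norm_iteratedFDeriv_le hg hB hl ht hp).1,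
    (holderNorm_kappa_le hg hB hl ht hp).trans_lt ENNReal.ofReal_lt_top⟩

theorem vanishes_kappa (hg : HasDecay σ l K g) (hB : MemB σ g) (hl : 0 < l) :
    Vanishes (kappa ω g) := by
  intro p hp
  have h1 : Tendsto (fun t : ℝ => ENNReal.ofReal (K * ((1 + t) ^ (-l) / l))) atTop (𝓝 0) := by
    have h2 : Tendsto (fun t : ℝ => (1 + t) ^ (-l)) atTop (𝓝 0) :=
      (tendsto_rpow_neg_atTop hl).comp (tendsto_atTop_add_const_left _ _ tendsto_id)
    have h3 := (h2.div_const l).const_mul K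
    simpa using ENNReal.tendsto_ofReal h3
  refine tendsto_of_tendsto_of_tendsto_of_le_of_le' tendsto_const_nhds h1
    (Eventually.of_forall fun _ => zero_le) ?_
  filter_upwards [eventually_ge_atTop 0] with t ht
  refine c0Norm_le fun θ => ?_
  simpa only [norm_iteratedFDeriv_zero] using
    (contDiff_kappa_and_norm_iteratedFDeriv_le hg hB hl ht hp).2 0 (Nat.zero_le _) θ

theorem decay_add_le (hK : 0 ≤ K) {r t s : ℝ} (hr : 0 ≤ r) (ht : 0 ≤ t) (hs : 0 ≤ s) :
    K * (1 + (t + s)) ^ (-r) ≤ K * (1 + (0 + s)) ^ (-r) := by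
  refine mul_le_mul_of_nonneg_left ?_ hK
  exact Real.rpow_le_rpow_of_nonpos (by linarith) (by linarith) (by linarith)

theorem continuousOn_characteristic {F : Type*} [NormedAddCommGroup F]
    {h : E n × ℝ × E n → F} (hh : ContinuousOn h (dom n)) (hω : ContinuousOn ω (B34 n))
    {s : ℝ} (hs : 0 ≤ s) :
    ContinuousOn (fun x : E n × ℝ × E n => h (x.1 + s • ω x.2.2, x.2.1 + s, x.2.2)) (dom n) := by
  refine hh.comp (f := fun x : E n × ℝ × E n => (x.1 + s • ω x.2.2, x.2.1 + s, x.2.2)) ?_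
    fun x hx => ⟨mem_univ _, add_nonneg hx.2.1 hs, hx.2.2⟩
  have h1 : ContinuousOn (fun x : E n × ℝ × E n => ω x.2.2) (dom n) :=
    hω.comp (by fun_prop) fun x hx => hx.2.2
  exact (continuousOn_fst.add (h1.const_smul s)).prodMk (by fun_prop)

theorem continuousOn_kappa (hg : HasDecay σ l K g) (hB : MemB σ g) (hl : 0 < l)
    (hω : ContinuousOn ω (B34 n)) :
    ContinuousOn (fun x : E n × ℝ × E n => kappa ω g x.1 x.2.1 x.2.2) (dom n) := by
  simp only [kappa_eq]
  refine ContinuousOn.neg (continuousOn_of_dominated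
    (bound := fun s => K * (1 + (0 + s)) ^ (-(l + 1))) ?_ ?_ (integrableOn_decay hl K le_rfl) ?_)
  · intro x hx
    exact aestronglyMeasurable_characteristic hB.continuousOn _ _ hx.2.1 hx.2.2
  · intro x hx
    filter_upwards [ae_restrict_mem measurableSet_Ioi] with s hs
    exact (hg.norm_le (add_nonneg hx.2.1 (le_of_lt hs)) hx.2.2 _).trans
      (decay_add_le hg.nonneg (by linarith) hx.2.1 (le_of_lt hs))
  · filter_upwards [ae_restrict_mem measurableSet_Ioi] with s hs
    exact continuousOn_characteristic hB.continuousOn hω (le_of_lt hs)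

end Kappa

section Parameter

variable {n : ℕ} {σ l K : ℝ} {ω : E n → E n} {g : E n → ℝ → E n → ℝ}

/-- The derivative in `p` of `g (θ + s ω(p), t + s; p)`. -/
noncomputable def characteristicDParam (ω : E n → E n) (g : E n → ℝ → E n → ℝ)
    (x : E n × ℝ × E n) (s : ℝ) : E n →L[ℝ] ℝ :=
  s • (dTheta g (x.1 + s • ω x.2.2) (x.2.1 + s) x.2.2).comp (fderiv ℝ ω x.2.2) +
    dParam g (x.1 + s • ω x.2.2) (x.2.1 + s) x.2.2

theorem hasFDerivAt_characteristic (hB : MemB σ g) (hσ : 1 ≤ σ)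
    (hθ : ContinuousOn (fun x : E n × ℝ × E n => dTheta g x.1 x.2.1 x.2.2) (dom n))
    (hω : ContDiffOn ℝ 1 ω (B34 n)) (θ : E n) {t s : ℝ} (hts : 0 ≤ t + s) {p : E n}
    (hp : p ∈ B34 n) :
    HasFDerivAt (fun p' => g (θ + s • ω p') (t + s) p')
      (characteristicDParam ω g (θ, t, p) s) p := by
  have hf : ⌊σ⌋₊ ≠ 0 := by
    have : 1 ≤ ⌊σ⌋₊ := Nat.le_floor (by simpa using hσ)
    omega
  have hnhds : ∀ᶠ v : E n × E n in 𝓝 (θ + s • ω p, p), v.2 ∈ B34 n :=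
    continuous_snd.continuousAt.eventually (isOpen_ball.mem_nhds hp)
  have hcont : ∀ {h : E n × ℝ × E n → E n →L[ℝ] ℝ}, ContinuousOn h (dom n) →
      ContinuousAt (fun v : E n × E n => h (v.1, t + s, v.2)) (θ + s • ω p, p) := by
    intro h hh
    have h1 : ContinuousOn (fun v : E n × E n => h (v.1, t + s, v.2)) (univ ×ˢ B34 n) :=
      hh.comp (by fun_prop) fun v hv => ⟨mem_univ _, hts, hv.2⟩
    exact h1.continuousAt ((isOpen_univ.prod isOpen_ball).mem_nhds ⟨mem_univ _, hp⟩)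
  have hstrict := hasStrictFDerivAt_uncurry_coprod (𝕜 := ℝ) (u := (θ + s • ω p, p))
    (f := fun x q => g x (t + s) q) (f₁ := fun x q => dTheta g x (t + s) q)
    (f₂ := fun x q => dParam g x (t + s) q)
    (hnhds.mono fun v hv =>
      ((hB.memHolder _ hts _ hv).2.1.differentiable (by exact_mod_cast hf) v.1).hasFDerivAt)
    (hnhds.mono fun v hv => (hB.differentiableAt_param v.1 _ hts _ hv).hasFDerivAt)
    (hcont hθ) (hcont hB.continuousOn_dParam)
  have hωp : HasFDerivAt ω (fderiv ℝ ω p) p :=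
    ((hω.differentiableOn (by simp)).differentiableAt (isOpen_ball.mem_nhds hp)).hasFDerivAt
  have hin : HasFDerivAt (fun p' => (θ + s • ω p', p'))
      ((s • fderiv ℝ ω p).prod (ContinuousLinearMap.id ℝ (E n))) p :=
    ((hωp.const_smul s).const_add θ).prodMk (hasFDerivAt_id p)
  have hcomp := HasFDerivAt.comp (f := fun p' => (θ + s • ω p', p')) p hstrict.hasFDerivAt hin
  refine hcomp.congr_fderiv ?_
  ext v
  simp [characteristicDParam, Function.HasUncurry.uncurry]

theorem HasDecay.norm_characteristicDParam_le (hg : HasDecay σ l K g) (hσ : 1 ≤ σ) {m : ℝ}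
    {x : E n × ℝ × E n} (hx : x ∈ dom n) (hm : ‖fderiv ℝ ω x.2.2‖ ≤ m) {s : ℝ} (hs : 0 ≤ s) :
    ‖characteristicDParam ω g x s‖ ≤ (m + 1) * K * (1 + (x.2.1 + s)) ^ (-l) := by
  have ht : (0 : ℝ) ≤ x.2.1 := hx.2.1
  have hts : 0 ≤ x.2.1 + s := add_nonneg ht hs
  have hK := hg.nonneg
  have hm0 : 0 ≤ m := (norm_nonneg _).trans hm
  have hpow : s * (1 + (x.2.1 + s)) ^ (-(l + 1)) ≤ (1 + (x.2.1 + s)) ^ (-l) := by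
    have h1 : (1 + (x.2.1 + s)) ^ (-l) = (1 + (x.2.1 + s)) * (1 + (x.2.1 + s)) ^ (-(l + 1)) := by
      rw [show -l = 1 + -(l + 1) by ring, Real.rpow_add (by linarith), Real.rpow_one]
    rw [h1]
    exact mul_le_mul_of_nonneg_right (by linarith) (by positivity)
  have h1 : ‖s • (dTheta g (x.1 + s • ω x.2.2) (x.2.1 + s) x.2.2).comp (fderiv ℝ ω x.2.2)‖ ≤
      m * K * (1 + (x.2.1 + s)) ^ (-l) := by
    rw [norm_smul, Real.norm_of_nonneg hs]
    calc s * ‖(dTheta g (x.1 + s • ω x.2.2) (x.2.1 + s) x.2.2).comp (fderiv ℝ ω x.2.2)‖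
        ≤ s * ((K * (1 + (x.2.1 + s)) ^ (-(l + 1))) * m) := by
          refine mul_le_mul_of_nonneg_left ?_ hs
          refine (ContinuousLinearMap.opNorm_comp_le _ _).trans ?_
          exact mul_le_mul (hg.norm_dTheta_le hσ hts hx.2.2 _) hm (norm_nonneg _) (by positivity)
      _ = m * K * (s * (1 + (x.2.1 + s)) ^ (-(l + 1))) := by ring
      _ ≤ _ := mul_le_mul_of_nonneg_left hpow (by positivity)
  have h2 := hg.param (x.1 + s • ω x.2.2) _ hts _ hx.2.2
  refine (norm_add_le _ _).trans ((add_le_add h1 h2).trans_eq ?_)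
  ring

theorem continuousOn_fderiv_of_contDiffOn (hω : ContDiffOn ℝ 1 ω (B34 n)) :
    ContinuousOn (fderiv ℝ ω) (B34 n) :=
  hω.continuousOn_fderiv_of_isOpen isOpen_ball le_rfl

theorem eventually_norm_fderiv_le (hω : ContDiffOn ℝ 1 ω (B34 n)) {p : E n} (hp : p ∈ B34 n) :
    ∀ᶠ q in 𝓝 p, q ∈ B34 n ∧ ‖fderiv ℝ ω q‖ ≤ ‖fderiv ℝ ω p‖ + 1 := by
  have hc : ContinuousAt (fderiv ℝ ω) p :=
    (continuousOn_fderiv_of_contDiffOn hω).continuousAt (isOpen_ball.mem_nhds hp)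
  filter_upwards [isOpen_ball.mem_nhds hp, hc.norm.eventually_le_const
    (show ‖fderiv ℝ ω p‖ < ‖fderiv ℝ ω p‖ + 1 by linarith)] with q h1 h2 using ⟨h1, h2⟩

theorem continuousOn_characteristicDParam (hB : MemB σ g)
    (hθ : ContinuousOn (fun x : E n × ℝ × E n => dTheta g x.1 x.2.1 x.2.2) (dom n))
    (hω : ContDiffOn ℝ 1 ω (B34 n)) {s : ℝ} (hs : 0 ≤ s) :
    ContinuousOn (fun x => characteristicDParam ω g x s) (dom n) := by
  have h1 := continuousOn_characteristic hθ hω.continuousOn hs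
  have h2 := continuousOn_characteristic hB.continuousOn_dParam hω.continuousOn hs
  have h3 : ContinuousOn (fun x : E n × ℝ × E n => fderiv ℝ ω x.2.2) (dom n) :=
    (continuousOn_fderiv_of_contDiffOn hω).comp (by fun_prop) fun x hx => hx.2.2
  exact ((h1.clm_comp h3).const_smul s).add h2

theorem aestronglyMeasurable_characteristicDParam (hB : MemB σ g)
    (hθ : ContinuousOn (fun x : E n × ℝ × E n => dTheta g x.1 x.2.1 x.2.2) (dom n))
    {x : E n × ℝ × E n} (hx : x ∈ dom n) :
    AEStronglyMeasurable (characteristicDParam ω g x) (volume.restrict (Ioi 0)) := by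
  have h1 := aestronglyMeasurable_characteristic hθ x.1 (ω x.2.2) hx.2.1 hx.2.2
  have h2 := aestronglyMeasurable_characteristic hB.continuousOn_dParam x.1 (ω x.2.2) hx.2.1 hx.2.2
  have h3 : Continuous fun L : E n →L[ℝ] ℝ => L.comp (fderiv ℝ ω x.2.2) := by fun_prop
  exact (aestronglyMeasurable_id.smul (h3.comp_aestronglyMeasurable h1)).add h2

theorem integrableOn_param_bound (hl : 1 < l) (c : ℝ) {t : ℝ} (ht : 0 ≤ t) :
    IntegrableOn (fun s : ℝ => c * (1 + (t + s)) ^ (-l)) (Ioi 0) :=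
  (integrableOn_one_add_rpow hl ht).const_mul c

theorem hasFDerivAt_kappa (hg : HasDecay σ l K g) (hB : MemB σ g) (hσ : 1 ≤ σ) (hl : 1 < l)
    (hθ : ContinuousOn (fun x : E n × ℝ × E n => dTheta g x.1 x.2.1 x.2.2) (dom n))
    (hω : ContDiffOn ℝ 1 ω (B34 n)) {x : E n × ℝ × E n} (hx : x ∈ dom n) :
    HasFDerivAt (fun p => kappa ω g x.1 x.2.1 p)
      (-∫ s in Ioi (0 : ℝ), characteristicDParam ω g x s) x.2.2 := by
  obtain ⟨θ, t, p⟩ := x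
  have ht : (0 : ℝ) ≤ t := hx.2.1
  have hp : p ∈ B34 n := hx.2.2
  simp only [kappa_eq]
  refine HasFDerivAt.fun_neg ?_
  refine hasFDerivAt_integral_of_dominated_of_fderiv_le
    (F' := fun q s => characteristicDParam ω g (θ, t, q) s)
    (bound := fun s => (‖fderiv ℝ ω p‖ + 1 + 1) * K * (1 + (t + s)) ^ (-l))
    (eventually_norm_fderiv_le hω hp) ?_ ?_ ?_ ?_ (integrableOn_param_bound hl _ ht) ?_
  · filter_upwards [isOpen_ball.mem_nhds hp] with q hq
    exact aestronglyMeasurable_characteristic hB.continuousOn θ (ω q) ht hq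
  · exact integrableOn_shifted_characteristic hg hB (by linarith) θ (ω p) ht hp
  · exact aestronglyMeasurable_characteristicDParam hB hθ hx
  · filter_upwards [ae_restrict_mem measurableSet_Ioi] with s hs q hq
    exact hg.norm_characteristicDParam_le (x := (θ, t, q)) hσ ⟨mem_univ _, ht, hq.1⟩ hq.2
      (le_of_lt hs)
  · filter_upwards [ae_restrict_mem measurableSet_Ioi] with s hs q hq
    exact hasFDerivAt_characteristic hB hσ hθ hω θ (add_nonneg ht (le_of_lt hs)) hq.1

theorem continuousOn_dParam_kappa (hg : HasDecay σ l K g) (hB : MemB σ g) (hσ : 1 ≤ σ)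
    (hl : 1 < l)
    (hθ : ContinuousOn (fun x : E n × ℝ × E n => dTheta g x.1 x.2.1 x.2.2) (dom n))
    (hω : ContDiffOn ℝ 1 ω (B34 n)) :
    ContinuousOn (fun x : E n × ℝ × E n => dParam (kappa ω g) x.1 x.2.1 x.2.2) (dom n) := by
  have heq : EqOn (fun x : E n × ℝ × E n => dParam (kappa ω g) x.1 x.2.1 x.2.2)
      (fun x => -∫ s in Ioi (0 : ℝ), characteristicDParam ω g x s) (dom n) :=
    fun x hx => (hasFDerivAt_kappa hg hB hσ hl hθ hω hx).fderiv
  refine ContinuousOn.congr (ContinuousOn.neg fun x hx => ?_) heq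
  refine continuousWithinAt_of_dominated
    (bound := fun s => (‖fderiv ℝ ω x.2.2‖ + 1 + 1) * K * (1 + (0 + s)) ^ (-l)) ?_ ?_
    (integrableOn_param_bound hl _ le_rfl) ?_
  · filter_upwards [self_mem_nhdsWithin] with y hy
    exact aestronglyMeasurable_characteristicDParam hB hθ hy
  · have hcont : ContinuousAt (fun y : E n × ℝ × E n => y.2.2) x := by fun_prop
    filter_upwards [self_mem_nhdsWithin, nhdsWithin_le_nhds
      (hcont.eventually (eventually_norm_fderiv_le hω hx.2.2))] with y hy hyω
    filter_upwards [ae_restrict_mem measurableSet_Ioi] with s hs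
    refine (hg.norm_characteristicDParam_le hσ hy hyω.2 (le_of_lt hs)).trans ?_
    exact decay_add_le (mul_nonneg (by positivity) hg.nonneg) (by linarith) hy.2.1 (le_of_lt hs)
  · filter_upwards [ae_restrict_mem measurableSet_Ioi] with s hs
    exact continuousOn_characteristicDParam hB hθ hω (le_of_lt hs) x hx

theorem norm_dParam_kappa_le (hg : HasDecay σ l K g) (hB : MemB σ g) (hσ : 1 ≤ σ) (hl : 1 < l)
    (hθ : ContinuousOn (fun x : E n × ℝ × E n => dTheta g x.1 x.2.1 x.2.2) (dom n))
    (hω : ContDiffOn ℝ 1 ω (B34 n)) {m : ℝ} (θ : E n) {t : ℝ} (ht : 0 ≤ t) {p : E n}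
    (hp : p ∈ B34 n) (hm : ‖fderiv ℝ ω p‖ ≤ m) :
    ‖dParam (kappa ω g) θ t p‖ ≤ (m + 1) * K / (l - 1) * (1 + t) ^ (-(l - 1)) := by
  have hx : (θ, t, p) ∈ dom n := ⟨mem_univ _, ht, hp⟩
  have h1 : dParam (kappa ω g) θ t p =
      -∫ s in Ioi (0 : ℝ), characteristicDParam ω g (θ, t, p) s :=
    (hasFDerivAt_kappa hg hB hσ hl hθ hω hx).fderiv
  rw [h1, norm_neg]
  refine (norm_integral_le_of_norm_le
    (integrableOn_param_bound hl ((m + 1) * K) ht) ?_).trans_eq ?_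
  · filter_upwards [ae_restrict_mem measurableSet_Ioi] with s hs
    exact hg.norm_characteristicDParam_le hσ hx hm (le_of_lt hs)
  · rw [integral_const_mul, integral_one_add_rpow hl ht]
    ring

theorem memB_kappa (hg : HasDecay σ l K g) (hB : MemB σ g) (hσ : 1 ≤ σ) (hl : 1 < l)
    (hθ : ContinuousOn (fun x : E n × ℝ × E n => dTheta g x.1 x.2.1 x.2.2) (dom n))
    (hω : ContDiffOn ℝ 1 ω (B34 n)) : MemB σ (kappa ω g) where
  continuousOn := continuousOn_kappa hg hB (by linarith) hω.continuousOn
  differentiableAt_param θ t ht p hp :=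
    (hasFDerivAt_kappa hg hB hσ hl hθ hω (x := (θ, t, p)) ⟨mem_univ _, ht, hp⟩).differentiableAt
  continuousOn_dParam := continuousOn_dParam_kappa hg hB hσ hl hθ hω
  memHolder t ht p hp := memHolder_kappa hg hB (by linarith) ht hp

end Parameter

section Equation

variable {n : ℕ} {σ l K : ℝ} {ω : E n → E n} {g : E n → ℝ → E n → ℝ}

/-- Derivative of an integral over an interval whose integrand depends on the endpoint. -/
theorem hasDerivWithinAt_integral_diagonal {ψ : ℝ → ℝ → ℝ} {t : ℝ} (ht : 0 ≤ t)
    (hψ : ContinuousOn (fun z : ℝ × ℝ => ψ z.1 z.2) (univ ×ˢ Ici 0)) :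
    HasDerivWithinAt (fun a => ∫ τ in t..a, ψ a τ) (ψ t t) (Ici 0) t := by
  rw [hasDerivWithinAt_iff_isLittleO, Asymptotics.isLittleO_iff]
  intro ε hε
  obtain ⟨δ, hδ, hclose⟩ := Metric.continuousWithinAt_iff.1 (hψ (t, t) ⟨mem_univ _, ht⟩) ε hε
  filter_upwards [self_mem_nhdsWithin, nhdsWithin_le_nhds (ball_mem_nhds t hδ)] with a ha hat
  have hsub : uIcc t a ⊆ Ici 0 := (ordConnected_Ici).uIcc_subset ht ha
  have hint : IntervalIntegrable (ψ a) volume t a := by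
    refine ContinuousOn.intervalIntegrable ?_
    exact hψ.comp (f := fun τ : ℝ => (a, τ)) (by fun_prop) fun τ hτ => ⟨mem_univ _, hsub hτ⟩
  have heq : (∫ τ in t..a, ψ a τ) - (∫ τ in t..t, ψ t τ) - (a - t) • ψ t t =
      ∫ τ in t..a, (ψ a τ - ψ t t) := by
    rw [intervalIntegral.integral_sub hint intervalIntegrable_const]
    simp
  rw [heq, Real.norm_eq_abs (a - t)]
  refine intervalIntegral.norm_integral_le_of_norm_le_const fun τ hτ => ?_
  have hτ' := uIoc_subset_uIcc hτ
  have hd : dist (a, τ) (t, t) < δ := by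
    rw [Prod.dist_eq, max_lt_iff]
    refine ⟨hat, lt_of_le_of_lt ?_ hat⟩
    rw [dist_comm τ t]
    exact (Real.dist_left_le_of_mem_uIcc hτ').trans_eq (dist_comm _ _)
  have := hclose (x := (a, τ)) ⟨mem_univ _, hsub hτ'⟩ hd
  rw [dist_eq_norm] at this
  exact this.le

/-- The values of `kappa` at two times, related along the characteristics. -/
theorem kappa_eq_add_integral (hg : HasDecay σ l K g) (hB : MemB σ g) (hl : 0 < l) (θ : E n)
    {t a : ℝ} (ht : 0 ≤ t) (ha : 0 ≤ a) {p : E n} (hp : p ∈ B34 n) :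
    kappa ω g θ a p = kappa ω g (θ - (a - t) • ω p) t p +
      ∫ τ in t..a, g (θ + (τ - a) • ω p) τ p := by
  have hpt : ∀ τ : ℝ, θ - (a - t) • ω p + (τ - t) • ω p = θ + (τ - a) • ω p := fun τ => by
    module
  have h1 := integrableOn_characteristic hg hB hl (θ - (a - t) • ω p) (ω p) ht hp
  have h2 := integrableOn_characteristic hg hB hl θ (ω p) ha hp
  simp only [hpt] at h1
  rw [← intervalIntegral.integral_Ioi_sub_Ioi' h1 h2]
  simp only [kappa, hpt]
  ring

theorem differentiable_kappa (hg : HasDecay σ l K g) (hB : MemB σ g) (hσ : 1 ≤ σ) (hl : 0 < l)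
    {t : ℝ} (ht : 0 ≤ t) {p : E n} (hp : p ∈ B34 n) :
    Differentiable ℝ (fun θ => kappa ω g θ t p) := by
  have hf : 1 ≤ ⌊σ⌋₊ := Nat.le_floor (by simpa using hσ)
  exact (contDiff_kappa_and_norm_iteratedFDeriv_le hg hB hl ht hp).1.differentiable
    (by exact_mod_cast (by omega))

theorem hasDerivWithinAt_kappa (hg : HasDecay σ l K g) (hB : MemB σ g) (hσ : 1 ≤ σ)
    (hl : 0 < l) (θ : E n) {t : ℝ} (ht : 0 ≤ t) {p : E n} (hp : p ∈ B34 n) :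
    HasDerivWithinAt (fun s => kappa ω g θ s p)
      (-dTheta (kappa ω g) θ t p (ω p) + g θ t p) (Ici 0) t := by
  have h1 : HasDerivWithinAt (fun a => kappa ω g (θ - (a - t) • ω p) t p)
      (-dTheta (kappa ω g) θ t p (ω p)) (Ici 0) t := by
    have hin : HasDerivAt (fun a : ℝ => θ - (a - t) • ω p) (-ω p) t := by
      simpa using (((hasDerivAt_id t).sub_const t).smul_const (ω p)).const_sub θ
    have hout : HasFDerivAt (fun θ => kappa ω g θ t p) (dTheta (kappa ω g) θ t p)
        (θ - (t - t) • ω p) := by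
      rw [sub_self, zero_smul, sub_zero]
      exact (differentiable_kappa hg hB hσ hl ht hp θ).hasFDerivAt
    rw [← map_neg]
    exact (hout.comp_hasDerivAt t hin).hasDerivWithinAt
  have h2 : HasDerivWithinAt (fun a => ∫ τ in t..a, g (θ + (τ - a) • ω p) τ p)
      (g θ t p) (Ici 0) t := by
    have h := hasDerivWithinAt_integral_diagonal (ψ := fun a τ => g (θ + (τ - a) • ω p) τ p) ht
      (hB.continuousOn.comp (f := fun z : ℝ × ℝ => (θ + (z.2 - z.1) • ω p, z.2, p))
        (by fun_prop) fun z hz => ⟨mem_univ _, hz.2, hp⟩)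
    simpa using h
  exact (h1.add h2).congr (fun a ha => kappa_eq_add_integral hg hB hl θ ht ha hp)
    (kappa_eq_add_integral hg hB hl θ ht ht hp)

theorem isSolution_kappa (hg : HasDecay σ l K g) (hB : MemB σ g) (hσ : 1 ≤ σ) (hl : 0 < l) :
    IsSolution ω g (kappa ω g) := by
  intro θ t ht p hp
  have h := hasDerivWithinAt_kappa (ω := ω) hg hB hσ hl θ ht hp
  refine ⟨differentiable_kappa hg hB hσ hl ht hp θ, h.differentiableWithinAt, ?_⟩
  rw [dTime, h.derivWithin (uniqueDiffOn_Ici 0 t ht)]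
  ring

end Equation

section Uniqueness

variable {n : ℕ}

/-- The closed unit cube, which meets every orbit of the lattice. -/
def unitCube (n : ℕ) : Set (E n) := WithLp.toLp 2 '' (Set.univ.pi fun _ => Icc (0 : ℝ) 1)

theorem isCompact_unitCube : IsCompact (unitCube n) :=
  (isCompact_univ_pi fun _ => isCompact_Icc).image (PiLp.continuous_toLp 2 _)

theorem exists_add_latt_mem_unitCube (x : E n) :
    ∃ y ∈ unitCube n, ∃ k : Fin n → ℤ, x = y + latt k := by
  refine ⟨WithLp.toLp 2 fun i => Int.fract (x i), ⟨_, fun i _ => ?_, rfl⟩, fun i => ⌊x i⌋, ?_⟩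
  · exact ⟨Int.fract_nonneg _, (Int.fract_lt_one _).le⟩
  · ext i
    simp [latt, Int.fract_add_floor]

/-- Maximum principle for the transport equation on the torus: only the pointwise existence of the
partial derivatives is used. -/
theorem nonpos_of_transport {v : E n → ℝ → ℝ} {w : E n}
    (hper : ∀ t, 0 ≤ t → ∀ x k, v (x + latt k) t = v x t)
    (hcont : ContinuousOn (fun z : E n × ℝ => v z.1 z.2) (univ ×ˢ Ici 0))
    (hder : ∀ θ t, 0 ≤ t → HasDerivWithinAt (fun s => v θ s)
      (-fderiv ℝ (fun θ' => v θ' t) θ w) (Ici 0) t)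
    (hlim : ∀ ε > 0, ∃ T, ∀ t ≥ T, ∀ θ, v θ t < ε) (θ₀ : E n) {t₀ : ℝ} (ht₀ : 0 ≤ t₀) :
    v θ₀ t₀ ≤ 0 := by
  by_contra! hc
  set c := v θ₀ t₀ with hcdef
  obtain ⟨T₁, hT₁⟩ := hlim (c / 2) (by linarith)
  set T := max T₁ (t₀ + 1) with hT
  have ht₀T : t₀ < T := lt_of_lt_of_le (by linarith) (le_max_right _ _)
  set ε := c / (2 * (T - t₀)) with hεdef
  have hε : 0 < ε := div_pos hc (by linarith)
  have hεT : ε * (T - t₀) = c / 2 := by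
    rw [hεdef]; field_simp [(sub_pos.2 ht₀T).ne']
  obtain ⟨y₀, hy₀, k₀, hk₀⟩ := exists_add_latt_mem_unitCube θ₀
  have hcφ : ContinuousOn (fun z : E n × ℝ => v z.1 z.2 + ε * (z.2 - t₀))
      (unitCube n ×ˢ Icc t₀ T) :=
    (hcont.mono (prod_mono (subset_univ _) fun s hs => ht₀.trans hs.1)).add (by fun_prop)
  obtain ⟨⟨y, s⟩, ⟨hy, hs⟩, hmax⟩ := (isCompact_unitCube.prod isCompact_Icc).exists_isMaxOn
    ⟨(y₀, t₀), hy₀, left_mem_Icc.2 ht₀T.le⟩ hcφ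
  have hs0 : 0 ≤ s := ht₀.trans hs.1
  have hglob : ∀ x r, r ∈ Icc t₀ T → v x r + ε * (r - t₀) ≤ v y s + ε * (s - t₀) := by
    intro x r hr
    obtain ⟨x', hx', k, rfl⟩ := exists_add_latt_mem_unitCube x
    rw [hper r (ht₀.trans hr.1)]
    exact isMaxOn_iff.1 hmax (x', r) ⟨hx', hr⟩
  have hsT : s < T := by
    refine lt_of_le_of_ne hs.2 fun h => ?_
    have h1 := hglob θ₀ t₀ (left_mem_Icc.2 ht₀T.le)
    have h2 := hT₁ T (le_max_left _ _) y
    rw [h, hεT] at h1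
    linarith
  have hcrit : fderiv ℝ (fun θ' => v θ' s) y = 0 := by
    refine IsLocalMax.fderiv_eq_zero (Eventually.of_forall fun x => ?_)
    have := hglob x s hs
    linarith
  have hd : HasDerivWithinAt (fun r => v y r + ε * (r - t₀)) ε (Ioi s) s := by
    have h1 := (hder y s hs0).mono (Ioi_subset_Ici hs0)
    rw [hcrit, zero_apply, neg_zero] at h1
    have h2 : HasDerivAt (fun r : ℝ => ε * (r - t₀)) ε s := by
      simpa using ((hasDerivAt_id s).sub_const t₀).const_mul ε
    exact (h1.add h2.hasDerivWithinAt).congr_deriv (zero_add ε)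
  rw [hasDerivWithinAt_iff_tendsto_slope' (by simp)] at hd
  have hev := (hd.eventually_const_lt hε).and
    (inter_mem self_mem_nhdsWithin (nhdsWithin_le_nhds (Iio_mem_nhds hsT)))
  obtain ⟨r, hr1, hr2, hr3⟩ := hev.exists
  rw [slope_def_field, lt_div_iff₀ (sub_pos.2 hr2), zero_mul] at hr1
  have := hglob y r ⟨hs.1.trans (le_of_lt hr2), le_of_lt hr3⟩
  linarith

theorem Vanishes.exists_abs_lt {κ : E n → ℝ → E n → ℝ} (h : Vanishes κ) {p : E n}
    (hp : p ∈ B34 n) {ε : ℝ} (hε : 0 < ε) : ∃ T, ∀ t ≥ T, ∀ θ, |κ θ t p| < ε := by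
  have h1 := (h p hp).eventually_lt_const (ENNReal.ofReal_pos.2 hε)
  obtain ⟨T, hT⟩ := eventually_atTop.1 h1
  refine ⟨T, fun t ht θ => ?_⟩
  have h2 : ‖κ θ t p‖ₑ < ENNReal.ofReal ε := (le_iSup (fun θ => ‖κ θ t p‖ₑ) θ).trans_lt (hT t ht)
  rwa [← ofReal_norm, ENNReal.ofReal_lt_ofReal_iff hε, Real.norm_eq_abs] at h2

theorem IsSolution.le_of_vanishes {σ : ℝ} {ω : E n → E n} {g κ₁ κ₂ : E n → ℝ → E n → ℝ}
    (hB₁ : MemB σ κ₁) (hB₂ : MemB σ κ₂) (h₁ : IsSolution ω g κ₁) (h₂ : IsSolution ω g κ₂)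
    (hv₁ : Vanishes κ₁) (hv₂ : Vanishes κ₂) (θ : E n) {t : ℝ} (ht : 0 ≤ t) {p : E n}
    (hp : p ∈ B34 n) : κ₁ θ t p ≤ κ₂ θ t p := by
  refine sub_nonpos.1 (nonpos_of_transport (v := fun θ t => κ₁ θ t p - κ₂ θ t p) (w := ω p)
    ?_ ?_ ?_ ?_ θ ht)
  · intro s hs x k
    exact congrArg₂ _ ((hB₁.memHolder s hs p hp).1 x k) ((hB₂.memHolder s hs p hp).1 x k)
  · have hc : ContinuousOn (fun z : E n × ℝ => (z.1, z.2, p)) (univ ×ˢ Ici 0) := by fun_prop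
    have hm : MapsTo (fun z : E n × ℝ => (z.1, z.2, p)) (univ ×ˢ Ici 0) (dom n) :=
      fun z hz => ⟨mem_univ _, hz.2, hp⟩
    exact (hB₁.continuousOn.comp hc hm).sub (hB₂.continuousOn.comp hc hm)
  · intro x s hs
    obtain ⟨d₁, e₁, q₁⟩ := h₁ x s hs p hp
    obtain ⟨d₂, e₂, q₂⟩ := h₂ x s hs p hp
    have h := e₁.hasDerivWithinAt.sub e₂.hasDerivWithinAt
    refine h.congr_deriv ?_
    rw [fderiv_fun_sub d₁ d₂, sub_apply]
    simp only [dTheta, dTime] at q₁ q₂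
    linarith
  · intro ε hε
    obtain ⟨T₁, hT₁⟩ := hv₁.exists_abs_lt hp (half_pos hε)
    obtain ⟨T₂, hT₂⟩ := hv₂.exists_abs_lt hp (half_pos hε)
    refine ⟨max T₁ T₂, fun s hs x => ?_⟩
    have h1 := abs_lt.1 (hT₁ s ((le_max_left _ _).trans hs) x)
    have h2 := abs_lt.1 (hT₂ s ((le_max_right _ _).trans hs) x)
    linarith [h1.2, h2.1]

end Uniqueness

section Estimate

variable {n : ℕ}

theorem norm_fderiv_le_of_c1Norm_le {ω : E n → E n} {M : ℝ≥0} (h : c1Norm ω ≤ M) {p : E n}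
    (hp : p ∈ B34 n) : ‖fderiv ℝ ω p‖ ≤ M := by
  have h1 : ‖fderiv ℝ ω p‖ₑ ≤ M :=
    (le_iSup₂_of_le (f := fun p (_ : p ∈ B34 n) => ‖fderiv ℝ ω p‖ₑ) p hp le_rfl).trans
      (le_sup_right.trans h)
  rw [enorm_eq_nnnorm, ENNReal.coe_le_coe] at h1
  exact_mod_cast h1

/-- The constant of the estimate. -/
noncomputable def estimateConst (l : ℝ) (M : ℝ≥0) : ℝ≥0 :=
  ((2 * (2 / l) + 2 * ((M + 1) / (l - 1))) * 2 ^ (l + 1)).toNNReal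

theorem wNorm_kappa_le {σ l : ℝ} {ω : E n → E n} {g : E n → ℝ → E n → ℝ} (hσ : 1 ≤ σ)
    (hl : 1 < l) (hB : MemB σ g) (hfin : wNorm σ (l + 1) g < ⊤)
    (hθ : ContinuousOn (fun x : E n × ℝ × E n => dTheta g x.1 x.2.1 x.2.2) (dom n))
    (hω : ContDiffOn ℝ 1 ω (B34 n)) {M : ℝ≥0} (hM : c1Norm ω ≤ M) :
    wNorm σ l (kappa ω g) ≤ estimateConst l M * wNorm σ (l + 1) g := by
  have hl0 : 0 < l := by linarith
  have hl1 : 0 < l - 1 := by linarith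
  have hg := hasDecay_of_wNorm_lt_top hl hfin
  have hK := hg.nonneg
  set N := (wNorm σ (l + 1) g).toReal with hN
  have h := wNorm_le hl (c := 2 * (N * 2 ^ (l + 1) / l))
    (d := (M + 1) * (N * 2 ^ (l + 1)) / (l - 1)) (by positivity) (by positivity)
    (fun t ht p hp => holderNorm_kappa_le (ω := ω) hg hB hl0 ht hp)
    (fun θ t ht p hp => norm_dParam_kappa_le hg hB hσ hl hθ hω θ ht hp
      (norm_fderiv_le_of_c1Norm_le hM hp))
  refine h.trans_eq ?_
  rw [estimateConst, ← ENNReal.ofReal_toReal hfin.ne, ← hN, ENNReal.ofNNReal_toNNReal,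
    ← ENNReal.ofReal_mul (by positivity)]
  congr 1
  ring

end Estimate

end HomEq

/-- Existence, uniqueness and estimate for the homological equation. The hypothesis on `∂_θ g` is
required in the endpoint case `σ = 1` only. -/
theorem homological_equation_exists_unique (n : ℕ) (l : ℝ) (hl : 1 < l) :
    ∃ C : ℝ≥0 → ℝ≥0,
      ∀ (σ : ℝ) (_ : 1 ≤ σ)
        (ω : E n → E n) (_ : ContDiffOn ℝ 1 ω (B34 n))
        (g : E n → ℝ → E n → ℝ) (_ : MemB σ g) (_ : wNorm σ (l + 1) g < ⊤)
        (_ : σ = 1 →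
          ContinuousOn (fun x : E n × ℝ × E n => dTheta g x.1 x.2.1 x.2.2) (dom n)),
        -- the integral defining `κ` converges absolutely
        (∀ θ : E n, ∀ t ∈ Ici (0 : ℝ), ∀ p ∈ B34 n,
          IntegrableOn (fun τ => g (θ + (τ - t) • ω p) τ p) (Ioi t)) ∧
        -- `κ` is a solution in `B⁺_σ` that vanishes at infinity
        MemB σ (kappa ω g) ∧ IsSolution ω g (kappa ω g) ∧ Vanishes (kappa ω g) ∧
        -- and the only one
        (∀ κ' : E n → ℝ → E n → ℝ, MemB σ κ' → IsSolution ω g κ' → Vanishes κ' →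
          ∀ θ : E n, ∀ t ∈ Ici (0 : ℝ), ∀ p ∈ B34 n, κ' θ t p = kappa ω g θ t p) ∧
        -- the estimate, with a constant depending only on `n`, `l` and a bound for `|ω|_{C¹}`
        (∀ M : ℝ≥0, c1Norm ω ≤ M → wNorm σ l (kappa ω g) ≤ C M * wNorm σ (l + 1) g) := by
  refine ⟨estimateConst l, ?_⟩
  intro σ hσ ω hω g hB hfin h1
  have hl0 : 0 < l := by linarith
  have hg := hasDecay_of_wNorm_lt_top hl hfin
  have hθ := continuousOn_dTheta hg hB hl0.le hσ h1
  have hBκ := memB_kappa hg hB hσ hl hθ hω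
  have hsol := isSolution_kappa (ω := ω) hg hB hσ hl0
  have hvan := vanishes_kappa (ω := ω) hg hB hl0
  refine ⟨fun θ t ht p hp => integrableOn_characteristic hg hB hl0 θ (ω p) ht hp, hBκ, hsol, hvan,
    fun κ' hB' hsol' hvan' θ t ht p hp => le_antisymm ?_ ?_,
    fun M hM => wNorm_kappa_le hσ hl hB hfin hθ hω hM⟩
  · exact IsSolution.le_of_vanishes hB' hBκ hsol' hsol hvan' hvan θ ht hp
  · exact IsSolution.le_of_vanishes hBκ hB' hsol hsol' hvan hvan' θ ht hp
end

section
/- Let $\mathbb{T}^n=\mathbb{R}^n/\mathbb{Z}^n$, $\mathbb{R}^+=[0,+\infty)$, let $B_{3/4}\subset\mathbb{R}^n$ be the open ball of radius $3/4$ centred at the origin, and let $M_n$ be the set of real $n\times n$ matrices. For $f$ on $\mathbb{T}^n\times\mathbb{R}^+\times B_{3/4}$ write $f^t_{p_0}(\theta)=f(\theta,t;p_0)$, and for $\sigma\ge 1$ let $|\cdot|_{C^\sigma}$ be the Hölder norm on $\mathbb{T}^n$ (the $C^k$ norm, i.e. the supremum of the $C^0$ norms of all partial derivatives of order $\le k$,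 if $\sigma=k\in\mathbb{N}$; the $C^k$ norm plus the largest $\mu$-Hölder seminorm of the partial derivatives of order $k$ if $\sigma=k+\mu$, $0<\mu<1$). Let $\mathcal{B}^+_\sigma$ be the space of (scalar-, vector- or matrix-valued) functions $f$ on $\mathbb{T}^n\times\mathbb{R}^+\times B_{3/4}$ such that $\partial_{p_0}f$ exists, $f$ and $\partial_{p_0}f$ are continuous, and $f^t_{p_0}\in C^\sigma(\mathbb{T}^n)$ for all $(t,p_0)$. Put $$|f|^+_{\sigma,l}=\sup_{(t,p_0)}|f^t_{p_0}|_{C^\sigma}(1+t^l)+\sup_{(t,p_0)}|(\partial_{p_0}f)^t_{p_0}|_{C^0}(1+t^{l-1})\quad (l\ge 1),$$ $$|f|^+_{\sigma,0}=\sup_{(t,p_0)}|f^t_{p_0}|_{C^\sigma}+\sup_{(t,p_0)}|(\partial_{p_0}f)^t_{p_0}|_{C^0}.$$ For $\omega:B_{3/4}\to\mathbb{R}^n$ and an $\mathbb{R}^n$-valued map $u$ that is differentiable in $\theta$ and in $t$, write $(\nabla_{\theta t}u)\Omega$ for the map $(\theta,t;p_0)\mapsto\partial_\theta u(\theta,t;p_0)\,\omega(p_0)+\partial_t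 u(\theta,t;p_0)$. Let $\sigma\ge 1$, $l>1$, let $\omega\in C^1(B_{3/4},\mathbb{R}^n)$ with $|\omega|_{C^1}<\infty$, and let $\bar m_0:\mathbb{T}^n\times\mathbb{R}^+\times B_{3/4}\to M_n$ be a map in $\mathcal{B}^+_\sigma$ with $|\bar m_0|^+_{\sigma,0}<\infty$. Let $z,g\in\mathcal{B}^+_\sigma$ be $\mathbb{R}^n$-valued with $|z|^+_{\sigma,l+1}<\infty$ and $|g|^+_{\sigma,l+2}<\infty$. If $\sigma=1$, assume in addition that $\partial_\theta\bar m_0$, $\partial_\theta z$ and $\partial_\theta g$ are continuous on $\mathbb{T}^n\times\mathbb{R}^+\times B_{3/4}$ (for $\sigma>1$ this is automatic). Then there exists a unique pair $(\hat u,\hat v)$ of $\mathbb{R}^n$-valued maps on $\mathbb{T}^n\times\mathbb{R}^+\times B_{3/4}$, differentiable in $t$, with $\hat u,\hat v,(\nabla_{\theta t}\hat u)\Omega,(\nabla_{\theta t}\hat v)\Omega\in\mathcal{B}^+_\sigma$, $|\hat u|^+_{\sigma,l}<\infty$, $|\hat v|^+_{\sigma,l+1}<\infty$ and $\lim_{t\to+\infty}|\hat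 u^t_{p_0}|_{C^0}=\lim_{t\to+\infty}|\hat v^t_{p_0}|_{C^0}=0$ for each $p_0\in B_{3/4}$, solving the linearized system $$\bar m_0\hat v-(\nabla_{\theta t}\hat u)\Omega=z,\qquad(\nabla_{\theta t}\hat v)\Omega=g .$$ The derivatives $\partial_\theta\hat u$ and $\partial_\theta\hat v$ are continuous on $\mathbb{T}^n\times\mathbb{R}^+\times B_{3/4}$. Moreover, $$\max\{|\hat u|^+_{\sigma,l},\,|(\nabla_{\theta t}\hat u)\Omega|^+_{\sigma,l+1}\}\le\bar C\left(|\bar m_0|^+_{\sigma,0}\,|g|^+_{\sigma,l+2}+|z|^+_{\sigma,l+1}\right),$$ $$\max\{|\hat v|^+_{\sigma,l+1},\,|(\nabla_{\theta t}\hat v)\Omega|^+_{\sigma,l+2}\}\le\bar C\,|g|^+_{\sigma,l+2},$$ for a constant $\bar C$ depending only on $n$, $l$ and (an upper bound for) $|\omega|_{C^1}$. -/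
open scoped ENNReal NNReal Topology
open Filter Metric Set

noncomputable section

namespace LinOp

/-- `ℝⁿ` with the Euclidean norm. Functions on the torus `𝕋ⁿ = ℝⁿ/ℤⁿ` are written as `ℤⁿ`-periodic
functions on `ℝⁿ`. -/
abbrev E (n : ℕ) := EuclideanSpace ℝ (Fin n)

/-- The ball `B_{3/4}` of parameters `p₀`. -/
abbrev B (n : ℕ) : Set (E n) := ball 0 (3 / 4)

/-- The point of `ℝⁿ` with integer coordinates `k`. -/
def latt {n : ℕ} (k : Fin n → ℤ) : E n := WithLp.toLp 2 fun i => (k i : ℝ)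

variable {n : ℕ} {F : Type*} [NormedAddCommGroup F] [NormedSpace ℝ F]

/-- The partial derivative `∂_{a 0} ⋯ ∂_{a (i-1)} f` of order `i` of a function on `ℝⁿ`. -/
def partialD (i : ℕ) (a : Fin i → Fin n) (f : E n → F) (x : E n) : F :=
  iteratedFDeriv ℝ i f x fun j => EuclideanSpace.single (a j) (1 : ℝ)

/-- The `C⁰` norm. -/
def c0Norm (f : E n → F) : ℝ≥0∞ := ⨆ x : E n, ‖f x‖ₑ

/-- The `C^k` norm: the supremum of the `C⁰` norms of all partial derivatives of order `≤ k`. -/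
def ckNorm (k : ℕ) (f : E n → F) : ℝ≥0∞ :=
  ⨆ (i : ℕ) (_ : i ≤ k) (a : Fin i → Fin n), c0Norm (partialD i a f)

/-- The `μ`-Hölder seminorm of the partial derivatives of order `k`. -/
def holderSeminorm (k : ℕ) (μ : ℝ) (f : E n → F) : ℝ≥0∞ :=
  ⨆ (a : Fin k → Fin n) (x : E n) (y : E n) (_ : x ≠ y),
    ENNReal.ofReal (‖partialD k a f x - partialD k a f y‖ / ‖x - y‖ ^ μ)

/-- The Hölder norm `|f|_{C^σ}`: the `C^k` norm if `σ = k` is an integer, and the `C^k` norm plus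
the `μ`-Hölder seminorm of the partial derivatives of order `k` if `σ = k + μ`, `0 < μ < 1`. -/
def holderNorm (σ : ℝ) (f : E n → F) : ℝ≥0∞ :=
  ckNorm ⌊σ⌋₊ f + if (⌊σ⌋₊ : ℝ) = σ then 0 else holderSeminorm ⌊σ⌋₊ (σ - ⌊σ⌋₊) f

/-- Membership in the Hölder class `C^σ`. -/
def IsHolder (σ : ℝ) (f : E n → F) : Prop :=
  ContDiff ℝ ⌊σ⌋₊ f ∧ holderNorm σ f < ⊤

/-! Functions of `(θ, t, p₀) ∈ 𝕋ⁿ × ℝ⁺ × B_{3/4}` are functions on `ℝⁿ × ℝ × ℝⁿ` of which only the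
values at `t ≥ 0` and `p₀ ∈ B_{3/4}` matter. -/

/-- The set `𝕋ⁿ × ℝ⁺ × B_{3/4}` (its lift to the universal cover in the first factor). -/
def dom (n : ℕ) : Set (E n × ℝ × E n) := univ ×ˢ (Ici 0 ×ˢ B n)

/-- The derivative `∂_{p₀} f`. -/
def dP (f : E n → ℝ → E n → F) (θ : E n) (t : ℝ) (p : E n) : E n →L[ℝ] F :=
  fderiv ℝ (fun p' => f θ t p') p

/-- The derivative `∂_θ f`. -/
def dTheta (f : E n → ℝ → E n → F) (θ : E n) (t : ℝ) (p : E n) : E n →L[ℝ] F :=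
  fderiv ℝ (fun θ' => f θ' t p) θ

/-- The time derivative `∂_t f` on `ℝ⁺` (one-sided at `t = 0`). -/
def dT (f : E n → ℝ → E n → F) (θ : E n) (t : ℝ) (p : E n) : F :=
  derivWithin (fun s => f θ s p) (Ici 0) t

/-- The derivative `(∇_{θt} f) Ω = ∂_θ f ω + ∂_t f`. -/
def dOmega (ω : E n → E n) (f : E n → ℝ → E n → F) (θ : E n) (t : ℝ) (p : E n) : F :=
  dTheta f θ t p (ω p) + dT f θ t p

/-- The space `B⁺_σ`. -/
structure MemB (σ : ℝ) (f : E n → ℝ → E n → F) : Prop where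
  periodic : ∀ (θ : E n), ∀ t ∈ Ici (0 : ℝ), ∀ p ∈ B n, ∀ k : Fin n → ℤ,
    f (θ + latt k) t p = f θ t p
  cont : ContinuousOn (fun x : E n × ℝ × E n => f x.1 x.2.1 x.2.2) (dom n)
  diffP : ∀ (θ : E n), ∀ t ∈ Ici (0 : ℝ), ∀ p ∈ B n,
    DifferentiableAt ℝ (fun p' => f θ t p') p
  contP : ContinuousOn (fun x : E n × ℝ × E n => dP f x.1 x.2.1 x.2.2) (dom n)
  holder : ∀ t ∈ Ici (0 : ℝ), ∀ p ∈ B n, IsHolder σ fun θ => f θ t p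

/-- Continuity of `∂_θ f` in all variables `(θ, t, p₀)` together. -/
def ContTheta (f : E n → ℝ → E n → F) : Prop :=
  ContinuousOn (fun x : E n × ℝ × E n => dTheta f x.1 x.2.1 x.2.2) (dom n)

/-- The weight `1 + t^l`, to be replaced by `1` for `l = 0`. -/
def weight (l t : ℝ) : ℝ := if l = 0 then 1 else 1 + t ^ l

/-- The weight `1 + t^(l-1)` of the `p₀`-derivative, to be replaced by `1` for `l = 0`. -/
def weightP (l t : ℝ) : ℝ := if l = 0 then 1 else 1 + t ^ (l - 1)

/-- The weighted norm `|f|⁺_{σ,l}` (used for `l = 0` and `l ≥ 1`). -/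
def wNorm (σ l : ℝ) (f : E n → ℝ → E n → F) : ℝ≥0∞ :=
  (⨆ t ∈ Ici (0 : ℝ), ⨆ p ∈ B n,
      holderNorm σ (fun θ => f θ t p) * ENNReal.ofReal (weight l t)) +
    ⨆ t ∈ Ici (0 : ℝ), ⨆ p ∈ B n,
      c0Norm (fun θ => dP f θ t p) * ENNReal.ofReal (weightP l t)

/-- The norm `|ω|_{C¹}` of a map on `B_{3/4}`. -/
def c1NormB (ω : E n → E n) : ℝ≥0∞ :=
  ⨆ p ∈ B n, max ‖ω p‖ₑ ‖fderiv ℝ ω p‖ₑ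

/-- `f` is differentiable in `t`, and `f` and `(∇_{θt} f) Ω` belong to `B⁺_σ`; moreover
`|f|⁺_{σ,l} < ∞` and `|f^t_{p₀}|_{C⁰} → 0` as `t → +∞` for each `p₀`. -/
structure Admissible (σ l : ℝ) (ω : E n → E n) (f : E n → ℝ → E n → F) : Prop where
  mem : MemB σ f
  diffT : ∀ (θ : E n), ∀ t ∈ Ici (0 : ℝ), ∀ p ∈ B n,
    DifferentiableWithinAt ℝ (fun s => f θ s p) (Ici 0) t
  memOmega : MemB σ (dOmega ω f)
  finite : wNorm σ l f < ⊤
  decay : ∀ p ∈ B n, Tendsto (fun t : ℝ => c0Norm fun θ => f θ t p) atTop (𝓝 0)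

/-- `(u, v)` is a solution, in the class where it is sought, of the linearized system
`m₀ v - (∇_{θt} u) Ω = z`, `(∇_{θt} v) Ω = g`. Matrices are identified with linear maps. -/
structure IsSolution (σ l : ℝ) (ω : E n → E n) (m₀ : E n → ℝ → E n → (E n →L[ℝ] E n))
    (z g u v : E n → ℝ → E n → E n) : Prop where
  admU : Admissible σ l ω u
  admV : Admissible σ (l + 1) ω v
  eq₁ : ∀ (θ : E n), ∀ t ∈ Ici (0 : ℝ), ∀ p ∈ B n,
    m₀ θ t p (v θ t p) - dOmega ω u θ t p = z θ t p
  eq₂ : ∀ (θ : E n), ∀ t ∈ Ici (0 : ℝ), ∀ p ∈ B n, dOmega ω v θ t p = g θ t p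

end LinOp

end

open LinOp

noncomputable section

namespace LinOp

variable {n : ℕ} {F G H : Type*} [NormedAddCommGroup F] [NormedSpace ℝ F]
  [NormedAddCommGroup G] [NormedSpace ℝ G] [NormedAddCommGroup H] [NormedSpace ℝ H]

/-- The standard basis vector `e_j` of `ℝⁿ`. -/
abbrev basisVec (j : Fin n) : E n := EuclideanSpace.single j (1 : ℝ)

/-- The first order partial derivative `∂_j f`. -/
def pderiv (j : Fin n) (f : E n → F) (x : E n) : F := fderiv ℝ f x (basisVec j)

lemma partialD_zero (a : Fin 0 → Fin n) (f : E n → F) : partialD 0 a f = f := by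
  funext x
  simp [partialD]

lemma partialD_succ_init {i : ℕ} (a : Fin (i + 1) → Fin n) {f : E n → F}
    (hf : ContDiff ℝ (i + 1 : ℕ) f) :
    partialD (i + 1) a f = partialD i (Fin.init a) (pderiv (a (Fin.last i)) f) := by
  funext x
  unfold partialD pderiv
  rw [iteratedFDeriv_succ_apply_right]
  rw [iteratedFDeriv_clm_apply_const_apply (n := (i : ℕ)) _ (by exact le_rfl)]
  · rfl
  · exact (hf.fderiv_right (by norm_cast))

lemma partialD_succ_tail {i : ℕ} (a : Fin (i + 1) → Fin n) {f : E n → F}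
    (hf : ContDiff ℝ (i + 1 : ℕ) f) :
    partialD (i + 1) a f = pderiv (a 0) (partialD i (Fin.tail a) f) := by
  funext x
  unfold partialD pderiv
  have h : DifferentiableAt ℝ (iteratedFDeriv ℝ i f) x :=
    hf.differentiable_iteratedFDeriv (by exact_mod_cast Nat.lt_succ_self i) x
  rw [iteratedFDeriv_succ_apply_left]
  rw [fderiv_continuousMultilinear_apply_const_apply h]
  rfl

lemma partialD_pderiv {i : ℕ} (a : Fin i → Fin n) (j : Fin n) {f : E n → F}
    (hf : ContDiff ℝ (i + 1 : ℕ) f) :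
    partialD i a (pderiv j f) = partialD (i + 1) (Fin.snoc a j : Fin (i + 1) → Fin n) f := by
  rw [partialD_succ_init _ hf]
  simp

lemma pderiv_partialD {i : ℕ} (a : Fin i → Fin n) (j : Fin n) {f : E n → F}
    (hf : ContDiff ℝ (i + 1 : ℕ) f) :
    pderiv j (partialD i a f) = partialD (i + 1) (Fin.cons j a : Fin (i + 1) → Fin n) f := by
  rw [partialD_succ_tail _ hf]
  simp

lemma partialD_one (a : Fin 1 → Fin n) (f : E n → F) : partialD 1 a f = pderiv (a 0) f := by
  funext x
  unfold partialD pderiv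
  rw [iteratedFDeriv_one_apply]

lemma contDiff_pderiv {k : ℕ} (j : Fin n) {f : E n → F} (hf : ContDiff ℝ (k + 1 : ℕ) f) :
    ContDiff ℝ k (pderiv j f) :=
  (hf.fderiv_right (by norm_cast)).clm_apply contDiff_const

lemma contDiff_partialD {i k : ℕ} (a : Fin i → Fin n) {f : E n → F}
    (hf : ContDiff ℝ (i + k : ℕ) f) : ContDiff ℝ k (partialD i a f) := by
  have h := hf.iteratedFDeriv_right (m := (k : ℕ)) (i := i) (by norm_cast; omega)
  exact (ContinuousMultilinearMap.apply ℝ (fun _ : Fin i => E n) F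
    (fun j => basisVec (a j))).contDiff.comp h

lemma partialD_add {i : ℕ} (a : Fin i → Fin n) {f g : E n → F}
    (hf : ContDiff ℝ i f) (hg : ContDiff ℝ i g) :
    partialD i a (fun x => f x + g x) = fun x => partialD i a f x + partialD i a g x := by
  funext x
  unfold partialD
  have := iteratedFDeriv_add_apply (x := x) hf.contDiffAt hg.contDiffAt
  have h2 := congrArg (fun L => L fun j => basisVec (a j)) this
  exact h2

lemma partialD_neg {i : ℕ} (a : Fin i → Fin n) (f : E n → F) :
    partialD i a (fun x => - f x) = fun x => - partialD i a f x := by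
  funext x
  unfold partialD
  have := iteratedFDeriv_neg_apply (𝕜 := ℝ) (i := i) (f := f) (x := x)
  have h2 := congrArg (fun L => L fun j => basisVec (a j)) this
  exact h2

lemma partialD_comp_add_right {i : ℕ} (a : Fin i → Fin n) (f : E n → F) (c x : E n) :
    partialD i a (fun y => f (y + c)) x = partialD i a f (x + c) := by
  unfold partialD
  rw [iteratedFDeriv_comp_add_right]

lemma sum_smul_basisVec (x : E n) : ∑ i, x i • basisVec i = x := by
  ext j
  simp [Finset.sum_apply, Pi.single_apply]

lemma clm_apply_eq_sum (L : E n →L[ℝ] F) (x : E n) : L x = ∑ i, x i • L (basisVec i) := by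
  conv_lhs => rw [← sum_smul_basisVec x]
  simp [map_sum]

lemma opNorm_le_card_mul {M : ℝ} (hM : 0 ≤ M) (L : E n →L[ℝ] F) (h : ∀ i, ‖L (basisVec i)‖ ≤ M) :
    ‖L‖ ≤ n * M := by
  refine L.opNorm_le_bound (by positivity) fun x => ?_
  rw [clm_apply_eq_sum]
  calc ‖∑ i, x i • L (basisVec i)‖ ≤ ∑ i : Fin n, ‖x‖ * M := by
        refine norm_sum_le_of_le _ fun i _ => ?_
        rw [norm_smul]
        exact mul_le_mul (PiLp.norm_apply_le x i) (h i) (norm_nonneg _) (norm_nonneg _)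
    _ = n * M * ‖x‖ := by simp; ring

/-- `M` bounds the partial derivatives of `f` of order at most `⌊σ⌋` and, if `σ` is not an integer,
the Hölder constants of those of order `⌊σ⌋`. -/
structure HolderBd (σ M : ℝ) (f : E n → F) : Prop where
  bound : ∀ i ≤ ⌊σ⌋₊, ∀ (a : Fin i → Fin n) (x : E n), ‖partialD i a f x‖ ≤ M
  holder : (⌊σ⌋₊ : ℝ) ≠ σ → ∀ (a : Fin ⌊σ⌋₊ → Fin n) (x y : E n),
    ‖partialD ⌊σ⌋₊ a f x - partialD ⌊σ⌋₊ a f y‖ ≤ M * ‖x - y‖ ^ (σ - ⌊σ⌋₊)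

/-- `ℤⁿ`-periodicity. -/
def Periodic (f : E n → F) : Prop := ∀ (x : E n) (k : Fin n → ℤ), f (x + latt k) = f x

lemma latt_single (j : Fin n) : latt (Pi.single j (1 : ℤ)) = basisVec j := by
  ext i
  by_cases h : i = j <;> simp [latt, h, Pi.single_apply]

lemma Periodic.partialD {f : E n → F} (hf : Periodic f) {i : ℕ} (a : Fin i → Fin n) :
    Periodic (partialD i a f) := by
  intro x k
  rw [← partialD_comp_add_right]
  congr 1
  funext y
  exact hf y k

lemma hasDerivAt_line {f : E n → F} {x e : E n} {r : ℝ}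
    (hf : DifferentiableAt ℝ f (x + r • e)) :
    HasDerivAt (fun s : ℝ => f (x + s • e)) (fderiv ℝ f (x + r • e) e) r := by
  have h1 : HasDerivAt (fun s : ℝ => x + s • e) e r := by
    simpa using ((hasDerivAt_id r).smul_const e).const_add x
  exact hf.hasFDerivAt.comp_hasDerivAt r h1

lemma norm_line_sub_le {f : E n → F} (hf : Differentiable ℝ f) (j : Fin n) {M : ℝ}
    (hM : ∀ x, ‖pderiv j f x‖ ≤ M) (x : E n) (r : ℝ) :
    ‖f (x + r • basisVec j) - f x‖ ≤ M * |r| := by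
  have h := Convex.norm_image_sub_le_of_norm_hasDerivWithin_le (s := univ)
    (f := fun s : ℝ => f (x + s • basisVec j)) (C := M) (x := 0) (y := r)
    (fun s _ => (hasDerivAt_line (hf _)).hasDerivWithinAt) (fun s _ => hM _) convex_univ
    (mem_univ _) (mem_univ _)
  simpa using h

/-- On a circle of length one, a derivative is at most half the supremum of the next one. -/
lemma norm_pderiv_le_half {q : E n → F} (j : Fin n) (hper : Periodic q)
    (hq : Differentiable ℝ q) (hh : Differentiable ℝ (pderiv j q)) {M : ℝ}
    (hM : ∀ x, ‖pderiv j (pderiv j q) x‖ ≤ M) (x : E n) : ‖pderiv j q x‖ ≤ M / 2 := by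
  have hM0 : 0 ≤ M := (norm_nonneg _).trans (hM x)
  have h := Convex.norm_image_sub_le_of_norm_hasDerivWithin_le (s := Icc (-(1 / 2) : ℝ) (1 / 2))
    (f := fun s : ℝ => q (x + s • basisVec j) - s • pderiv j q x) (C := M / 2)
    (f' := fun s => pderiv j q (x + s • basisVec j) - pderiv j q x)
    (x := -(1 / 2)) (y := 1 / 2)
    (fun s _ => (by
      have h1 := hasDerivAt_line (x := x) (e := basisVec j) (r := s) (hq _)
      have h2 := (hasDerivAt_id s).smul_const (pderiv j q x)
      have h3 := h1.sub h2
      simp only [one_smul] at h3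
      exact h3.hasDerivWithinAt))
    (fun s hs => (norm_line_sub_le hh j hM x s).trans (by
      have : |s| ≤ 1 / 2 := abs_le.2 hs
      nlinarith)) (convex_Icc _ _) (by constructor <;> norm_num) (by constructor <;> norm_num)
  have h4 : q (x + (1 / 2 : ℝ) • basisVec j) = q (x + (-(1 / 2) : ℝ) • basisVec j) := by
    rw [← hper (x + (-(1 / 2) : ℝ) • basisVec j) (Pi.single j 1), latt_single]
    congr 1
    module
  rw [h4] at h
  have h5 : q (x + (-(1 / 2) : ℝ) • basisVec j) - (1 / 2 : ℝ) • pderiv j q x -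
      (q (x + (-(1 / 2) : ℝ) • basisVec j) - (-(1 / 2) : ℝ) • pderiv j q x) = - pderiv j q x := by
    module
  rw [h5, norm_neg] at h
  norm_num at h
  exact h

lemma norm_partialD_le_of_periodic {f : E n → F} (hper : Periodic f) {M : ℝ} (d : ℕ) :
    ∀ (j : ℕ), ContDiff ℝ (j + 1 + d : ℕ) f →
      (∀ (a : Fin (j + 1 + d) → Fin n) x, ‖partialD (j + 1 + d) a f x‖ ≤ M) →
      ∀ (a : Fin (j + 1) → Fin n) x, ‖partialD (j + 1) a f x‖ ≤ M / 2 ^ d := by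
  induction d with
  | zero => intro j _ h a x; simpa using h a x
  | succ d ih =>
    intro j hf h a x
    have e : j + 1 + (d + 1) = j + 1 + 1 + d := by omega
    rw [e] at hf h
    have h1 := ih (j + 1) hf h
    have hf1 : ContDiff ℝ (j + 1 + 1 : ℕ) f := hf.of_le (by norm_cast; omega)
    have hf0 : ContDiff ℝ (j + 1 : ℕ) f := hf.of_le (by norm_cast; omega)
    rw [partialD_succ_tail a hf0]
    refine (norm_pderiv_le_half (a 0) (hper.partialD _)
      ((contDiff_partialD (k := 1) _ hf0).differentiable (by norm_num)) ?_
      (M := M / 2 ^ d) ?_ x).trans_eq ?_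
    · rw [← partialD_succ_tail a hf0]
      exact (contDiff_partialD (k := 1) _ hf1).differentiable (by norm_num)
    · intro y
      rw [← partialD_succ_tail a hf0, pderiv_partialD _ _ hf1]
      exact h1 _ _
    · rw [pow_succ]; field_simp

/-- The weights of the interpolation inequality: partial derivatives of order `j ≤ k` of a periodic
function are at most `interpWt k j` times its `C^k` norm. -/
def interpWt (k j : ℕ) : ℝ := 1 / 2 ^ (k - j) + if j = 0 then 1 else 0

lemma interpWt_nonneg (k j : ℕ) : 0 ≤ interpWt k j := by
  unfold interpWt; split_ifs <;> positivity

lemma norm_partialD_le_interpWt {f : E n → F} (hper : Periodic f) {M : ℝ} {k : ℕ}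
    (hf : ContDiff ℝ k f) (hM : ∀ i ≤ k, ∀ (a : Fin i → Fin n) x, ‖partialD i a f x‖ ≤ M)
    {j : ℕ} (hj : j ≤ k) (a : Fin j → Fin n) (x : E n) :
    ‖partialD j a f x‖ ≤ M * interpWt k j := by
  have hM0 : 0 ≤ M := (norm_nonneg _).trans (hM j hj a x)
  unfold interpWt
  rcases j with _ | j
  · refine (hM 0 hj a x).trans ?_
    simp only [if_true]
    have : 0 ≤ M * (1 / 2 ^ (k - 0)) := by positivity
    linarith
  · obtain ⟨d, rfl⟩ := Nat.exists_eq_add_of_le hj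
    have := norm_partialD_le_of_periodic hper d j hf (hM _ le_rfl) a x
    simpa [div_eq_mul_inv] using this

lemma sum_choose_interpWt_le (i : ℕ) :
    ∑ ij ∈ Finset.HasAntidiagonal.antidiagonal i, (i.choose ij.1 : ℝ) * (interpWt i ij.1 * interpWt i ij.2) ≤ 4 := by
  have h1 : ∀ ij ∈ Finset.HasAntidiagonal.antidiagonal i,
      (i.choose ij.1 : ℝ) * (interpWt i ij.1 * interpWt i ij.2) ≤
        (i.choose ij.1 : ℝ) * (1 / 2 ^ i) +
          ((if ij.1 = 0 then 2 else 0) + (if ij.2 = 0 then 1 else 0)) := by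
    rintro ⟨j, j'⟩ h
    rw [Finset.HasAntidiagonal.mem_antidiagonal] at h
    subst h
    have e1 : j + j' - j = j' := by omega
    have e2 : j + j' - j' = j := by omega
    simp only [interpWt, e1, e2]
    rcases Nat.eq_zero_or_pos j with rfl | hj <;> rcases Nat.eq_zero_or_pos j' with rfl | hj'
    · norm_num
    · simp [hj'.ne']
    · simp [hj.ne']
    · simp [hj.ne', hj'.ne', pow_add]
  refine (Finset.sum_le_sum h1).trans ?_
  rw [Finset.sum_add_distrib, Finset.sum_add_distrib, ← Finset.sum_mul]
  have h2 : ∑ ij ∈ Finset.HasAntidiagonal.antidiagonal i, (i.choose ij.1 : ℝ) = 2 ^ i := by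
    rw [Finset.Nat.sum_antidiagonal_eq_sum_range_succ_mk]
    exact_mod_cast Nat.sum_range_choose i
  have h3 : ∑ ij ∈ Finset.HasAntidiagonal.antidiagonal i, (if ij.1 = 0 then (2 : ℝ) else 0) = 2 := by
    rw [Finset.Nat.sum_antidiagonal_eq_sum_range_succ_mk]
    simp
  have h4 : ∑ ij ∈ Finset.HasAntidiagonal.antidiagonal i, (if ij.2 = 0 then (1 : ℝ) else 0) = 1 := by
    rw [← Finset.Nat.sum_antidiagonal_swap, Finset.Nat.sum_antidiagonal_eq_sum_range_succ_mk]
    simp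
  rw [h2, h3, h4]
  have : (2 : ℝ) ^ i * (1 / 2 ^ i) = 1 := by field_simp
  linarith

/-- Leibniz' rule as an estimate for an arbitrary subadditive functional. -/
lemma leibniz_le (L : F →L[ℝ] G →L[ℝ] H) (q : (E n → H) → ℝ)
    (hq : ∀ f g, q (fun x => f x + g x) ≤ q f + q g) (i : ℕ) :
    ∀ (f : E n → F) (g : E n → G) (T : ℕ → ℕ → ℝ), ContDiff ℝ i f → ContDiff ℝ i g →
      (∀ j j', j + j' = i → ∀ (b : Fin j → Fin n) (c : Fin j' → Fin n),
        q (fun x => L (partialD j b f x) (partialD j' c g x)) ≤ T j j') →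
      ∀ a : Fin i → Fin n, q (partialD i a fun x => L (f x) (g x)) ≤
        ∑ ij ∈ Finset.HasAntidiagonal.antidiagonal i, (i.choose ij.1 : ℝ) * T ij.1 ij.2 := by
  induction i with
  | zero =>
    intro f g T _ _ h a
    have := h 0 0 rfl a a
    simp only [partialD_zero] at this ⊢
    simpa using this
  | succ i ih =>
    intro f g T hf hg h a
    have hL : ContDiff ℝ (i + 1 : ℕ) fun x => L (f x) (g x) :=
      (L.contDiff.comp hf).clm_apply hg
    have hf0 : ContDiff ℝ i f := hf.of_le (by norm_cast; omega)
    have hg0 : ContDiff ℝ i g := hg.of_le (by norm_cast; omega)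
    have hf1 := contDiff_pderiv (a (Fin.last i)) hf
    have hg1 := contDiff_pderiv (a (Fin.last i)) hg
    have hd : pderiv (a (Fin.last i)) (fun x => L (f x) (g x)) = fun x =>
        L (f x) (pderiv (a (Fin.last i)) g x) + L (pderiv (a (Fin.last i)) f x) (g x) := by
      funext x
      have hfx : HasFDerivAt f _ x :=
        ((hf.differentiable (by norm_cast)) x).hasFDerivAt
      have hgx : HasFDerivAt g _ x :=
        ((hg.differentiable (by norm_cast)) x).hasFDerivAt
      unfold pderiv
      rw [(L.hasFDerivAt_of_bilinear hfx hgx).fderiv]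
      simp
    rw [partialD_succ_init _ hL, hd, partialD_add]
    · refine (hq _ _).trans ?_
      rw [Finset.sum_antidiagonal_choose_succ_mul]
      refine add_le_add ?_ ?_
      · refine ih f _ (fun j j' => T j (j' + 1)) hf0 hg1 ?_ _
        intro j j' hjj b c
        rw [partialD_pderiv _ _ (hg.of_le (by norm_cast; omega))]
        exact h j (j' + 1) (by omega) _ _
      · have := ih _ g (fun j j' => T (j + 1) j') hf1 hg0 (by
          intro j j' hjj b c
          rw [partialD_pderiv _ _ (hf.of_le (by norm_cast; omega))]
          exact h (j + 1) j' (by omega) _ _) (Fin.init a)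
        refine this.trans_eq (Finset.sum_congr rfl fun ij hij => ?_)
        rw [Finset.HasAntidiagonal.mem_antidiagonal] at hij
        rw [Nat.choose_symm_of_eq_add hij.symm]
    · exact (L.contDiff.comp hf0).clm_apply hg1
    · exact (L.contDiff.comp hf1).clm_apply hg0

/-- Intermediate partial derivatives of a periodic function are Hölder continuous, with constants
that decay geometrically in the order. -/
lemma norm_partialD_sub_le {σ M : ℝ} {f : E n → F} (hper : Periodic f)
    (hf : ContDiff ℝ ⌊σ⌋₊ f) (hM : HolderBd σ M f) (hσ : (⌊σ⌋₊ : ℝ) ≠ σ) (hσ0 : 0 ≤ σ)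
    {j : ℕ} (hj : j ≤ ⌊σ⌋₊) (a : Fin j → Fin n) (x y : E n) :
    ‖partialD j a f x - partialD j a f y‖ ≤
      (2 * n + 2) * (M * interpWt ⌊σ⌋₊ j) * ‖x - y‖ ^ (σ - ⌊σ⌋₊) := by
  have hM0 : 0 ≤ M := (norm_nonneg _).trans (hM.bound j hj a x)
  have hD : 0 ≤ ‖x - y‖ ^ (σ - ⌊σ⌋₊) := by positivity
  have hw := interpWt_nonneg ⌊σ⌋₊ j
  have hle : (⌊σ⌋₊ : ℝ) ≤ σ := Nat.floor_le hσ0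
  have hlt : σ < ⌊σ⌋₊ + 1 := Nat.lt_floor_add_one σ
  rcases hj.eq_or_lt with rfl | hlt'
  · refine (hM.holder hσ a x y).trans ?_
    gcongr
    have : 1 ≤ interpWt ⌊σ⌋₊ ⌊σ⌋₊ := by
      unfold interpWt; split_ifs <;> simp
    have h2 : (1 : ℝ) ≤ 2 * n + 2 := by
      have : (0 : ℝ) ≤ n := by positivity
      linarith
    calc M = 1 * (M * 1) := by ring
      _ ≤ _ := by gcongr
  · rcases le_total ‖x - y‖ 1 with h1 | h1
    · have hf1 : ContDiff ℝ (j + 1 : ℕ) f := hf.of_le (by norm_cast)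
      have hdiff := (contDiff_partialD (k := 1) a hf1).differentiable (by norm_num)
      have hw2 : interpWt ⌊σ⌋₊ (j + 1) ≤ 2 * interpWt ⌊σ⌋₊ j := by
        unfold interpWt
        have : ⌊σ⌋₊ - j = (⌊σ⌋₊ - (j + 1)) + 1 := by omega
        rw [this, pow_succ]
        have h0 : (0 : ℝ) ≤ (if j = 0 then (1 : ℝ) else 0) := by split_ifs <;> norm_num
        have : 2 * (1 / ((2 : ℝ) ^ (⌊σ⌋₊ - (j + 1)) * 2)) = 1 / 2 ^ (⌊σ⌋₊ - (j + 1)) := by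
          field_simp
        simp only [Nat.add_eq_zero_iff, one_ne_zero, and_false, if_false]
        linarith
      have hder : ∀ z, ‖fderiv ℝ (partialD j a f) z‖ ≤ n * (M * interpWt ⌊σ⌋₊ (j + 1)) := by
        intro z
        refine opNorm_le_card_mul (mul_nonneg hM0 (interpWt_nonneg _ _)) _ fun i => ?_
        have := norm_partialD_le_interpWt hper hf hM.bound hlt' (Fin.cons i a : Fin (j + 1) → Fin n) z
        rwa [← pderiv_partialD _ _ hf1] at this
      have hl := Convex.norm_image_sub_le_of_norm_fderiv_le (s := univ)
        (fun z _ => hdiff z) (fun z _ => hder z) convex_univ (mem_univ y) (mem_univ x)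
      refine hl.trans ?_
      have hpow : ‖x - y‖ ≤ ‖x - y‖ ^ (σ - ⌊σ⌋₊) := by
        rcases (norm_nonneg (x - y)).eq_or_lt with h0 | h0
        · rw [← h0]; positivity
        · exact Real.self_le_rpow_of_le_one h0.le h1 (by linarith)
      refine mul_le_mul ?_ hpow (norm_nonneg _) (by positivity)
      calc (n : ℝ) * (M * interpWt ⌊σ⌋₊ (j + 1)) ≤ n * (M * (2 * interpWt ⌊σ⌋₊ j)) := by gcongr
        _ ≤ (2 * n + 2) * (M * interpWt ⌊σ⌋₊ j) := by
          have : 0 ≤ M * interpWt ⌊σ⌋₊ j := by positivity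
          linarith
    · have hb := fun z => norm_partialD_le_interpWt hper hf hM.bound hj a z
      have hpow : 1 ≤ ‖x - y‖ ^ (σ - ⌊σ⌋₊) := Real.one_le_rpow h1 (by linarith)
      have hMw : 0 ≤ M * interpWt ⌊σ⌋₊ j := by positivity
      calc ‖partialD j a f x - partialD j a f y‖
          ≤ M * interpWt ⌊σ⌋₊ j + M * interpWt ⌊σ⌋₊ j := norm_sub_le_of_le (hb x) (hb y)
        _ ≤ (2 * n + 2) * (M * interpWt ⌊σ⌋₊ j) * 1 := by
          have : (0 : ℝ) ≤ n * (M * interpWt ⌊σ⌋₊ j) := by positivity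
          linarith
        _ ≤ _ := by gcongr

/-- The product estimate in Hölder spaces of periodic functions, with a constant independent of the
exponent. -/
lemma HolderBd.bilinear {σ M N : ℝ} {f : E n → F} {g : E n → G} (hσ0 : 0 ≤ σ)
    (L : F →L[ℝ] G →L[ℝ] H) (hL : ∀ x y, ‖L x y‖ ≤ ‖x‖ * ‖y‖)
    (hfp : Periodic f) (hgp : Periodic g) (hf : ContDiff ℝ ⌊σ⌋₊ f) (hg : ContDiff ℝ ⌊σ⌋₊ g)
    (hM : HolderBd σ M f) (hN : HolderBd σ N g) :
    HolderBd σ (16 * (n + 1) * (M * N)) fun x => L (f x) (g x) := by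
  have hM0 : 0 ≤ M := (norm_nonneg _).trans (hM.bound 0 (Nat.zero_le _) Fin.elim0 0)
  have hN0 : 0 ≤ N := (norm_nonneg _).trans (hN.bound 0 (Nat.zero_le _) Fin.elim0 0)
  have hsum : ∀ (i : ℕ) (c : ℝ), 0 ≤ c →
      ∑ ij ∈ Finset.HasAntidiagonal.antidiagonal i, (i.choose ij.1 : ℝ) * (c * (interpWt i ij.1 * interpWt i ij.2))
        ≤ 4 * c := by
    intro i c hc
    calc _ = c * ∑ ij ∈ Finset.HasAntidiagonal.antidiagonal i,
          (i.choose ij.1 : ℝ) * (interpWt i ij.1 * interpWt i ij.2) := by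
          rw [Finset.mul_sum]; exact Finset.sum_congr rfl fun _ _ => by ring
      _ ≤ c * 4 := by gcongr; exact sum_choose_interpWt_le i
      _ = 4 * c := by ring
  have hMN : 0 ≤ M * N := mul_nonneg hM0 hN0
  have hn : (0 : ℝ) ≤ n * (M * N) := by positivity
  refine ⟨fun i hi a x => ?_, fun hσ a x y => ?_⟩
  · have := leibniz_le L (fun h => ‖h x‖) (fun f g => norm_add_le _ _) i f g
      (fun j j' => (M * N) * (interpWt i j * interpWt i j'))
      (hf.of_le (by exact_mod_cast hi)) (hg.of_le (by exact_mod_cast hi)) ?_ a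
    · refine (this.trans (hsum i _ hMN)).trans ?_
      linarith
    · intro j j' hjj b c
      refine (hL _ _).trans ?_
      have h1 := norm_partialD_le_interpWt hfp (hf.of_le (by exact_mod_cast hi))
        (fun i' hi' => hM.bound i' (hi'.trans hi)) (show j ≤ i by omega) b x
      have h2 := norm_partialD_le_interpWt hgp (hg.of_le (by exact_mod_cast hi))
        (fun i' hi' => hN.bound i' (hi'.trans hi)) (show j' ≤ i by omega) c x
      calc _ ≤ (M * interpWt i j) * (N * interpWt i j') :=
            mul_le_mul h1 h2 (norm_nonneg _) ((norm_nonneg _).trans h1)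
        _ = _ := by ring
  · set D := ‖x - y‖ ^ (σ - ⌊σ⌋₊) with hDdef
    have hD : 0 ≤ D := by positivity
    have hc : 0 ≤ 4 * (n + 1) * D * (M * N) := by positivity
    have := leibniz_le L (fun h => ‖h x - h y‖) (fun f g => by
        rw [add_sub_add_comm]; exact norm_add_le _ _) ⌊σ⌋₊ f g
      (fun j j' => (4 * (n + 1) * D * (M * N)) * (interpWt ⌊σ⌋₊ j * interpWt ⌊σ⌋₊ j'))
      hf hg ?_ a
    · refine (this.trans (hsum _ _ hc)).trans_eq ?_
      ring
    · intro j j' hjj b c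
      have hj : j ≤ ⌊σ⌋₊ := by omega
      have hj' : j' ≤ ⌊σ⌋₊ := by omega
      have h1 := norm_partialD_sub_le hfp hf hM hσ hσ0 hj b x y
      have h2 := norm_partialD_sub_le hgp hg hN hσ hσ0 hj' c x y
      have h3 := norm_partialD_le_interpWt hfp hf hM.bound hj b y
      have h4 := norm_partialD_le_interpWt hgp hg hN.bound hj' c x
      have e : L (partialD j b f x) (partialD j' c g x) - L (partialD j b f y) (partialD j' c g y) =
          L (partialD j b f x - partialD j b f y) (partialD j' c g x) +
            L (partialD j b f y) (partialD j' c g x - partialD j' c g y) := by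
        simp
      show ‖L (partialD j b f x) (partialD j' c g x) - L (partialD j b f y) (partialD j' c g y)‖ ≤ _
      rw [e]
      refine (norm_add_le_of_le (hL _ _) (hL _ _)).trans ?_
      calc _ ≤ ((2 * n + 2) * (M * interpWt ⌊σ⌋₊ j) * D) * (N * interpWt ⌊σ⌋₊ j') +
            (M * interpWt ⌊σ⌋₊ j) * ((2 * n + 2) * (N * interpWt ⌊σ⌋₊ j') * D) :=
            add_le_add
              (mul_le_mul h1 h4 (norm_nonneg _) ((norm_nonneg _).trans h1))
              (mul_le_mul h3 h2 (norm_nonneg _) ((norm_nonneg _).trans h3))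
        _ = _ := by ring

section ParametricIntegral

open MeasureTheory

variable {α : Type*} [MeasurableSpace α] {μ : Measure α}

lemma aestronglyMeasurable_pderiv {Φ : E n → α → F} (hm : ∀ x, AEStronglyMeasurable (Φ x) μ)
    (hd : ∀ᵐ s ∂μ, Differentiable ℝ fun x => Φ x s) (j : Fin n) (x : E n) :
    AEStronglyMeasurable (fun s => pderiv j (fun y => Φ y s) x) μ := by
  refine aestronglyMeasurable_of_tendsto_ae atTop
    (f := fun (N : ℕ) s => ((N : ℝ) + 1) • (Φ (x + ((N : ℝ) + 1)⁻¹ • basisVec j) s - Φ x s)) ?_ ?_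
  · intro N
    exact ((hm _).sub (hm _)).const_smul _
  · filter_upwards [hd] with s hs
    have h := hasDerivAt_line (f := fun y => Φ y s) (x := x) (e := basisVec j) (r := 0) (hs _)
    have h2 := h.tendsto_slope_zero
    have h3 : Tendsto (fun N : ℕ => ((N : ℝ) + 1)⁻¹) atTop (𝓝[≠] 0) := by
      refine tendsto_nhdsWithin_iff.2 ⟨?_, ?_⟩
      · simpa using tendsto_one_div_add_atTop_nhds_zero_nat (𝕜 := ℝ)
      · filter_upwards with N
        have : ((N : ℝ) + 1) ≠ 0 := by positivity
        simpa using this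
    have h4 := h2.comp h3
    simpa [Function.comp_def, pderiv] using h4

/-- Differentiation under the integral sign, in terms of partial derivatives. -/
lemma contDiff_integral_and_partialD {b : α → ℝ} (hb : Integrable b μ) (k : ℕ) :
    ∀ Φ : E n → α → F, (∀ x, AEStronglyMeasurable (Φ x) μ) →
      (∀ᵐ s ∂μ, ContDiff ℝ k fun x => Φ x s) →
      (∀ᵐ s ∂μ, ∀ i ≤ k, ∀ (a : Fin i → Fin n) x, ‖partialD i a (fun y => Φ y s) x‖ ≤ b s) →
      ContDiff ℝ k (fun x => ∫ s, Φ x s ∂μ) ∧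
        ∀ i ≤ k, ∀ (a : Fin i → Fin n) x,
          partialD i a (fun x => ∫ s, Φ x s ∂μ) x = ∫ s, partialD i a (fun y => Φ y s) x ∂μ ∧
          AEStronglyMeasurable (fun s => partialD i a (fun y => Φ y s) x) μ := by
  induction k with
  | zero =>
    intro Φ hm hc hbd
    refine ⟨?_, ?_⟩
    · rw [CharP.cast_eq_zero, contDiff_zero]
      refine continuous_of_dominated hm (bound := b) (fun x => ?_) hb ?_
      · filter_upwards [hbd] with s hs
        simpa [partialD_zero] using hs 0 le_rfl Fin.elim0 x
      · filter_upwards [hc] with s hs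
        exact hs.continuous
    · intro i hi
      obtain rfl : i = 0 := by omega
      intro a x
      simpa [partialD_zero] using hm x
  | succ k ih =>
    intro Φ hm hc hbd
    have hdiff : ∀ᵐ s ∂μ, Differentiable ℝ fun x => Φ x s := by
      filter_upwards [hc] with s hs
      exact hs.differentiable (by norm_cast)
    have hpd : ∀ᵐ s ∂μ, ∀ j x, ‖pderiv j (fun y => Φ y s) x‖ ≤ b s := by
      filter_upwards [hbd] with s hs j x
      have := hs 1 (by omega) (fun _ => j) x
      rwa [partialD_one] at this
    have hmd : ∀ x, AEStronglyMeasurable (fun s => fderiv ℝ (fun y => Φ y s) x) μ := by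
      intro x
      have e : ∀ s, fderiv ℝ (fun y => Φ y s) x = ∑ j : Fin n,
          (EuclideanSpace.proj j : E n →L[ℝ] ℝ).smulRight (pderiv j (fun y => Φ y s) x) := by
        intro s
        ext y
        rw [clm_apply_eq_sum]
        simp [pderiv]
      simp_rw [e]
      refine Finset.aestronglyMeasurable_fun_sum _ fun j _ => ?_
      exact ((ContinuousLinearMap.smulRightL ℝ (E n) F
        (EuclideanSpace.proj j)).continuous.comp_aestronglyMeasurable
        (aestronglyMeasurable_pderiv hm hdiff j x))
    have hbn : ∀ᵐ s ∂μ, ∀ x, ‖fderiv ℝ (fun y => Φ y s) x‖ ≤ n * b s := by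
      filter_upwards [hpd, hbd] with s hs hs' x
      exact opNorm_le_card_mul ((norm_nonneg _).trans (hs' 0 (Nat.zero_le _) Fin.elim0 0)) _
        fun i => hs i x
    have hder : ∀ x, HasFDerivAt (fun x => ∫ s, Φ x s ∂μ)
        (∫ s, fderiv ℝ (fun y => Φ y s) x ∂μ) x := by
      intro x
      refine hasFDerivAt_integral_of_dominated_of_fderiv_le (s := univ) univ_mem
        (bound := fun s => n * b s) (F' := fun x s => fderiv ℝ (fun y => Φ y s) x)
        (Eventually.of_forall hm) ?_ (hmd x) ?_ (hb.const_mul _) ?_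
      · refine hb.mono' (hm x) ?_
        filter_upwards [hbd] with s hs
        simpa [partialD_zero] using hs 0 (Nat.zero_le _) Fin.elim0 x
      · filter_upwards [hbn] with s hs x _ using hs x
      · filter_upwards [hdiff] with s hs x _ using (hs x).hasFDerivAt
    have hpint : ∀ j, pderiv j (fun x => ∫ s, Φ x s ∂μ) =
        fun x => ∫ s, pderiv j (fun y => Φ y s) x ∂μ := by
      intro j
      funext x
      unfold pderiv
      rw [(hder x).fderiv, ContinuousLinearMap.integral_apply]
      exact (hb.const_mul n).mono' (hmd x) (by filter_upwards [hbn] with s hs using hs x)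
    have hIH := fun j => ih (fun x s => pderiv j (fun y => Φ y s) x)
      (fun x => aestronglyMeasurable_pderiv hm hdiff j x)
      (by filter_upwards [hc] with s hs using contDiff_pderiv j hs)
      (by
        filter_upwards [hc, hbd] with s hs hs' i hi a x
        have := hs' (i + 1) (by omega) (Fin.snoc a j : Fin (i + 1) → Fin n) x
        rwa [← partialD_pderiv _ _ (hs.of_le (by norm_cast; omega))] at this)
    have hC : ContDiff ℝ (k + 1 : ℕ) (fun x => ∫ s, Φ x s ∂μ) := by
      have : ((k + 1 : ℕ) : WithTop ℕ∞) = (k : WithTop ℕ∞) + 1 := by norm_cast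
      rw [this, contDiff_succ_iff_fderiv_apply]
      refine ⟨fun x => (hder x).differentiableAt, fun h => ?_, fun y => ?_⟩
      · exact absurd h (by simp)
      · simp_rw [clm_apply_eq_sum _ y]
        refine ContDiff.sum fun j _ => contDiff_const.smul ?_
        have := (hIH j).1
        rw [← hpint j] at this
        exact this
    refine ⟨hC, ?_⟩
    intro i hi a x
    rcases i with _ | i
    · simpa [partialD_zero] using hm x
    · have hae : (fun s => partialD i (Fin.init a)
          (pderiv (a (Fin.last i)) fun y => Φ y s) x) =ᵐ[μ]
          fun s => partialD (i + 1) a (fun y => Φ y s) x := by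
        filter_upwards [hc] with s hs
        rw [partialD_succ_init _ (hs.of_le (by exact_mod_cast hi))]
      have hi' := (hIH (a (Fin.last i))).2 i (by omega) (Fin.init a) x
      refine ⟨?_, hi'.2.congr hae⟩
      rw [partialD_succ_init _ (hC.of_le (by exact_mod_cast hi)), hpint]
      exact hi'.1.trans (integral_congr_ae hae)

lemma HolderBd.integral {σ : ℝ} {b : α → ℝ} (hb : Integrable b μ) {Φ : E n → α → F}
    (hm : ∀ x, AEStronglyMeasurable (Φ x) μ)
    (hc : ∀ᵐ s ∂μ, ContDiff ℝ ⌊σ⌋₊ fun x => Φ x s)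
    (hh : ∀ᵐ s ∂μ, HolderBd σ (b s) fun x => Φ x s) :
    HolderBd σ (∫ s, b s ∂μ) fun x => ∫ s, Φ x s ∂μ := by
  have h := (contDiff_integral_and_partialD hb ⌊σ⌋₊ Φ hm hc
    (by filter_upwards [hh] with s hs using hs.bound)).2
  refine ⟨fun i hi a x => ?_, fun hσ a x y => ?_⟩
  · rw [(h i hi a x).1]
    refine norm_integral_le_of_norm_le hb ?_
    filter_upwards [hh] with s hs using hs.bound i hi a x
  · have hint : ∀ z, Integrable (fun s => partialD ⌊σ⌋₊ a (fun y => Φ y s) z) μ := fun z =>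
      hb.mono' (h _ le_rfl a z).2 (by filter_upwards [hh] with s hs using hs.bound _ le_rfl a z)
    rw [(h _ le_rfl a x).1, (h _ le_rfl a y).1, ← integral_sub (hint x) (hint y),
      ← integral_mul_const]
    refine norm_integral_le_of_norm_le (hb.mul_const _) ?_
    filter_upwards [hh] with s hs using hs.holder hσ a x y

end ParametricIntegral

open MeasureTheory

/-- A bound by `N` in a weighted norm equivalent to `|·|⁺_{σ,L}`. -/
structure WBd (σ L N : ℝ) (f : E n → ℝ → E n → F) : Prop where
  holder : ∀ t ∈ Ici (0 : ℝ), ∀ p ∈ B n, HolderBd σ (N * (1 + t) ^ (-L)) fun θ => f θ t p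
  dP : ∀ (θ : E n), ∀ t ∈ Ici (0 : ℝ), ∀ p ∈ B n, ‖dP f θ t p‖ ≤ N * (1 + t) ^ (1 - L)

/-- Minus the integral of `f` along the forward characteristic of `∂_θ ω + ∂_t`. -/
def charInt (ω : E n → E n) (f : E n → ℝ → E n → F) (θ : E n) (t : ℝ) (p : E n) : F :=
  -∫ r in Ioi (0 : ℝ), f (θ + r • ω p) (t + r) p

lemma setIntegral_Ioi_comp_add (φ : ℝ → F) (t : ℝ) :
    ∫ r in Ioi (0 : ℝ), φ (t + r) = ∫ s in Ioi t, φ s := by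
  have h := (measurePreserving_add_left volume t).setIntegral_preimage_emb
    (measurableEmbedding_addLeft t) φ (Ioi t)
  rw [← h]
  simp

lemma integrableOn_weight {a t : ℝ} (ha : 1 < a) (ht : 0 ≤ t) :
    IntegrableOn (fun r : ℝ => (1 + (t + r)) ^ (-a)) (Ioi 0) := by
  have := integrableOn_add_rpow_Ioi_of_lt (a := -a) (c := 0) (m := 1 + t) (by linarith)
    (by linarith)
  refine this.congr_fun (fun r _ => ?_) measurableSet_Ioi
  simp only
  congr 1
  ring

lemma integral_weight {a t : ℝ} (ha : 1 < a) (ht : 0 ≤ t) :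
    ∫ r in Ioi (0 : ℝ), (1 + (t + r)) ^ (-a) = (1 + t) ^ (1 - a) / (a - 1) := by
  simp_rw [← add_assoc]
  rw [setIntegral_Ioi_comp_add (fun s : ℝ => s ^ (-a)) (1 + t),
    integral_Ioi_rpow_of_lt (by linarith) (by linarith)]
  have h1 : a - 1 ≠ 0 := by linarith
  have h2 : -a + 1 ≠ 0 := by linarith
  rw [show -a + 1 = 1 - a by ring] at *
  rw [div_eq_div_iff h2 h1]
  ring

lemma continuousOn_integral_Ioi {X : Type*} [TopologicalSpace X] [FirstCountableTopology X]
    {s : Set X} {Φ : X → ℝ → G}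
    (hΦ : ContinuousOn (fun y : X × ℝ => Φ y.1 y.2) (s ×ˢ Ici 0)) {b : ℝ → ℝ}
    (hb : IntegrableOn b (Ioi 0)) (hbd : ∀ x ∈ s, ∀ r ∈ Ioi (0 : ℝ), ‖Φ x r‖ ≤ b r) :
    ContinuousOn (fun x => ∫ r in Ioi (0 : ℝ), Φ x r) s := by
  refine continuousOn_of_dominated (bound := b) ?_ ?_ hb ?_
  · intro x hx
    refine ContinuousOn.aestronglyMeasurable ?_ measurableSet_Ioi
    exact hΦ.comp (f := fun r : ℝ => (x, r)) (by fun_prop) fun r hr => ⟨hx, Ioi_subset_Ici_self hr⟩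
  · intro x hx
    filter_upwards [ae_restrict_mem measurableSet_Ioi] with r hr using hbd x hx r hr
  · filter_upwards [ae_restrict_mem measurableSet_Ioi] with r hr
    exact hΦ.comp (f := fun x : X => (x, r)) (by fun_prop) fun x hx => ⟨hx, Ioi_subset_Ici_self hr⟩

/-- The flow of the characteristics. -/
def charFlow (ω : E n → E n) (y : (E n × ℝ × E n) × ℝ) : E n × ℝ × E n :=
  (y.1.1 + y.2 • ω y.1.2.2, y.1.2.1 + y.2, y.1.2.2)

lemma mapsTo_charFlow (ω : E n → E n) : MapsTo (charFlow ω) (dom n ×ˢ Ici 0) (dom n) := by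
  rintro ⟨⟨θ, t, p⟩, r⟩ ⟨⟨_, ht, hp⟩, hr⟩
  exact ⟨mem_univ _, add_nonneg (mem_Ici.1 ht) (mem_Ici.1 hr), hp⟩

lemma mem_dom {θ : E n} {t : ℝ} {p : E n} (ht : t ∈ Ici (0 : ℝ)) (hp : p ∈ B n) :
    (θ, t, p) ∈ dom n := ⟨mem_univ _, ht, hp⟩

lemma continuousOn_comp_snd {X : Type*} [TopologicalSpace X] {h : E n → X} (hh : ContinuousOn h (B n)) :
    ContinuousOn (fun y : (E n × ℝ × E n) × ℝ => h y.1.2.2) (dom n ×ˢ Ici 0) :=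
  hh.comp (by fun_prop) fun _ hy => hy.1.2.2

lemma continuousOn_charFlow {ω : E n → E n} (hω : ContinuousOn ω (B n)) :
    ContinuousOn (charFlow ω) (dom n ×ˢ Ici 0) := by
  have := continuousOn_comp_snd hω
  exact (ContinuousOn.add (by fun_prop) (continuousOn_snd.smul this)).prodMk (by fun_prop)

lemma continuousOn_fix {X : Type*} [TopologicalSpace X] {h : E n × ℝ × E n → X} (hh : ContinuousOn h (dom n)) {t : ℝ}
    (ht : t ∈ Ici (0 : ℝ)) : ContinuousOn (fun y : E n × E n => h (y.1, t, y.2)) (univ ×ˢ B n) :=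
  hh.comp (f := fun y : E n × E n => (y.1, t, y.2)) (by fun_prop) fun _ hy => mem_dom ht hy.2

lemma isOpen_univ_prod_B : IsOpen ((univ : Set (E n)) ×ˢ B n) := isOpen_univ.prod isOpen_ball

section

variable {σ L N K : ℝ} {ω : E n → E n} {f : E n → ℝ → E n → F}

lemma one_le_floor (hσ : 1 ≤ σ) : 1 ≤ ⌊σ⌋₊ := Nat.le_floor (by simpa using hσ)

lemma MemB.periodic' (hf : MemB σ f) {t : ℝ} (ht : t ∈ Ici (0 : ℝ)) {p : E n} (hp : p ∈ B n) :
    Periodic fun θ => f θ t p := fun θ k => hf.periodic θ t ht p hp k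

lemma MemB.differentiable (hσ : 1 ≤ σ) (hf : MemB σ f) {t : ℝ} (ht : t ∈ Ici (0 : ℝ)) {p : E n}
    (hp : p ∈ B n) : Differentiable ℝ fun θ => f θ t p := by
  have h1 : 1 ≤ ⌊σ⌋₊ := one_le_floor hσ
  exact (hf.holder t ht p hp).1.differentiable (by norm_cast; omega)

lemma WBd.norm_le (hW : WBd σ L N f) (θ : E n) {t : ℝ} (ht : t ∈ Ici (0 : ℝ)) {p : E n}
    (hp : p ∈ B n) : ‖f θ t p‖ ≤ N * (1 + t) ^ (-L) := by
  have := (hW.holder t ht p hp).bound 0 (Nat.zero_le _) Fin.elim0 θ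
  rwa [partialD_zero] at this

lemma WBd.norm_pderiv_le (hσ : 1 ≤ σ) (hW : WBd σ L N f) (θ : E n) {t : ℝ} (ht : t ∈ Ici (0 : ℝ))
    {p : E n} (hp : p ∈ B n) (j : Fin n) :
    ‖pderiv j (fun θ => f θ t p) θ‖ ≤ N * (1 + t) ^ (-L) := by
  have := (hW.holder t ht p hp).bound 1 (one_le_floor hσ) (fun _ => j) θ
  rwa [partialD_one] at this

lemma WBd.nonneg (hW : WBd σ L N f) : 0 ≤ N := by
  have h := (norm_nonneg _).trans (hW.norm_le 0 (t := 0) self_mem_Ici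
    (mem_ball_self (by norm_num : (0 : ℝ) < 3 / 4)))
  simpa using h

lemma WBd.norm_dTheta_le (hσ : 1 ≤ σ) (hW : WBd σ L N f) (θ : E n) {t : ℝ} (ht : t ∈ Ici (0 : ℝ))
    {p : E n} (hp : p ∈ B n) : ‖dTheta f θ t p‖ ≤ n * (N * (1 + t) ^ (-L)) := by
  have ht' : (0 : ℝ) ≤ t := ht
  exact opNorm_le_card_mul (mul_nonneg hW.nonneg (by positivity)) _
    fun j => hW.norm_pderiv_le hσ θ ht hp j

lemma weight_le {a t r : ℝ} (ha : 0 ≤ a) (ht : 0 ≤ t) (hr : 0 ≤ r) :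
    (1 + (t + r)) ^ (-a) ≤ (1 + (0 + r)) ^ (-a) :=
  Real.rpow_le_rpow_of_nonpos (by linarith) (by linarith) (by linarith)

/-- Joint differentiability in `(θ, p₀)`. -/
lemma hasFDerivAt_theta_p (hσ : 1 ≤ σ) (hf : MemB σ f) (hT : ContTheta f) {t : ℝ}
    (ht : t ∈ Ici (0 : ℝ)) (θ : E n) {p : E n} (hp : p ∈ B n) :
    HasFDerivAt (fun y : E n × E n => f y.1 t y.2)
      ((dTheta f θ t p).coprod (dP f θ t p)) (θ, p) := by
  have hmem : (univ : Set (E n)) ×ˢ B n ∈ 𝓝 (θ, p) :=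
    isOpen_univ_prod_B.mem_nhds ⟨mem_univ _, hp⟩
  have h := hasStrictFDerivAt_uncurry_coprod (𝕜 := ℝ) (u := (θ, p)) (f := fun θ p => f θ t p)
    (f₁ := fun θ p => dTheta f θ t p) (f₂ := fun θ p => dP f θ t p) ?_ ?_ ?_ ?_
  · exact h.hasFDerivAt
  · filter_upwards [hmem] with y hy
    exact (hf.differentiable hσ ht hy.2 y.1).hasFDerivAt
  · filter_upwards [hmem] with y hy
    exact (hf.diffP y.1 t ht y.2 hy.2).hasFDerivAt
  · exact (continuousOn_fix hT ht).continuousAt hmem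
  · exact (continuousOn_fix hf.contP ht).continuousAt hmem

/-- The `p₀`-derivative of the integrand of `charInt`. -/
def charIntDeriv (ω : E n → E n) (f : E n → ℝ → E n → F) (x : E n × ℝ × E n) (r : ℝ) :
    E n →L[ℝ] F :=
  (dTheta f (x.1 + r • ω x.2.2) (x.2.1 + r) x.2.2).comp (r • fderiv ℝ ω x.2.2) +
    dP f (x.1 + r • ω x.2.2) (x.2.1 + r) x.2.2

lemma differentiableAt_of_contDiffOn (hω : ContDiffOn ℝ 1 ω (B n)) {p : E n} (hp : p ∈ B n) :
    DifferentiableAt ℝ ω p :=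
  (hω.differentiableOn (by norm_num)).differentiableAt (isOpen_ball.mem_nhds hp)

lemma continuousOn_fderiv_B (hω : ContDiffOn ℝ 1 ω (B n)) : ContinuousOn (fderiv ℝ ω) (B n) :=
  hω.continuousOn_fderiv_of_isOpen isOpen_ball (by norm_num)

lemma hasFDerivAt_charInt_integrand (hσ : 1 ≤ σ) (hω : ContDiffOn ℝ 1 ω (B n)) (hf : MemB σ f)
    (hT : ContTheta f) (θ : E n) {t r : ℝ} (ht : t ∈ Ici (0 : ℝ)) (hr : r ∈ Ici (0 : ℝ)) {p : E n}
    (hp : p ∈ B n) :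
    HasFDerivAt (fun p => f (θ + r • ω p) (t + r) p) (charIntDeriv ω f (θ, t, p) r) p := by
  have htr : t + r ∈ Ici (0 : ℝ) := add_nonneg (mem_Ici.1 ht) (mem_Ici.1 hr)
  have h1 : HasFDerivAt (fun p => (θ + r • ω p, p))
      ((r • fderiv ℝ ω p).prod (ContinuousLinearMap.id ℝ (E n))) p :=
    (((differentiableAt_of_contDiffOn hω hp).hasFDerivAt.const_smul r).const_add θ).prodMk
      (hasFDerivAt_id p)
  have h2 := HasFDerivAt.comp (f := fun p => (θ + r • ω p, p)) p
    (hasFDerivAt_theta_p hσ hf hT htr (θ + r • ω p) hp) h1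
  refine h2.congr_fderiv ?_
  ext y
  simp [charIntDeriv]

lemma continuousOn_charIntDeriv (hω : ContDiffOn ℝ 1 ω (B n)) (hf : MemB σ f) (hT : ContTheta f) :
    ContinuousOn (fun y : (E n × ℝ × E n) × ℝ => charIntDeriv ω f y.1 y.2) (dom n ×ˢ Ici 0) := by
  have h1 := hT.comp (continuousOn_charFlow hω.continuousOn) (mapsTo_charFlow ω)
  have h2 := hf.contP.comp (continuousOn_charFlow hω.continuousOn) (mapsTo_charFlow ω)
  have h3 := continuousOn_comp_snd (continuousOn_fderiv_B hω)
  exact (h1.clm_comp (continuousOn_snd.smul h3)).add h2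

lemma norm_charIntDeriv_le (hσ : 1 ≤ σ) (hK : ∀ p ∈ B n, ‖fderiv ℝ ω p‖ ≤ K)
    (hW : WBd σ L N f) {x : E n × ℝ × E n} (hx : x ∈ dom n) {r : ℝ} (hr : 0 ≤ r) :
    ‖charIntDeriv ω f x r‖ ≤ N * (n * K + 1) * (1 + (x.2.1 + r)) ^ (-(L - 1)) := by
  obtain ⟨θ, t, p⟩ := x
  have ht : (0 : ℝ) ≤ t := hx.2.1
  have hp : p ∈ B n := hx.2.2
  have htr : t + r ∈ Ici (0 : ℝ) := add_nonneg ht hr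
  have hN := hW.nonneg
  have hK0 : 0 ≤ K := (norm_nonneg _).trans (hK p hp)
  have hpos : 0 < 1 + (t + r) := by linarith
  unfold charIntDeriv
  simp only
  have e : (1 + (t + r)) ^ (-(L - 1)) = (1 + (t + r)) ^ (-L) * (1 + (t + r)) := by
    rw [← Real.rpow_add_one hpos.ne']; congr 1; ring
  calc _ ≤ n * (N * (1 + (t + r)) ^ (-L)) * (r * K) + N * (1 + (t + r)) ^ (1 - L) := by
        refine norm_add_le_of_le ((ContinuousLinearMap.opNorm_comp_le _ _).trans ?_)
          (hW.dP _ _ htr p hp)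
        refine mul_le_mul (hW.norm_dTheta_le hσ _ htr hp) ?_ (norm_nonneg _) (by positivity)
        rw [norm_smul, Real.norm_of_nonneg hr]
        exact mul_le_mul_of_nonneg_left (hK p hp) hr
    _ ≤ n * (N * (1 + (t + r)) ^ (-L)) * ((1 + (t + r)) * K) + N * (1 + (t + r)) ^ (1 - L) := by
        gcongr; linarith
    _ = _ := by
        rw [show 1 - L = -(L - 1) by ring, e]; ring

lemma hasFDerivAt_charInt_p (hσ : 1 ≤ σ) (hL : 2 < L) (hω : ContDiffOn ℝ 1 ω (B n))
    (hK : ∀ p ∈ B n, ‖fderiv ℝ ω p‖ ≤ K) (hf : MemB σ f) (hT : ContTheta f) (hW : WBd σ L N f)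
    (θ : E n) {t : ℝ} (ht : t ∈ Ici (0 : ℝ)) {p : E n} (hp : p ∈ B n) :
    HasFDerivAt (fun p => charInt ω f θ t p)
      (-∫ r in Ioi (0 : ℝ), charIntDeriv ω f (θ, t, p) r) p := by
  have hc := hf.cont.comp (continuousOn_charFlow hω.continuousOn) (mapsTo_charFlow ω)
  have hmeas : ∀ p ∈ B n, AEStronglyMeasurable (fun r => f (θ + r • ω p) (t + r) p)
      (volume.restrict (Ioi 0)) := by
    intro p hp
    refine ContinuousOn.aestronglyMeasurable ?_ measurableSet_Ioi
    exact hc.comp (f := fun r : ℝ => ((θ, t, p), r)) (by fun_prop)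
      fun r hr => ⟨mem_dom ht hp, Ioi_subset_Ici_self hr⟩
  refine HasFDerivAt.neg ?_
  refine hasFDerivAt_integral_of_dominated_of_fderiv_le (s := B n) (isOpen_ball.mem_nhds hp)
    (bound := fun r => N * (n * K + 1) * (1 + (t + r)) ^ (-(L - 1)))
    (F' := fun p r => charIntDeriv ω f (θ, t, p) r)
    ?_ ?_ ?_ ?_ ((integrableOn_weight (by linarith) ht).const_mul _) ?_
  · filter_upwards [isOpen_ball.mem_nhds hp] with p' hp' using hmeas p' hp'
  · refine ((integrableOn_weight (a := L) (t := t) (by linarith) ht).const_mul N).mono'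
      (hmeas p hp) ?_
    filter_upwards [ae_restrict_mem measurableSet_Ioi] with r hr
    exact hW.norm_le _ (add_nonneg (mem_Ici.1 ht) (le_of_lt hr)) hp
  · refine ContinuousOn.aestronglyMeasurable ?_ measurableSet_Ioi
    exact (continuousOn_charIntDeriv hω hf hT).comp (f := fun r : ℝ => ((θ, t, p), r))
      (by fun_prop) fun r hr => ⟨mem_dom ht hp, Ioi_subset_Ici_self hr⟩
  · filter_upwards [ae_restrict_mem measurableSet_Ioi] with r hr p' hp'
    exact norm_charIntDeriv_le hσ hK hW (mem_dom ht hp') (le_of_lt hr)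
  · filter_upwards [ae_restrict_mem measurableSet_Ioi] with r hr p' hp'
    exact hasFDerivAt_charInt_integrand hσ hω hf hT θ ht (mem_Ici.2 (le_of_lt hr)) hp'

lemma continuousOn_charInt (hL : 2 < L) (hω : ContDiffOn ℝ 1 ω (B n))
    (hf : MemB σ f) (hW : WBd σ L N f) :
    ContinuousOn (fun x : E n × ℝ × E n => charInt ω f x.1 x.2.1 x.2.2) (dom n) := by
  have hc := hf.cont.comp (continuousOn_charFlow hω.continuousOn) (mapsTo_charFlow ω)
  refine ContinuousOn.neg ?_
  refine continuousOn_integral_Ioi (b := fun r => N * (1 + (0 + r)) ^ (-L)) hc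
    ((integrableOn_weight (by linarith) le_rfl).const_mul _) ?_
  intro x hx r hr
  have ht : 0 ≤ x.2.1 := hx.2.1
  refine (hW.norm_le _ (add_nonneg ht (le_of_lt hr)) hx.2.2).trans ?_
  exact mul_le_mul_of_nonneg_left (weight_le (by linarith) ht (le_of_lt hr)) hW.nonneg

lemma contP_charInt (hσ : 1 ≤ σ) (hL : 2 < L) (hω : ContDiffOn ℝ 1 ω (B n))
    (hK : ∀ p ∈ B n, ‖fderiv ℝ ω p‖ ≤ K) (hf : MemB σ f) (hT : ContTheta f) (hW : WBd σ L N f) :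
    ContinuousOn (fun x : E n × ℝ × E n => dP (charInt ω f) x.1 x.2.1 x.2.2) (dom n) := by
  have h0 : (0 : E n) ∈ B n := mem_ball_self (by norm_num)
  have hK0 : 0 ≤ K := (norm_nonneg _).trans (hK 0 h0)
  have hN := hW.nonneg
  have h := (continuousOn_integral_Ioi (b := fun r => N * (n * K + 1) * (1 + (0 + r)) ^ (-(L - 1)))
    (continuousOn_charIntDeriv hω hf hT)
    ((integrableOn_weight (by linarith) le_rfl).const_mul _) (by
      intro x hx r hr
      have ht : 0 ≤ x.2.1 := hx.2.1
      refine (norm_charIntDeriv_le hσ hK hW hx (le_of_lt hr)).trans ?_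
      exact mul_le_mul_of_nonneg_left (weight_le (by linarith) ht (le_of_lt hr))
        (by positivity))).neg
  refine h.congr fun x hx => ?_
  exact (hasFDerivAt_charInt_p hσ hL hω hK hf hT hW x.1 hx.2.1 hx.2.2).fderiv

lemma aestronglyMeasurable_charInt_integrand (hω : ContDiffOn ℝ 1 ω (B n)) (hf : MemB σ f)
    {t : ℝ} (ht : t ∈ Ici (0 : ℝ)) {p : E n} (hp : p ∈ B n) (θ : E n) :
    AEStronglyMeasurable (fun r => f (θ + r • ω p) (t + r) p) (volume.restrict (Ioi 0)) := by
  have hc := hf.cont.comp (continuousOn_charFlow hω.continuousOn) (mapsTo_charFlow ω)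
  refine ContinuousOn.aestronglyMeasurable ?_ measurableSet_Ioi
  exact hc.comp (f := fun r : ℝ => ((θ, t, p), r)) (by fun_prop)
    fun r hr => ⟨mem_dom ht hp, Ioi_subset_Ici_self hr⟩

lemma HolderBd.comp_add_right {M : ℝ} {g : E n → F} (hg : HolderBd σ M g) (c : E n) :
    HolderBd σ M fun x => g (x + c) := by
  refine ⟨fun i hi a x => ?_, fun hσ a x y => ?_⟩
  · rw [partialD_comp_add_right]; exact hg.bound i hi a _
  · rw [partialD_comp_add_right, partialD_comp_add_right]
    simpa using hg.holder hσ a (x + c) (y + c)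

lemma HolderBd.neg {M : ℝ} {g : E n → F} (hg : HolderBd σ M g) : HolderBd σ M fun x => -g x := by
  refine ⟨fun i hi a x => ?_, fun hσ a x y => ?_⟩
  · rw [partialD_neg, norm_neg]; exact hg.bound i hi a _
  · rw [partialD_neg, ← neg_sub', norm_neg]; exact hg.holder hσ a x y

lemma HolderBd.mono {M M' : ℝ} {g : E n → F} (hg : HolderBd σ M g) (h : M ≤ M') :
    HolderBd σ M' g :=
  ⟨fun i hi a x => (hg.bound i hi a x).trans h,
    fun hσ a x y => (hg.holder hσ a x y).trans (by gcongr)⟩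

lemma contDiff_charInt_integrand (hf : MemB σ f) {t : ℝ} (ht : t ∈ Ici (0 : ℝ)) {p : E n}
    (hp : p ∈ B n) : ∀ᵐ r ∂volume.restrict (Ioi (0 : ℝ)),
      ContDiff ℝ ⌊σ⌋₊ fun θ => f (θ + r • ω p) (t + r) p := by
  filter_upwards [ae_restrict_mem measurableSet_Ioi] with r hr
  exact (hf.holder (t + r) (add_nonneg (mem_Ici.1 ht) (le_of_lt hr)) p hp).1.comp
    (contDiff_id.add contDiff_const)

lemma holderBd_charInt_integrand (hW : WBd σ L N f) {t : ℝ} (ht : t ∈ Ici (0 : ℝ)) {p : E n}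
    (hp : p ∈ B n) : ∀ᵐ r ∂volume.restrict (Ioi (0 : ℝ)),
      HolderBd σ (N * (1 + (t + r)) ^ (-L)) fun θ => f (θ + r • ω p) (t + r) p := by
  filter_upwards [ae_restrict_mem measurableSet_Ioi] with r hr
  exact (hW.holder (t + r) (add_nonneg (mem_Ici.1 ht) (le_of_lt hr)) p hp).comp_add_right _

lemma contDiff_charInt (hL : 2 < L) (hω : ContDiffOn ℝ 1 ω (B n)) (hf : MemB σ f)
    (hW : WBd σ L N f) {t : ℝ} (ht : t ∈ Ici (0 : ℝ)) {p : E n} (hp : p ∈ B n) :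
    ContDiff ℝ ⌊σ⌋₊ fun θ => charInt ω f θ t p :=
  (contDiff_integral_and_partialD
    ((integrableOn_weight (a := L) (by linarith) ht).const_mul N) ⌊σ⌋₊
    (fun θ r => f (θ + r • ω p) (t + r) p)
    (aestronglyMeasurable_charInt_integrand hω hf ht hp) (contDiff_charInt_integrand hf ht hp)
    (by filter_upwards [holderBd_charInt_integrand (ω := ω) hW ht hp] with r hr using hr.bound)).1.neg

lemma holderBd_charInt (hL : 2 < L) (hω : ContDiffOn ℝ 1 ω (B n)) (hf : MemB σ f)
    (hW : WBd σ L N f) {t : ℝ} (ht : t ∈ Ici (0 : ℝ)) {p : E n} (hp : p ∈ B n) :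
    HolderBd σ (N * ((1 + t) ^ (1 - L) / (L - 1))) fun θ => charInt ω f θ t p := by
  have := (HolderBd.integral ((integrableOn_weight (a := L) (by linarith) ht).const_mul N)
    (aestronglyMeasurable_charInt_integrand hω hf ht hp) (contDiff_charInt_integrand hf ht hp)
    (holderBd_charInt_integrand (ω := ω) hW ht hp)).neg
  rw [integral_const_mul, integral_weight (by linarith) ht] at this
  exact this

lemma wBd_charInt (hσ : 1 ≤ σ) (hL : 2 < L) (hω : ContDiffOn ℝ 1 ω (B n))
    (hK : ∀ p ∈ B n, ‖fderiv ℝ ω p‖ ≤ K) (hf : MemB σ f) (hT : ContTheta f) (hW : WBd σ L N f) :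
    WBd σ (L - 1) ((n * K + 1) / (L - 2) * N) (charInt ω f) := by
  have h0 : (0 : E n) ∈ B n := mem_ball_self (by norm_num)
  have hK0 : 0 ≤ K := (norm_nonneg _).trans (hK 0 h0)
  have hN := hW.nonneg
  refine ⟨fun t ht p hp => ?_, fun θ t ht p hp => ?_⟩
  · have ht' : (0 : ℝ) ≤ t := ht
    refine (holderBd_charInt hL hω hf hW ht hp).mono ?_
    rw [show -(L - 1) = 1 - L by ring]
    have h1 : 1 / (L - 1) ≤ (n * K + 1) / (L - 2) := by
      have : (0 : ℝ) ≤ n * K := by positivity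
      exact div_le_div₀ (by positivity) (by linarith) (by linarith) (by linarith)
    calc N * ((1 + t) ^ (1 - L) / (L - 1)) = 1 / (L - 1) * N * (1 + t) ^ (1 - L) := by ring
      _ ≤ _ := by gcongr
  · have hd := (hasFDerivAt_charInt_p hσ hL hω hK hf hT hW θ ht hp).fderiv
    unfold dP
    rw [hd, norm_neg]
    refine (norm_integral_le_of_norm_le
      ((integrableOn_weight (a := L - 1) (t := t) (by linarith) ht).const_mul (N * (n * K + 1)))
      ?_).trans_eq ?_
    · filter_upwards [ae_restrict_mem measurableSet_Ioi] with r hr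
      exact norm_charIntDeriv_le hσ hK hW (mem_dom ht hp) (le_of_lt hr)
    · rw [integral_const_mul, integral_weight (by linarith) ht]
      rw [show L - 1 - 1 = L - 2 by ring]
      ring

lemma contTheta_charInt (hσ : 1 ≤ σ) (hL : 2 < L) (hω : ContDiffOn ℝ 1 ω (B n))
    (hf : MemB σ f) (hT : ContTheta f) (hW : WBd σ L N f) : ContTheta (charInt ω f) := by
  unfold ContTheta
  rw [continuousOn_clm_apply]
  intro y
  have hc := hT.comp (continuousOn_charFlow hω.continuousOn) (mapsTo_charFlow ω)
  have hj : ∀ j : Fin n, ContinuousOn (fun x : E n × ℝ × E n => -∫ r in Ioi (0 : ℝ),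
      dTheta f (x.1 + r • ω x.2.2) (x.2.1 + r) x.2.2 (basisVec j)) (dom n) := by
    intro j
    refine ContinuousOn.neg ?_
    refine continuousOn_integral_Ioi (b := fun r => N * (1 + (0 + r)) ^ (-L))
      (hc.clm_apply continuousOn_const) ((integrableOn_weight (by linarith) le_rfl).const_mul _) ?_
    intro x hx r hr
    have ht : 0 ≤ x.2.1 := hx.2.1
    refine (hW.norm_pderiv_le hσ _ (add_nonneg ht (le_of_lt hr)) hx.2.2 j).trans ?_
    exact mul_le_mul_of_nonneg_left (weight_le (by linarith) ht (le_of_lt hr)) hW.nonneg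
  have hs : ContinuousOn (fun x : E n × ℝ × E n => ∑ j, y j • -∫ r in Ioi (0 : ℝ),
      dTheta f (x.1 + r • ω x.2.2) (x.2.1 + r) x.2.2 (basisVec j)) (dom n) :=
    continuousOn_finsetSum _ fun j _ => (hj j).const_smul (y j)
  refine hs.congr fun x hx => ?_
  obtain ⟨θ, t, p⟩ := x
  have ht : t ∈ Ici (0 : ℝ) := hx.2.1
  have hp : p ∈ B n := hx.2.2
  simp only
  rw [clm_apply_eq_sum]
  refine Finset.sum_congr rfl fun j _ => ?_
  congr 1
  have h1 := ((contDiff_integral_and_partialD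
    ((integrableOn_weight (a := L) (by linarith) ht).const_mul N) ⌊σ⌋₊
    (fun θ r => f (θ + r • ω p) (t + r) p)
    (aestronglyMeasurable_charInt_integrand hω hf ht hp) (contDiff_charInt_integrand hf ht hp)
    (by filter_upwards [holderBd_charInt_integrand (ω := ω) hW ht hp] with r hr using hr.bound)).2
    1 (one_le_floor hσ) (fun _ => j) θ).1
  have h2 : dTheta (charInt ω f) θ t p (basisVec j) =
      partialD 1 (fun _ => j) (fun θ => charInt ω f θ t p) θ := by
    rw [partialD_one]; rfl
  rw [h2]
  unfold charInt
  rw [partialD_neg]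
  simp only
  rw [h1]
  congr 1
  refine integral_congr_ae (Eventually.of_forall fun r => ?_)
  simp only
  rw [partialD_comp_add_right (f := fun θ => f θ (t + r) p), partialD_one]
  rfl

end

section TimeDerivative

variable {σ L N K : ℝ} {ω : E n → E n} {f : E n → ℝ → E n → F}

lemma continuousOn_backward (hf : MemB σ f) (θ e : E n) {p : E n} (hp : p ∈ B n) :
    ContinuousOn (fun y : ℝ × ℝ => f (θ + (y.2 - y.1) • e) y.2 p) (univ ×ˢ Ici 0) :=
  hf.cont.comp (f := fun y : ℝ × ℝ => (θ + (y.2 - y.1) • e, y.2, p)) (by fun_prop)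
    fun _ hy => mem_dom hy.2 hp

lemma continuousOn_backward_right (hf : MemB σ f) (θ e : E n) {p : E n} (hp : p ∈ B n) (s : ℝ) :
    ContinuousOn (fun τ : ℝ => f (θ + (τ - s) • e) τ p) (Ici 0) :=
  (continuousOn_backward hf θ e hp).comp (f := fun τ : ℝ => (s, τ)) (by fun_prop)
    fun _ hτ => ⟨mem_univ _, hτ⟩

lemma integrableOn_backward (hL : 2 < L) (hf : MemB σ f) (hW : WBd σ L N f) (θ e : E n) {p : E n}
    (hp : p ∈ B n) (s : ℝ) {a : ℝ} (ha : 0 ≤ a) :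
    IntegrableOn (fun τ : ℝ => f (θ + (τ - s) • e) τ p) (Ioi a) := by
  refine IntegrableOn.mono_set ?_ (Ioi_subset_Ioi ha)
  refine ((integrableOn_weight (a := L) (t := 0) (by linarith) le_rfl).const_mul N).mono' ?_ ?_
  · exact ((continuousOn_backward_right hf θ e hp s).mono
      Ioi_subset_Ici_self).aestronglyMeasurable measurableSet_Ioi
  · filter_upwards [ae_restrict_mem measurableSet_Ioi] with τ hτ
    rw [zero_add]
    exact hW.norm_le _ (Ioi_subset_Ici_self hτ) hp

lemma charInt_eq_add (hL : 2 < L) (hf : MemB σ f) (hW : WBd σ L N f) (θ : E n) {p : E n}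
    (hp : p ∈ B n) {s t : ℝ} (hs : s ∈ Ici (0 : ℝ)) (ht : t ∈ Ici (0 : ℝ)) :
    charInt ω f θ s p = charInt ω f (θ + (t - s) • ω p) t p +
      ∫ τ in t..s, f (θ + (τ - s) • ω p) τ p := by
  have h1 := setIntegral_Ioi_comp_add (fun τ => f (θ + (τ - s) • ω p) τ p) s
  have h2 := setIntegral_Ioi_comp_add (fun τ => f (θ + (τ - s) • ω p) τ p) t
  have h3 := intervalIntegral.integral_Ioi_sub_Ioi' (integrableOn_backward hL hf hW θ (ω p) hp s ht)
    (integrableOn_backward hL hf hW θ (ω p) hp s hs)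
  rw [← h3, ← h1, ← h2]
  unfold charInt
  have e1 : ∀ r : ℝ, θ + (s + r - s) • ω p = θ + r • ω p := fun r => by congr 2; ring
  have e2 : ∀ r : ℝ, θ + (t + r - s) • ω p = θ + (t - s) • ω p + r • ω p := fun r => by module
  simp only [e1, e2]
  abel

lemma hasDerivWithinAt_integral_backward [CompleteSpace F] (hf : MemB σ f) (θ e : E n) {p : E n}
    (hp : p ∈ B n) {t : ℝ} (ht : t ∈ Ici (0 : ℝ)) :
    HasDerivWithinAt (fun s => ∫ τ in t..s, f (θ + (τ - s) • e) τ p) (f θ t p) (Ici 0) t := by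
  rw [hasDerivWithinAt_iff_isLittleO, Asymptotics.isLittleO_iff]
  intro ε hε
  have hc := continuousOn_backward hf θ e hp (t, t) ⟨mem_univ _, ht⟩
  obtain ⟨δ, hδ, hδ'⟩ := Metric.continuousWithinAt_iff.1 hc ε hε
  filter_upwards [self_mem_nhdsWithin, mem_nhdsWithin_of_mem_nhds (Metric.ball_mem_nhds t hδ)]
    with s hs hsδ
  rw [intervalIntegral.integral_same, sub_zero]
  have hsub : uIcc t s ⊆ Ici (0 : ℝ) := fun τ hτ => (le_min (mem_Ici.1 ht) (mem_Ici.1 hs)).trans hτ.1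
  have hint : IntervalIntegrable (fun τ : ℝ => f (θ + (τ - s) • e) τ p) volume t s :=
    ((continuousOn_backward_right hf θ e hp s).mono hsub).intervalIntegrable
  rw [← intervalIntegral.integral_const, ← intervalIntegral.integral_sub hint
    intervalIntegrable_const]
  refine intervalIntegral.norm_integral_le_of_norm_le_const fun τ hτ => ?_
  have hτ' : τ ∈ uIcc t s := uIoc_subset_uIcc hτ
  have h1 : |τ - t| ≤ |s - t| := abs_sub_left_of_mem_uIcc hτ'
  have h2 : |s - t| < δ := by simpa [Real.dist_eq] using hsδ
  have := hδ' (x := (s, τ)) ⟨mem_univ _, hsub hτ'⟩ (by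
    rw [Prod.dist_eq]
    exact max_lt (by simpa [Real.dist_eq] using h2) (by
      rw [Real.dist_eq]; exact h1.trans_lt h2))
  simp only [dist_eq_norm, sub_self, zero_smul, add_zero] at this
  exact this.le

lemma hasDerivWithinAt_charInt [CompleteSpace F] (hσ : 1 ≤ σ) (hL : 2 < L)
    (hω : ContDiffOn ℝ 1 ω (B n)) (hf : MemB σ f) (hW : WBd σ L N f) (θ : E n) {t : ℝ}
    (ht : t ∈ Ici (0 : ℝ)) {p : E n} (hp : p ∈ B n) :
    HasDerivWithinAt (fun s => charInt ω f θ s p)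
      (-dTheta (charInt ω f) θ t p (ω p) + f θ t p) (Ici 0) t := by
  have hd : DifferentiableAt ℝ (fun θ => charInt ω f θ t p) θ :=
    (contDiff_charInt hL hω hf hW ht hp).differentiable
      (by have := one_le_floor hσ; norm_cast; omega) θ
  have h1 : HasDerivAt (fun s : ℝ => θ + (t - s) • ω p) (-ω p) t := by
    simpa using (((hasDerivAt_id t).const_sub t).smul_const (ω p)).const_add θ
  have h2 : HasDerivAt (fun s : ℝ => charInt ω f (θ + (t - s) • ω p) t p)
      (-dTheta (charInt ω f) θ t p (ω p)) t := by
    have h3 : HasFDerivAt (fun θ => charInt ω f θ t p) (dTheta (charInt ω f) θ t p)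
        (θ + (t - t) • ω p) := by
      rw [sub_self, zero_smul, add_zero]
      exact hd.hasFDerivAt
    have h4 := h3.comp_hasDerivAt t h1
    rw [map_neg] at h4
    exact h4
  refine (h2.hasDerivWithinAt.add
    (hasDerivWithinAt_integral_backward hf θ (ω p) hp ht)).congr (fun s hs => ?_) ?_
  · exact charInt_eq_add hL hf hW θ hp hs ht
  · exact charInt_eq_add hL hf hW θ hp ht ht

lemma dOmega_charInt [CompleteSpace F] (hσ : 1 ≤ σ) (hL : 2 < L)
    (hω : ContDiffOn ℝ 1 ω (B n)) (hf : MemB σ f) (hW : WBd σ L N f) (θ : E n) {t : ℝ}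
    (ht : t ∈ Ici (0 : ℝ)) {p : E n} (hp : p ∈ B n) :
    dOmega ω (charInt ω f) θ t p = f θ t p := by
  unfold dOmega dT
  rw [(hasDerivWithinAt_charInt hσ hL hω hf hW θ ht hp).derivWithin
    (uniqueDiffOn_Ici 0 t ht)]
  abel

end TimeDerivative

section ContTheta

variable {σ M : ℝ} {f : E n → ℝ → E n → F}

lemma exists_holder_pderiv (hσ : 1 < σ) : ∃ ν : ℝ, 0 < ν ∧ ∀ g : E n → F, ContDiff ℝ ⌊σ⌋₊ g →
    HolderBd σ M g → ∀ (j : Fin n) (x : E n) (s : ℝ),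
      ‖pderiv j g (x + s • basisVec j) - pderiv j g x‖ ≤ M * |s| ^ ν := by
  have h1 := one_le_floor hσ.le
  rcases h1.eq_or_lt with h | h
  · refine ⟨σ - 1, by linarith, fun g _ hM j x s => ?_⟩
    have hh := hM.holder
    rw [← h] at hh
    have := hh (by simpa using hσ.ne) (fun _ => j) (x + s • basisVec j) x
    simpa [partialD_one, norm_smul] using this
  · refine ⟨1, one_pos, fun g hg hM j x s => ?_⟩
    have hg1 : ContDiff ℝ (0 + 1 + 1 : ℕ) g := hg.of_le (by norm_cast)
    rw [Real.rpow_one]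
    refine norm_line_sub_le ((contDiff_pderiv j hg1).differentiable (by norm_num)) j ?_ x s
    intro y
    have := hM.bound 2 h (Fin.cons j fun _ => j : Fin 2 → Fin n) y
    rwa [← pderiv_partialD (i := 1) _ _ hg1, partialD_one] at this

lemma norm_slope_sub_pderiv_le {g : E n → F} (hg : Differentiable ℝ g) {ν : ℝ} (hν : 0 < ν)
    (j : Fin n) (x : E n)
    (hM : ∀ s : ℝ, ‖pderiv j g (x + s • basisVec j) - pderiv j g x‖ ≤ M * |s| ^ ν) {h : ℝ}
    (hh : 0 < h) :
    ‖h⁻¹ • (g (x + h • basisVec j) - g x) - pderiv j g x‖ ≤ M * h ^ ν := by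
  have hM0 : 0 ≤ M := by simpa using (norm_nonneg _).trans (hM 1)
  have h1 := Convex.norm_image_sub_le_of_norm_hasDerivWithin_le (s := Icc 0 h)
    (f := fun s : ℝ => g (x + s • basisVec j) - s • pderiv j g x) (C := M * h ^ ν)
    (f' := fun s => pderiv j g (x + s • basisVec j) - pderiv j g x)
    (x := 0) (y := h)
    (fun s _ => (by
      have h1 := hasDerivAt_line (x := x) (e := basisVec j) (r := s) (hg _)
      have h2 := (hasDerivAt_id s).smul_const (pderiv j g x)
      have h3 := h1.sub h2
      simp only [one_smul] at h3
      exact h3.hasDerivWithinAt))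
    (fun s hs => (hM s).trans (by
      rw [abs_of_nonneg hs.1]
      exact mul_le_mul_of_nonneg_left (Real.rpow_le_rpow hs.1 hs.2 hν.le) hM0))
    (convex_Icc _ _) (left_mem_Icc.2 hh.le) (right_mem_Icc.2 hh.le)
  simp only [zero_smul, add_zero, sub_zero, Real.norm_of_nonneg hh.le] at h1
  have e : h⁻¹ • (g (x + h • basisVec j) - g x) - pderiv j g x =
      h⁻¹ • (g (x + h • basisVec j) - h • pderiv j g x - g x) := by
    rw [smul_sub, smul_sub, smul_sub, inv_smul_smul₀ hh.ne']
    abel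
  rw [e, norm_smul, norm_inv, Real.norm_of_nonneg hh.le, inv_mul_le_iff₀ hh]
  linarith

/-- For `σ > 1`, a uniform bound in `C^σ` and continuity imply the continuity of `∂_θ f`. -/
lemma contTheta_of_one_lt (hσ : 1 < σ) (hf : MemB σ f)
    (hM : ∀ t ∈ Ici (0 : ℝ), ∀ p ∈ B n, HolderBd σ M fun θ => f θ t p) : ContTheta f := by
  obtain ⟨ν, hν, hh⟩ := exists_holder_pderiv (n := n) (F := F) (M := M) hσ
  have hj : ∀ j : Fin n, ContinuousOn
      (fun x : E n × ℝ × E n => dTheta f x.1 x.2.1 x.2.2 (basisVec j)) (dom n) := by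
    intro j
    have hu : TendstoUniformlyOn
        (fun (m : ℕ) (x : E n × ℝ × E n) => (1 / ((m : ℝ) + 1))⁻¹ •
          (f (x.1 + (1 / ((m : ℝ) + 1)) • basisVec j) x.2.1 x.2.2 - f x.1 x.2.1 x.2.2))
        (fun x => dTheta f x.1 x.2.1 x.2.2 (basisVec j)) atTop (dom n) := by
      rw [Metric.tendstoUniformlyOn_iff]
      intro ε hε
      have h0 : Tendsto (fun m : ℕ => M * (1 / ((m : ℝ) + 1)) ^ ν) atTop (𝓝 0) := by
        have := ((tendsto_one_div_add_atTop_nhds_zero_nat (𝕜 := ℝ)).rpow_const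
          (Or.inr hν.le)).const_mul M
        simpa [Real.zero_rpow hν.ne'] using this
      filter_upwards [h0.eventually (gt_mem_nhds hε)] with m hm x hx
      rw [dist_comm, dist_eq_norm]
      refine (norm_slope_sub_pderiv_le (hf.differentiable hσ.le hx.2.1 hx.2.2) hν j x.1
        (hh _ (hf.holder _ hx.2.1 _ hx.2.2).1 (hM _ hx.2.1 _ hx.2.2) j x.1)
        (by positivity : (0 : ℝ) < 1 / ((m : ℝ) + 1))).trans_lt hm
    refine hu.continuousOn (Frequently.of_forall fun m => ?_)
    have h2 : ContinuousOn (fun x : E n × ℝ × E n =>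
        f (x.1 + (1 / ((m : ℝ) + 1)) • basisVec j) x.2.1 x.2.2) (dom n) :=
      hf.cont.comp (f := fun x : E n × ℝ × E n =>
        (x.1 + (1 / ((m : ℝ) + 1)) • basisVec j, x.2.1, x.2.2)) (by fun_prop)
        fun x hx => mem_dom hx.2.1 hx.2.2
    exact (h2.sub hf.cont).const_smul _
  unfold ContTheta
  rw [continuousOn_clm_apply]
  intro y
  simp_rw [clm_apply_eq_sum _ y]
  exact continuousOn_finsetSum _ fun j _ => (hj j).const_smul (y j)

end ContTheta

section Uniqueness

/-- The unit cube, a fundamental domain of the torus. -/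
def cube (n : ℕ) : Set (E n) := {x | ∀ i, x i ∈ Icc (0 : ℝ) 1}

lemma isCompact_cube : IsCompact (cube n) := by
  have h : cube n = (EuclideanSpace.equiv (Fin n) ℝ).symm '' (univ.pi fun _ => Icc (0 : ℝ) 1) := by
    ext x
    constructor
    · intro hx
      exact ⟨EuclideanSpace.equiv (Fin n) ℝ x, fun i _ => hx i, by simp⟩
    · rintro ⟨y, hy, rfl⟩ i
      exact hy i (mem_univ _)
  rw [h]
  exact (isCompact_univ_pi fun _ => isCompact_Icc).image (ContinuousLinearEquiv.continuous _)

lemma exists_mem_cube (x : E n) : ∃ k : Fin n → ℤ, x + latt k ∈ cube n := by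
  refine ⟨fun i => -⌊x i⌋, fun i => ?_⟩
  have : (x + latt fun i => -⌊x i⌋) i = Int.fract (x i) := by
    simp [latt, Int.fract, sub_eq_add_neg]
  rw [this]
  exact ⟨Int.fract_nonneg _, (Int.fract_lt_one _).le⟩

/-- The maximum principle for the transport equation on the torus. -/
lemma transport_max_principle {e : E n} {W : E n → ℝ → ℝ} {A : E n → ℝ → E n →L[ℝ] ℝ}
    {b : E n → ℝ → ℝ} (hper : ∀ t ∈ Ici (0 : ℝ), Periodic fun θ => W θ t)
    (hc : ContinuousOn (fun y : E n × ℝ => W y.1 y.2) (univ ×ˢ Ici 0))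
    (hA : ∀ θ, ∀ t ∈ Ici (0 : ℝ), HasFDerivAt (fun θ => W θ t) (A θ t) θ)
    (hb : ∀ θ, ∀ t ∈ Ici (0 : ℝ), HasDerivWithinAt (fun s => W θ s) (b θ t) (Ici 0) t)
    (heq : ∀ θ, ∀ t ∈ Ici (0 : ℝ), A θ t e + b θ t = 0) {T c : ℝ} (hcT : ∀ θ, W θ T ≤ c)
    {t : ℝ} (ht : t ∈ Icc 0 T) (θ : E n) : W θ t ≤ c := by
  have key : ∀ ε > 0, W θ t + ε * t ≤ c + ε * T := by
    intro ε hε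
    have hcomp : IsCompact (cube n ×ˢ Icc 0 T) := isCompact_cube.prod isCompact_Icc
    obtain ⟨⟨θ₀, t₀⟩, ⟨_, ht₀⟩, hmax⟩ := hcomp.exists_isMaxOn
      (f := fun y : E n × ℝ => W y.1 y.2 + ε * y.2)
      ⟨(0, t), fun i => by simp, ht⟩
      (((hc.mono fun y hy => ⟨mem_univ _, hy.2.1⟩)).add (by fun_prop))
    have hmax' : ∀ x, ∀ s ∈ Icc 0 T, W x s + ε * s ≤ W θ₀ t₀ + ε * t₀ := by
      intro x s hs
      obtain ⟨k, hk⟩ := exists_mem_cube x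
      have := hmax (show (x + latt k, s) ∈ cube n ×ˢ Icc 0 T from ⟨hk, hs⟩)
      simp only [mem_ofPred_eq] at this
      rwa [show W (x + latt k) s = W x s from hper s hs.1 x k] at this
    have ht₀T : t₀ = T := by
      by_contra hne
      have hlt : t₀ < T := lt_of_le_of_ne ht₀.2 hne
      have hA0 : A θ₀ t₀ = 0 := by
        have hloc : IsLocalMax (fun θ => W θ t₀) θ₀ :=
          Eventually.of_forall fun x => by linarith [hmax' x t₀ ht₀]
        exact hloc.hasFDerivAt_eq_zero (hA θ₀ t₀ ht₀.1)
      have hb0 : b θ₀ t₀ = 0 := by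
        have := heq θ₀ t₀ ht₀.1
        rw [hA0] at this
        simpa using this
      have hd : HasDerivWithinAt (fun s => W θ₀ s + ε * s) ε (Ioi t₀) t₀ := by
        have h1 := (hb θ₀ t₀ ht₀.1).add ((hasDerivWithinAt_id t₀ (Ici 0)).const_mul ε)
        rw [hb0] at h1
        simp only [zero_add, mul_one] at h1
        exact h1.mono fun s hs => ht₀.1.trans (le_of_lt hs)
      rw [hasDerivWithinAt_iff_tendsto_slope' (by simp)] at hd
      have : ε ≤ 0 := by
        refine le_of_tendsto hd ?_
        filter_upwards [self_mem_nhdsWithin,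
          mem_nhdsWithin_of_mem_nhds (Iio_mem_nhds hlt)] with s hs hs'
        have hs0 : t₀ < s := hs
        rw [slope_def_field]
        exact div_nonpos_of_nonpos_of_nonneg
          (by linarith [hmax' θ₀ s ⟨ht₀.1.trans hs0.le, le_of_lt hs'⟩]) (by linarith)
      linarith
    refine (hmax' θ t ht).trans ?_
    rw [ht₀T]
    linarith [hcT θ₀]
  refine le_of_forall_pos_le_add fun δ hδ => ?_
  have hpos : 0 < T - t + 1 := by linarith [ht.2]
  have h1 := key (δ / (T - t + 1)) (by positivity)
  have h2 : δ / (T - t + 1) * (T - t) ≤ δ := by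
    rw [div_mul_eq_mul_div, div_le_iff₀ hpos]
    nlinarith
  linarith

lemma eventually_norm_le {f : E n → ℝ → E n}
    (hf : Tendsto (fun t : ℝ => c0Norm fun θ => f θ t) atTop (𝓝 0)) {δ : ℝ} (hδ : 0 < δ) :
    ∀ᶠ t in atTop, ∀ θ, ‖f θ t‖ ≤ δ := by
  filter_upwards [hf.eventually (gt_mem_nhds (ENNReal.ofReal_pos.2 hδ))] with t ht θ
  have h1 : ‖f θ t‖ₑ ≤ ENNReal.ofReal δ :=
    (le_iSup (fun x => ‖f x t‖ₑ) θ).trans (le_of_lt ht)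
  rw [← ofReal_norm, ENNReal.ofReal_le_ofReal_iff hδ.le] at h1
  exact h1

lemma Admissible.eq_of_dOmega_eq {σ l : ℝ} {ω : E n → E n} {f g : E n → ℝ → E n → E n}
    (hσ : 1 ≤ σ) (hf : Admissible σ l ω f) (hg : Admissible σ l ω g)
    (h : ∀ (θ : E n), ∀ t ∈ Ici (0 : ℝ), ∀ p ∈ B n, dOmega ω f θ t p = dOmega ω g θ t p)
    (θ : E n) {t : ℝ} (ht : t ∈ Ici (0 : ℝ)) {p : E n} (hp : p ∈ B n) : f θ t p = g θ t p := by
  set ζ := f θ t p - g θ t p with hζ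
  have hpair : ContinuousOn (fun y : E n × ℝ => f y.1 y.2 p - g y.1 y.2 p) (univ ×ˢ Ici 0) :=
    ((hf.mem.cont.sub hg.mem.cont).comp (f := fun y : E n × ℝ => (y.1, y.2, p)) (by fun_prop)
      fun y hy => mem_dom hy.2 hp)
  have hA : ∀ θ, ∀ t ∈ Ici (0 : ℝ), HasFDerivAt (fun θ => innerSL ℝ ζ (f θ t p - g θ t p))
      ((innerSL ℝ ζ).comp (dTheta f θ t p - dTheta g θ t p)) θ := fun θ t ht =>
    (innerSL ℝ ζ).hasFDerivAt.comp θ ((hf.mem.differentiable hσ ht hp θ).hasFDerivAt.sub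
      (hg.mem.differentiable hσ ht hp θ).hasFDerivAt)
  have hb : ∀ θ, ∀ t ∈ Ici (0 : ℝ), HasDerivWithinAt (fun s => innerSL ℝ ζ (f θ s p - g θ s p))
      (innerSL ℝ ζ (dT f θ t p - dT g θ t p)) (Ici 0) t := fun θ t ht =>
    (innerSL ℝ ζ).hasFDerivAt.comp_hasDerivWithinAt t
      ((hf.diffT θ t ht p hp).hasDerivWithinAt.sub (hg.diffT θ t ht p hp).hasDerivWithinAt)
  have key : ∀ δ > 0, innerSL ℝ ζ (f θ t p - g θ t p) ≤ ‖ζ‖ * (δ + δ) := by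
    intro δ hδ
    obtain ⟨T, hT1, hT2, hT3⟩ := ((eventually_norm_le (hf.decay p hp) hδ).and
      ((eventually_norm_le (hg.decay p hp) hδ).and (eventually_ge_atTop t))).exists
    refine transport_max_principle (e := ω p) (W := fun θ t => innerSL ℝ ζ (f θ t p - g θ t p))
      ?_ ((innerSL ℝ ζ).continuous.comp_continuousOn hpair) hA hb ?_ (T := T) ?_ ⟨ht, hT3⟩ θ
    · intro s hs x k
      simp only
      rw [hf.mem.periodic x s hs p hp k, hg.mem.periodic x s hs p hp k]
    · intro x s hs
      have := h x s hs p hp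
      unfold dOmega at this
      rw [ContinuousLinearMap.comp_apply, ← map_add]
      have e : (dTheta f x s p - dTheta g x s p) (ω p) + (dT f x s p - dT g x s p) = 0 := by
        rw [FunLike.coe_sub, Pi.sub_apply]
        rw [← sub_eq_zero] at this
        rw [← this]
        abel
      rw [e, map_zero]
    · intro x
      rw [innerSL_apply_apply]
      refine (real_inner_le_norm _ _).trans ?_
      gcongr
      exact norm_sub_le_of_le (hT1 x) (hT2 x)
  rw [innerSL_apply_apply, ← hζ, real_inner_self_eq_norm_sq] at key
  have h0 : ‖ζ‖ = 0 := by
    by_contra hne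
    have hpos : 0 < ‖ζ‖ := lt_of_le_of_ne (norm_nonneg _) (Ne.symm hne)
    have := key (‖ζ‖ / 4) (by positivity)
    nlinarith
  exact sub_eq_zero.1 (norm_eq_zero.1 h0)

end Uniqueness

section Norms

variable {σ l M N : ℝ}

lemma enorm_le_ofReal_iff {X : Type*} [NormedAddCommGroup X] (hM : 0 ≤ M) {x : X} : ‖x‖ₑ ≤ ENNReal.ofReal M ↔ ‖x‖ ≤ M := by
  rw [← ofReal_norm, ENNReal.ofReal_le_ofReal_iff hM]

lemma HolderBd.nonneg {g : E n → F} (hg : HolderBd σ M g) : 0 ≤ M :=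
  (norm_nonneg _).trans (hg.bound 0 (Nat.zero_le _) Fin.elim0 0)

lemma HolderBd.holderNorm_le {g : E n → F} (hg : HolderBd σ M g) :
    holderNorm σ g ≤ ENNReal.ofReal (2 * M) := by
  have hM := hg.nonneg
  have h1 : ckNorm ⌊σ⌋₊ g ≤ ENNReal.ofReal M :=
    iSup_le fun i => iSup_le fun hi => iSup_le fun a => iSup_le fun x =>
      (enorm_le_ofReal_iff hM).2 (hg.bound i hi a x)
  have h2 : (if (⌊σ⌋₊ : ℝ) = σ then 0 else holderSeminorm ⌊σ⌋₊ (σ - ⌊σ⌋₊) g) ≤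
      ENNReal.ofReal M := by
    split_ifs with h
    · exact bot_le
    · refine iSup_le fun a => iSup_le fun x => iSup_le fun y => iSup_le fun hxy => ?_
      refine ENNReal.ofReal_le_ofReal ?_
      have : 0 < ‖x - y‖ := norm_pos_iff.2 (sub_ne_zero.2 hxy)
      rw [div_le_iff₀ (by positivity)]
      exact hg.holder h a x y
  unfold holderNorm
  rw [two_mul, ENNReal.ofReal_add hM hM]
  exact add_le_add h1 h2

lemma holderBd_of_holderNorm_le {g : E n → F} (hM : 0 ≤ M)
    (hg : holderNorm σ g ≤ ENNReal.ofReal M) : HolderBd σ M g := by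
  refine ⟨fun i hi a x => (enorm_le_ofReal_iff hM).1 ?_, fun hσ a x y => ?_⟩
  · refine le_trans ?_ (le_self_add.trans hg)
    refine (le_iSup (fun x => ‖partialD i a g x‖ₑ) x).trans ?_
    exact le_iSup_of_le i (le_iSup_of_le hi (le_iSup_of_le a le_rfl))
  · rcases eq_or_ne x y with rfl | hxy
    · simpa using mul_nonneg hM (Real.rpow_nonneg le_rfl _)
    · have h1 : holderSeminorm ⌊σ⌋₊ (σ - ⌊σ⌋₊) g ≤ ENNReal.ofReal M := by
        unfold holderNorm at hg
        rw [if_neg hσ] at hg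
        exact le_add_self.trans hg
      have h2 : ENNReal.ofReal (‖partialD ⌊σ⌋₊ a g x - partialD ⌊σ⌋₊ a g y‖ /
          ‖x - y‖ ^ (σ - ⌊σ⌋₊)) ≤ ENNReal.ofReal M := by
        refine le_trans ?_ h1
        exact le_iSup_of_le a (le_iSup_of_le x (le_iSup_of_le y (le_iSup_of_le hxy le_rfl)))
      rw [ENNReal.ofReal_le_ofReal_iff hM] at h2
      have : 0 < ‖x - y‖ := norm_pos_iff.2 (sub_ne_zero.2 hxy)
      rwa [div_le_iff₀ (by positivity)] at h2

lemma HolderBd.isHolder {g : E n → F} (hg : HolderBd σ M g) (hc : ContDiff ℝ ⌊σ⌋₊ g) :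
    IsHolder σ g := ⟨hc, hg.holderNorm_le.trans_lt ENNReal.ofReal_lt_top⟩

lemma one_add_rpow_le {a t : ℝ} (ha : 0 ≤ a) (ht : 0 ≤ t) : 1 + t ^ a ≤ 2 * (1 + t) ^ a := by
  have h1 : (1 : ℝ) ≤ (1 + t) ^ a := Real.one_le_rpow (by linarith) ha
  have h2 : t ^ a ≤ (1 + t) ^ a := Real.rpow_le_rpow ht (by linarith) ha
  linarith

lemma rpow_one_add_le {a t : ℝ} (ha : 0 ≤ a) (ht : 0 ≤ t) :
    (1 + t) ^ a ≤ 2 ^ a * (1 + t ^ a) := by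
  rcases le_total t 1 with h | h
  · have h1 : (1 + t) ^ a ≤ 2 ^ a := Real.rpow_le_rpow (by linarith) (by linarith) ha
    have h2 : (0 : ℝ) ≤ 2 ^ a * t ^ a := by positivity
    linarith
  · have h1 : (1 + t) ^ a ≤ (2 * t) ^ a := Real.rpow_le_rpow (by linarith) (by linarith) ha
    rw [Real.mul_rpow (by norm_num) ht] at h1
    have h2 : (0 : ℝ) ≤ 2 ^ a := by positivity
    linarith

lemma le_ofReal_div {x : ℝ≥0∞} {w : ℝ} (hw : 0 < w)
    (h : x * ENNReal.ofReal w ≤ ENNReal.ofReal N) : x ≤ ENNReal.ofReal (N / w) := by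
  rw [ENNReal.ofReal_div_of_pos hw, ENNReal.le_div_iff_mul_le]
  · exact h
  · exact Or.inl (by simpa using hw)
  · exact Or.inl ENNReal.ofReal_ne_top

lemma div_weight_le {a t : ℝ} (ha : 0 ≤ a) (ht : 0 ≤ t) (hN : 0 ≤ N) :
    N / (1 + t ^ a) ≤ 2 ^ a * N * (1 + t) ^ (-a) := by
  have h1 := rpow_one_add_le ha ht
  have h2 : (0 : ℝ) < (1 + t) ^ a := by positivity
  rw [Real.rpow_neg (by linarith), ← div_eq_mul_inv, div_le_div_iff₀ (by positivity) h2]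
  calc N * (1 + t) ^ a ≤ N * (2 ^ a * (1 + t ^ a)) := by gcongr
    _ = _ := by ring

lemma holderNorm_mul_le_wNorm (f : E n → ℝ → E n → F) {t : ℝ} (ht : t ∈ Ici (0 : ℝ)) {p : E n}
    (hp : p ∈ B n) :
    holderNorm σ (fun θ => f θ t p) * ENNReal.ofReal (weight l t) ≤ wNorm σ l f := by
  refine le_trans ?_ le_self_add
  exact le_iSup_of_le t (le_iSup_of_le ht (le_iSup_of_le p (le_iSup_of_le hp le_rfl)))

lemma enorm_dP_mul_le_wNorm (f : E n → ℝ → E n → F) (θ : E n) {t : ℝ} (ht : t ∈ Ici (0 : ℝ))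
    {p : E n} (hp : p ∈ B n) :
    ‖dP f θ t p‖ₑ * ENNReal.ofReal (weightP l t) ≤ wNorm σ l f := by
  refine le_trans ?_ le_add_self
  refine le_iSup_of_le t (le_iSup_of_le ht (le_iSup_of_le p (le_iSup_of_le hp ?_)))
  gcongr
  exact le_iSup (fun θ => ‖dP f θ t p‖ₑ) θ

lemma wBd_of_wNorm_le {f : E n → ℝ → E n → F} (hl : 1 ≤ l) (hN : 0 ≤ N)
    (h : wNorm σ l f ≤ ENNReal.ofReal N) : WBd σ l (2 ^ l * N) f := by
  have hl0 : l ≠ 0 := by linarith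
  refine ⟨fun t ht p hp => ?_, fun θ t ht p hp => ?_⟩
  · have ht' : (0 : ℝ) ≤ t := ht
    have h1 := (holderNorm_mul_le_wNorm f ht hp).trans h
    rw [weight, if_neg hl0] at h1
    exact (holderBd_of_holderNorm_le (by positivity) (le_ofReal_div (by positivity) h1)).mono
      (div_weight_le (by linarith) ht' hN)
  · have ht' : (0 : ℝ) ≤ t := ht
    have h1 := (enorm_dP_mul_le_wNorm f θ ht hp).trans h
    rw [weightP, if_neg hl0] at h1
    have h2 := (enorm_le_ofReal_iff (by positivity)).1 (le_ofReal_div (by positivity) h1)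
    refine h2.trans ((div_weight_le (by linarith) ht' hN).trans ?_)
    rw [neg_sub]
    gcongr
    · norm_num
    · linarith

lemma WBd.wNorm_le {f : E n → ℝ → E n → F} (hl : 1 ≤ l) (h : WBd σ l N f) :
    wNorm σ l f ≤ ENNReal.ofReal (6 * N) := by
  have hl0 : l ≠ 0 := by linarith
  have hN := h.nonneg
  have key : ∀ {a t : ℝ}, 0 ≤ a → 0 ≤ t → (1 + t) ^ (-a) * (1 + t ^ a) ≤ 2 := by
    intro a t ha ht
    have h2 : (0 : ℝ) < (1 + t) ^ a := by positivity
    rw [Real.rpow_neg (by linarith), inv_mul_le_iff₀ h2, mul_comm]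
    exact one_add_rpow_le ha ht
  rw [show 6 * N = 4 * N + 2 * N by ring, ENNReal.ofReal_add (by positivity) (by positivity)]
  refine add_le_add ?_ ?_
  · refine iSup_le fun t => iSup_le fun ht => iSup_le fun p => iSup_le fun hp => ?_
    have ht' : (0 : ℝ) ≤ t := ht
    refine (mul_le_mul_left (h.holder t ht p hp).holderNorm_le _).trans ?_
    rw [← ENNReal.ofReal_mul (by positivity), weight, if_neg hl0]
    refine ENNReal.ofReal_le_ofReal ?_
    calc 2 * (N * (1 + t) ^ (-l)) * (1 + t ^ l)
        = 2 * N * ((1 + t) ^ (-l) * (1 + t ^ l)) := by ring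
      _ ≤ 2 * N * 2 := by gcongr; exact key (by linarith) ht'
      _ = _ := by ring
  · refine iSup_le fun t => iSup_le fun ht => iSup_le fun p => iSup_le fun hp => ?_
    have ht' : (0 : ℝ) ≤ t := ht
    have hc : c0Norm (fun θ => LinOp.dP f θ t p) ≤ ENNReal.ofReal (N * (1 + t) ^ (1 - l)) :=
      iSup_le fun θ => (enorm_le_ofReal_iff (by positivity)).2 (h.dP θ t ht p hp)
    refine (mul_le_mul_left hc _).trans ?_
    rw [← ENNReal.ofReal_mul (by positivity), weightP, if_neg hl0]
    refine ENNReal.ofReal_le_ofReal ?_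
    have h3 := key (a := l - 1) (by linarith) ht'
    rw [neg_sub] at h3
    calc N * (1 + t) ^ (1 - l) * (1 + t ^ (l - 1))
        = N * ((1 + t) ^ (1 - l) * (1 + t ^ (l - 1))) := by ring
      _ ≤ N * 2 := by gcongr
      _ = _ := by ring

lemma wNorm_zero_bounds {f : E n → ℝ → E n → F} (hM : 0 ≤ M)
    (h : wNorm σ 0 f ≤ ENNReal.ofReal M) {t : ℝ} (ht : t ∈ Ici (0 : ℝ)) {p : E n} (hp : p ∈ B n) :
    (HolderBd σ M fun θ => f θ t p) ∧ ∀ θ, ‖dP f θ t p‖ ≤ M := by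
  constructor
  · have h1 := (holderNorm_mul_le_wNorm f ht hp).trans h
    rw [weight, if_pos rfl, ENNReal.ofReal_one, mul_one] at h1
    exact holderBd_of_holderNorm_le hM h1
  · intro θ
    have h1 := (enorm_dP_mul_le_wNorm f θ ht hp).trans h
    rw [weightP, if_pos rfl, ENNReal.ofReal_one, mul_one] at h1
    exact (enorm_le_ofReal_iff hM).1 h1

lemma WBd.holderBd {f : E n → ℝ → E n → F} (hl : 0 ≤ l) (h : WBd σ l N f) {t : ℝ}
    (ht : t ∈ Ici (0 : ℝ)) {p : E n} (hp : p ∈ B n) : HolderBd σ N fun θ => f θ t p := by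
  refine (h.holder t ht p hp).mono ?_
  have ht' : (0 : ℝ) ≤ t := ht
  exact mul_le_of_le_one_right h.nonneg
    (Real.rpow_le_one_of_one_le_of_nonpos (by linarith) (by linarith))

lemma WBd.tendsto_c0Norm {f : E n → ℝ → E n → F} (hl : 0 < l) (h : WBd σ l N f) {p : E n}
    (hp : p ∈ B n) : Tendsto (fun t : ℝ => c0Norm fun θ => f θ t p) atTop (𝓝 0) := by
  have h1 : Tendsto (fun t : ℝ => ENNReal.ofReal (N * (1 + t) ^ (-l))) atTop (𝓝 0) := by
    have := ((tendsto_rpow_neg_atTop hl).comp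
      (tendsto_atTop_add_const_left atTop (1 : ℝ) tendsto_id)).const_mul N
    simpa using ENNReal.tendsto_ofReal this
  refine tendsto_of_tendsto_of_tendsto_of_le_of_le' tendsto_const_nhds h1
    (Eventually.of_forall fun _ => bot_le) ?_
  filter_upwards [eventually_ge_atTop 0] with t ht
  have hN := h.nonneg
  exact iSup_le fun θ => (enorm_le_ofReal_iff (by positivity)).2 (h.norm_le θ ht hp)

end Norms

section Congr

variable {σ l : ℝ} {f g : E n → ℝ → E n → F}

lemma dP_congr (h : ∀ (θ : E n), ∀ t ∈ Ici (0 : ℝ), ∀ p ∈ B n, f θ t p = g θ t p) (θ : E n)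
    {t : ℝ} (ht : t ∈ Ici (0 : ℝ)) {p : E n} (hp : p ∈ B n) : dP f θ t p = dP g θ t p := by
  refine Filter.EventuallyEq.fderiv_eq ?_
  filter_upwards [isOpen_ball.mem_nhds hp] with p' hp' using h θ t ht p' hp'

lemma MemB.congr (hf : MemB σ f)
    (h : ∀ (θ : E n), ∀ t ∈ Ici (0 : ℝ), ∀ p ∈ B n, f θ t p = g θ t p) : MemB σ g where
  periodic θ t ht p hp k := by rw [← h _ t ht p hp, ← h _ t ht p hp]; exact hf.periodic θ t ht p hp k
  cont := hf.cont.congr fun x hx => (h _ _ hx.2.1 _ hx.2.2).symm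
  diffP θ t ht p hp := by
    refine (hf.diffP θ t ht p hp).congr_of_eventuallyEq ?_
    filter_upwards [isOpen_ball.mem_nhds hp] with p' hp' using (h θ t ht p' hp').symm
  contP := hf.contP.congr fun x hx => (dP_congr h _ hx.2.1 hx.2.2).symm
  holder t ht p hp := by
    have : (fun θ => g θ t p) = fun θ => f θ t p := funext fun θ => (h θ t ht p hp).symm
    rw [this]
    exact hf.holder t ht p hp

lemma wNorm_congr (h : ∀ (θ : E n), ∀ t ∈ Ici (0 : ℝ), ∀ p ∈ B n, f θ t p = g θ t p) :
    wNorm σ l f = wNorm σ l g := by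
  unfold wNorm
  congr 1
  · refine iSup_congr fun t => iSup_congr fun ht => iSup_congr fun p => iSup_congr fun hp => ?_
    rw [show (fun θ => f θ t p) = fun θ => g θ t p from funext fun θ => h θ t ht p hp]
  · refine iSup_congr fun t => iSup_congr fun ht => iSup_congr fun p => iSup_congr fun hp => ?_
    rw [show (fun θ => dP f θ t p) = fun θ => dP g θ t p from
      funext fun θ => dP_congr h θ ht hp]

end Congr

section CharInt

variable {σ L N K : ℝ} {ω : E n → E n} {f : E n → ℝ → E n → F}

lemma memB_charInt (hσ : 1 ≤ σ) (hL : 2 < L) (hω : ContDiffOn ℝ 1 ω (B n))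
    (hK : ∀ p ∈ B n, ‖fderiv ℝ ω p‖ ≤ K) (hf : MemB σ f) (hT : ContTheta f) (hW : WBd σ L N f) :
    MemB σ (charInt ω f) where
  periodic θ t ht p hp k := by
    unfold charInt
    congr 1
    refine MeasureTheory.setIntegral_congr_fun measurableSet_Ioi fun r hr => ?_
    rw [add_right_comm]
    exact hf.periodic _ _ (add_nonneg (mem_Ici.1 ht) (le_of_lt hr)) p hp k
  cont := continuousOn_charInt hL hω hf hW
  diffP θ _ ht _ hp := (hasFDerivAt_charInt_p hσ hL hω hK hf hT hW θ ht hp).differentiableAt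
  contP := contP_charInt hσ hL hω hK hf hT hW
  holder _ ht _ hp := (holderBd_charInt hL hω hf hW ht hp).isHolder (contDiff_charInt hL hω hf hW ht hp)

lemma admissible_charInt [CompleteSpace F] (hσ : 1 ≤ σ) (hL : 2 < L)
    (hω : ContDiffOn ℝ 1 ω (B n)) (hK : ∀ p ∈ B n, ‖fderiv ℝ ω p‖ ≤ K) (hf : MemB σ f)
    (hT : ContTheta f) (hW : WBd σ L N f) : Admissible σ (L - 1) ω (charInt ω f) where
  mem := memB_charInt hσ hL hω hK hf hT hW
  diffT θ _ ht _ hp :=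
    (hasDerivWithinAt_charInt hσ hL hω hf hW θ ht hp).differentiableWithinAt
  memOmega := hf.congr fun θ _ ht _ hp => (dOmega_charInt hσ hL hω hf hW θ ht hp).symm
  finite := ((wBd_charInt hσ hL hω hK hf hT hW).wNorm_le (by linarith)).trans_lt
    ENNReal.ofReal_lt_top
  decay _ hp := (wBd_charInt hσ hL hω hK hf hT hW).tendsto_c0Norm (by linarith) hp

end CharInt

section Product

variable {σ L M V N : ℝ} {m : E n → ℝ → E n → (F →L[ℝ] G)} {v : E n → ℝ → E n → F}
  {z : E n → ℝ → E n → G}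

lemma HolderBd.sub {f g : E n → F} (hf : HolderBd σ M f) (hg : HolderBd σ N g)
    (hfc : ContDiff ℝ ⌊σ⌋₊ f) (hgc : ContDiff ℝ ⌊σ⌋₊ g) :
    HolderBd σ (M + N) fun x => f x - g x := by
  have e : ∀ i ≤ ⌊σ⌋₊, ∀ a : Fin i → Fin n, partialD i a (fun x => f x - g x) =
      fun x => partialD i a f x - partialD i a g x := by
    intro i hi a
    have := partialD_add a (hfc.of_le (by exact_mod_cast hi))
      ((hgc.of_le (by exact_mod_cast hi)).neg)
    simp only [partialD_neg, ← sub_eq_add_neg] at this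
    exact this
  refine ⟨fun i hi a x => ?_, fun hσ a x y => ?_⟩
  · rw [e i hi a]
    exact norm_sub_le_of_le (hf.bound i hi a x) (hg.bound i hi a x)
  · rw [e _ le_rfl a, add_mul]
    simp only
    rw [sub_sub_sub_comm]
    exact norm_sub_le_of_le (hf.holder hσ a x y) (hg.holder hσ a x y)

lemma hasFDerivAt_p_apply_sub (hm : MemB σ m) (hv : MemB σ v) (hz : MemB σ z) (θ : E n) {t : ℝ}
    (ht : t ∈ Ici (0 : ℝ)) {p : E n} (hp : p ∈ B n) :
    HasFDerivAt (fun p => m θ t p (v θ t p) - z θ t p)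
      ((m θ t p).comp (dP v θ t p) + (dP m θ t p).flip (v θ t p) - dP z θ t p) p :=
  ((hm.diffP θ t ht p hp).hasFDerivAt.clm_apply (hv.diffP θ t ht p hp).hasFDerivAt).sub
    (hz.diffP θ t ht p hp).hasFDerivAt

lemma holderBd_apply_sub (hσ : 1 ≤ σ) (hm : MemB σ m) (hv : MemB σ v) (hz : MemB σ z)
    (hM : ∀ t ∈ Ici (0 : ℝ), ∀ p ∈ B n, HolderBd σ M fun θ => m θ t p)
    (hV : WBd σ L V v) (hN : WBd σ L N z) {t : ℝ} (ht : t ∈ Ici (0 : ℝ)) {p : E n}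
    (hp : p ∈ B n) :
    HolderBd σ ((16 * (n + 1) * M * V + N) * (1 + t) ^ (-L))
      fun θ => m θ t p (v θ t p) - z θ t p := by
  have h1 := HolderBd.bilinear (by linarith) (ContinuousLinearMap.id ℝ (F →L[ℝ] G))
    (fun x y => x.le_opNorm y) (hm.periodic' ht hp) (hv.periodic' ht hp)
    (hm.holder t ht p hp).1 (hv.holder t ht p hp).1 (hM t ht p hp) (hV.holder t ht p hp)
  refine (h1.sub (hN.holder t ht p hp)
    ((hm.holder t ht p hp).1.clm_apply (hv.holder t ht p hp).1) (hz.holder t ht p hp).1).mono ?_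
  apply le_of_eq
  ring

lemma memB_apply_sub (hσ : 1 ≤ σ) (hm : MemB σ m) (hv : MemB σ v) (hz : MemB σ z)
    (hM : ∀ t ∈ Ici (0 : ℝ), ∀ p ∈ B n, HolderBd σ M fun θ => m θ t p)
    (hV : WBd σ L V v) (hN : WBd σ L N z) :
    MemB σ fun θ t p => m θ t p (v θ t p) - z θ t p where
  periodic θ t ht p hp k := by
    rw [hm.periodic θ t ht p hp k, hv.periodic θ t ht p hp k, hz.periodic θ t ht p hp k]
  cont := (hm.cont.clm_apply hv.cont).sub hz.cont
  diffP θ _ ht _ hp := (hasFDerivAt_p_apply_sub hm hv hz θ ht hp).differentiableAt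
  contP := by
    have h1 := (ContinuousLinearMap.flipₗᵢ ℝ (E n) F G).continuous.comp_continuousOn hm.contP
    refine (((hm.cont.clm_comp hv.contP).add (h1.clm_apply hv.cont)).sub hz.contP).congr
      fun x hx => ?_
    exact (hasFDerivAt_p_apply_sub hm hv hz x.1 hx.2.1 hx.2.2).fderiv
  holder t ht p hp := (holderBd_apply_sub hσ hm hv hz hM hV hN ht hp).isHolder
    (((hm.holder t ht p hp).1.clm_apply (hv.holder t ht p hp).1).sub (hz.holder t ht p hp).1)

lemma wBd_apply_sub (hσ : 1 ≤ σ) (hm : MemB σ m) (hv : MemB σ v) (hz : MemB σ z)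
    (hM : ∀ t ∈ Ici (0 : ℝ), ∀ p ∈ B n, HolderBd σ M fun θ => m θ t p)
    (hMP : ∀ (θ : E n), ∀ t ∈ Ici (0 : ℝ), ∀ p ∈ B n, ‖dP m θ t p‖ ≤ M)
    (hV : WBd σ L V v) (hN : WBd σ L N z) :
    WBd σ L (16 * (n + 1) * M * V + N) fun θ t p => m θ t p (v θ t p) - z θ t p := by
  refine ⟨fun t ht p hp => holderBd_apply_sub hσ hm hv hz hM hV hN ht hp,
    fun θ t ht p hp => ?_⟩
  have ht' : (0 : ℝ) ≤ t := ht
  have hM0 := (hM t ht p hp).nonneg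
  have hV0 := hV.nonneg
  have hmn : ‖m θ t p‖ ≤ M := by
    have := (hM t ht p hp).bound 0 (Nat.zero_le _) Fin.elim0 θ
    rwa [partialD_zero] at this
  have hw : (1 + t) ^ (-L) ≤ (1 + t) ^ (1 - L) :=
    Real.rpow_le_rpow_of_exponent_le (by linarith) (by linarith)
  have h1 : ‖(m θ t p).comp (dP v θ t p)‖ ≤ M * (V * (1 + t) ^ (1 - L)) :=
    (ContinuousLinearMap.opNorm_comp_le _ _).trans
      (mul_le_mul hmn (hV.dP θ t ht p hp) (norm_nonneg _) hM0)
  have h2 : ‖(dP m θ t p).flip (v θ t p)‖ ≤ M * (V * (1 + t) ^ (1 - L)) := by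
    refine (ContinuousLinearMap.le_opNorm _ _).trans ?_
    rw [ContinuousLinearMap.opNorm_flip]
    exact mul_le_mul (hMP θ t ht p hp)
      ((hV.norm_le θ ht hp).trans (mul_le_mul_of_nonneg_left hw hV0)) (norm_nonneg _) hM0
  have h3 : dP (fun θ t p => m θ t p (v θ t p) - z θ t p) θ t p = _ :=
    (hasFDerivAt_p_apply_sub hm hv hz θ ht hp).fderiv
  rw [h3]
  refine (norm_sub_le_of_le (norm_add_le_of_le h1 h2) (hN.dP θ t ht p hp)).trans ?_
  have h4 : 0 ≤ M * V * (1 + t) ^ (1 - L) := by positivity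
  have h5 : 0 ≤ n * (M * V * (1 + t) ^ (1 - L)) := by positivity
  nlinarith

lemma contTheta_apply_sub (hσ : 1 ≤ σ) (hm : MemB σ m) (hv : MemB σ v) (hz : MemB σ z)
    (hmT : ContTheta m) (hvT : ContTheta v) (hzT : ContTheta z) :
    ContTheta fun θ t p => m θ t p (v θ t p) - z θ t p := by
  have h1 := (ContinuousLinearMap.flipₗᵢ ℝ (E n) F G).continuous.comp_continuousOn hmT
  refine (((hm.cont.clm_comp hvT).add (h1.clm_apply hv.cont)).sub hzT).congr fun x hx => ?_
  exact (((hm.differentiable hσ hx.2.1 hx.2.2 x.1).hasFDerivAt.clm_apply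
    (hv.differentiable hσ hx.2.1 hx.2.2 x.1).hasFDerivAt).sub
    (hz.differentiable hσ hx.2.1 hx.2.2 x.1).hasFDerivAt).fderiv

end Product

lemma norm_fderiv_le_of_c1NormB_le {K : ℝ} (hK : 0 ≤ K) {ω : E n → E n}
    (h : c1NormB ω ≤ ENNReal.ofReal K) {p : E n} (hp : p ∈ B n) : ‖fderiv ℝ ω p‖ ≤ K := by
  refine (enorm_le_ofReal_iff hK).1 (le_trans ?_ h)
  exact le_iSup_of_le p (le_iSup_of_le hp (le_max_right _ _))

lemma contTheta_of_holderBd {σ M : ℝ} {f : E n → ℝ → E n → F} (hσ : 1 ≤ σ) (hf : MemB σ f)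
    (hM : ∀ t ∈ Ici (0 : ℝ), ∀ p ∈ B n, HolderBd σ M fun θ => f θ t p)
    (h : σ = 1 → ContTheta f) : ContTheta f := by
  rcases hσ.eq_or_lt with h1 | h1
  · exact h h1.symm
  · exact contTheta_of_one_lt h1 hf hM

end LinOp

end

open LinOp
theorem linearized_operator_invertible
    (n : ℕ) (l K : ℝ) (hl : 1 < l) (hK : 0 ≤ K) :
    ∃ C : ℝ, 0 < C ∧
      ∀ (σ : ℝ) (ω : E n → E n) (m₀ : E n → ℝ → E n → (E n →L[ℝ] E n))
        (z g : E n → ℝ → E n → E n),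
        1 ≤ σ →
        ContDiffOn ℝ 1 ω (B n) → c1NormB ω ≤ ENNReal.ofReal K →
        MemB σ m₀ → wNorm σ 0 m₀ < ⊤ →
        MemB σ z → wNorm σ (l + 1) z < ⊤ →
        MemB σ g → wNorm σ (l + 2) g < ⊤ →
        -- needed in the limiting case `σ = 1` only; for `σ > 1` it follows from the above
        (σ = 1 → ContTheta m₀ ∧ ContTheta z ∧ ContTheta g) →
        ∃ u v : E n → ℝ → E n → E n,
          IsSolution σ l ω m₀ z g u v ∧
          ContTheta u ∧ ContTheta v ∧
          (∀ u' v' : E n → ℝ → E n → E n, IsSolution σ l ω m₀ z g u' v' →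
            ∀ (θ : E n), ∀ t ∈ Ici (0 : ℝ), ∀ p ∈ B n,
              u' θ t p = u θ t p ∧ v' θ t p = v θ t p) ∧
          max (wNorm σ l u) (wNorm σ (l + 1) (dOmega ω u)) ≤
            ENNReal.ofReal C * (wNorm σ 0 m₀ * wNorm σ (l + 2) g + wNorm σ (l + 1) z) ∧
          max (wNorm σ (l + 1) v) (wNorm σ (l + 2) (dOmega ω v)) ≤
            ENNReal.ofReal C * wNorm σ (l + 2) g := by
  obtain ⟨c₁, hc₁⟩ : ∃ c : ℝ, c = (n * K + 1) / (l + 2 - 2) := ⟨_, rfl⟩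
  obtain ⟨c₂, hc₂⟩ : ∃ c : ℝ, c = (n * K + 1) / (l + 1 - 2) := ⟨_, rfl⟩
  have hc₁0 : 0 ≤ c₁ := hc₁ ▸ div_nonneg (by positivity) (by linarith)
  have hc₂0 : 0 ≤ c₂ := hc₂ ▸ div_nonneg (by positivity) (by linarith)
  obtain ⟨d, hd0, hdm, hdg, hdz⟩ : ∃ d : ℝ, 1 ≤ d ∧ 16 * (n + 1) * (c₁ * 2 ^ (l + 2)) ≤ d ∧
      c₁ * 2 ^ (l + 2) ≤ d ∧ 2 ^ (l + 1) ≤ d := by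
    refine ⟨max (max 1 (16 * (n + 1) * (c₁ * 2 ^ (l + 2)))) (max (c₁ * 2 ^ (l + 2)) (2 ^ (l + 1))),
      ?_, ?_, ?_, ?_⟩ <;> simp
  refine ⟨6 * ((1 + c₂) * d), by positivity, ?_⟩
  intro σ ω m₀ z g hσ hω hωK hm hmN hz hzN hg hgN hT
  obtain ⟨M, hM0, hMe⟩ : ∃ M : ℝ, 0 ≤ M ∧ wNorm σ 0 m₀ = ENNReal.ofReal M :=
    ⟨_, ENNReal.toReal_nonneg, (ENNReal.ofReal_toReal hmN.ne).symm⟩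
  obtain ⟨Z, hZ0, hZe⟩ : ∃ Z : ℝ, 0 ≤ Z ∧ wNorm σ (l + 1) z = ENNReal.ofReal Z :=
    ⟨_, ENNReal.toReal_nonneg, (ENNReal.ofReal_toReal hzN.ne).symm⟩
  obtain ⟨Γ, hΓ0, hΓe⟩ : ∃ Γ : ℝ, 0 ≤ Γ ∧ wNorm σ (l + 2) g = ENNReal.ofReal Γ :=
    ⟨_, ENNReal.toReal_nonneg, (ENNReal.ofReal_toReal hgN.ne).symm⟩
  have hωd : ∀ p ∈ B n, ‖fderiv ℝ ω p‖ ≤ K := fun p hp => norm_fderiv_le_of_c1NormB_le hK hωK hp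
  have hmB : ∀ t ∈ Ici (0 : ℝ), ∀ p ∈ B n, HolderBd σ M fun θ => m₀ θ t p :=
    fun t ht p hp => (wNorm_zero_bounds hM0 hMe.le ht hp).1
  have hmP : ∀ (θ : E n), ∀ t ∈ Ici (0 : ℝ), ∀ p ∈ B n, ‖dP m₀ θ t p‖ ≤ M :=
    fun θ t ht p hp => (wNorm_zero_bounds hM0 hMe.le ht hp).2 θ
  have hzW := wBd_of_wNorm_le (by linarith) hZ0 hZe.le
  have hgW := wBd_of_wNorm_le (by linarith) hΓ0 hΓe.le
  have hmT : ContTheta m₀ := contTheta_of_holderBd hσ hm hmB fun h => (hT h).1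
  have hzT : ContTheta z := contTheta_of_holderBd hσ hz
    (fun t ht p hp => hzW.holderBd (by linarith) ht hp) fun h => (hT h).2.1
  have hgT : ContTheta g := contTheta_of_holderBd hσ hg
    (fun t ht p hp => hgW.holderBd (by linarith) ht hp) fun h => (hT h).2.2
  have hL₂ : 2 < l + 2 := by linarith
  have hL₁ : 2 < l + 1 := by linarith
  have e₂ : l + 2 - 1 = l + 1 := by ring
  have e₁ : l + 1 - 1 = l := by ring
  set v := charInt ω g with hv
  have hvA := admissible_charInt hσ hL₂ hω hωd hg hgT hgW
  have hvW := wBd_charInt hσ hL₂ hω hωd hg hgT hgW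
  have hvT : ContTheta v := contTheta_charInt hσ hL₂ hω hg hgT hgW
  have hvΩ : ∀ (θ : E n), ∀ t ∈ Ici (0 : ℝ), ∀ p ∈ B n, dOmega ω v θ t p = g θ t p :=
    fun θ t ht p hp => dOmega_charInt hσ hL₂ hω hg hgW θ ht hp
  rw [← hc₁] at hvW
  rw [e₂] at hvA hvW
  set f : E n → ℝ → E n → E n := fun θ t p => m₀ θ t p (v θ t p) - z θ t p with hf
  have hfB : MemB σ f := memB_apply_sub hσ hm hvA.mem hz hmB hvW hzW
  have hfW := wBd_apply_sub hσ hm hvA.mem hz hmB hmP hvW hzW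
  have hfT : ContTheta f := contTheta_apply_sub hσ hm hvA.mem hz hmT hvT hzT
  set u := charInt ω f with hu
  have huA := admissible_charInt hσ hL₁ hω hωd hfB hfT hfW
  have huW := wBd_charInt hσ hL₁ hω hωd hfB hfT hfW
  have huT : ContTheta u := contTheta_charInt hσ hL₁ hω hfB hfT hfW
  have huΩ : ∀ (θ : E n), ∀ t ∈ Ici (0 : ℝ), ∀ p ∈ B n, dOmega ω u θ t p = f θ t p :=
    fun θ t ht p hp => dOmega_charInt hσ hL₁ hω hfB hfW θ ht hp
  rw [← hc₂] at huW
  rw [e₁] at huA huW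
  have hsrc : 16 * (n + 1) * M * (c₁ * (2 ^ (l + 2) * Γ)) + 2 ^ (l + 1) * Z ≤ d * (M * Γ + Z) :=
    calc _ = 16 * (n + 1) * (c₁ * 2 ^ (l + 2)) * (M * Γ) + 2 ^ (l + 1) * Z := by ring
      _ ≤ d * (M * Γ) + d * Z :=
        add_le_add (mul_le_mul_of_nonneg_right hdm (mul_nonneg hM0 hΓ0))
          (mul_le_mul_of_nonneg_right hdz hZ0)
      _ = _ := by ring
  have hS : 0 ≤ d * (M * Γ + Z) := by positivity
  refine ⟨u, v, ⟨huA, hvA, fun θ t ht p hp => ?_, hvΩ⟩, huT, hvT, ?_, ?_, ?_⟩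
  · rw [huΩ θ t ht p hp, hf]
    exact sub_sub_cancel _ _
  · intro u' v' h'
    have hvv : ∀ (θ : E n), ∀ t ∈ Ici (0 : ℝ), ∀ p ∈ B n, v' θ t p = v θ t p :=
      fun θ t ht p hp => h'.admV.eq_of_dOmega_eq hσ hvA
        (fun θ t ht p hp => by rw [h'.eq₂ θ t ht p hp, hvΩ θ t ht p hp]) θ ht hp
    refine fun θ t ht p hp => ⟨h'.admU.eq_of_dOmega_eq hσ huA (fun θ t ht p hp => ?_) θ ht hp,
      hvv θ t ht p hp⟩
    rw [huΩ θ t ht p hp]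
    simp only [hf]
    rw [← h'.eq₁ θ t ht p hp, hvv θ t ht p hp, sub_sub_cancel]
  · rw [hMe, hΓe, hZe, ← ENNReal.ofReal_mul hM0, ← ENNReal.ofReal_add (mul_nonneg hM0 hΓ0) hZ0,
      ← ENNReal.ofReal_mul (by positivity)]
    refine max_le ((huW.wNorm_le hl.le).trans (ENNReal.ofReal_le_ofReal ?_)) ?_
    · have h1 := mul_le_mul_of_nonneg_left hsrc hc₂0
      linarith
    · rw [wNorm_congr huΩ]
      refine (hfW.wNorm_le (by linarith)).trans (ENNReal.ofReal_le_ofReal ?_)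
      have h1 := mul_nonneg hc₂0 hS
      linarith
  · rw [hΓe, ← ENNReal.ofReal_mul (by positivity)]
    have hdΓ : 0 ≤ d * Γ := by positivity
    have hc₂dΓ : 0 ≤ c₂ * (d * Γ) := by positivity
    refine max_le ((hvW.wNorm_le (by linarith)).trans (ENNReal.ofReal_le_ofReal ?_)) ?_
    · have h1 : c₁ * 2 ^ (l + 2) * Γ ≤ d * Γ := mul_le_mul_of_nonneg_right hdg hΓ0
      linarith
    · rw [wNorm_congr hvΩ, hΓe]
      refine ENNReal.ofReal_le_ofReal ?_
      have h1 : 1 * Γ ≤ d * Γ := mul_le_mul_of_nonneg_right hd0 hΓ0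
      linarith
end
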